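/- (Grünbaum–Aksionov) Every finite simple planar graph containing at most three triangles is 3-colorable, i.e., its chromatic number is at most 3. -/

import Mathlib

/-- `G` has an `H`-minor: there are pairwise disjoint branch sets in `G`,
each inducing a connected subgraph, with an edge of `G` between the branch sets
corresponding to each edge of `H`. -/
def SimpleGraph.HasMinor {V : Type*} {W : Type*} (G : SimpleGraph V) (H : SimpleGraph W) : Prop :=
  ∃ f : W → Set V,
    (∀ w, (G.induce (f w)).Connected) ∧
    (Pairwise fun w₁ w₂ => Disjoint (f w₁) (f w₂)) ∧
    (∀ ⦃w₁ w₂⦄, H.Adj w₁ w₂ → ∃ a ∈ f w₁, ∃ b ∈ f w₂, G.Adj a b)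

/-- A graph is outerplanar iff it has no `K₄` minor and no `K_{2,3}` minor. -/
def SimpleGraph.Outerplanar {V : Type*} (G : SimpleGraph V) : Prop :=
  ¬ G.HasMinor (completeGraph (Fin 4)) ∧
  ¬ G.HasMinor (completeBipartiteGraph (Fin 2) (Fin 3))

/-- Wagner's characterization: a graph is planar iff it has no `K₅` minor and
no `K_{3,3}` minor. -/
def SimpleGraph.IsPlanar {V : Type*} (G : SimpleGraph V) : Prop :=
  ¬ G.HasMinor (completeGraph (Fin 5)) ∧
  ¬ G.HasMinor (completeBipartiteGraph (Fin 3) (Fin 3))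

namespace SimpleGraph

open scoped Classical

set_option linter.unusedSectionVars false

universe u

section Chains

variable {V : Type*} [Fintype V]

/-- A mod-2 edge chain of `G`, as a symmetric function supported on the edges of `G`. -/
structure IsEdgeChain (G : SimpleGraph V) (Z : V → V → ZMod 2) : Prop where
  symm : ∀ u v, Z u v = Z v u
  supp : ∀ u v, Z u v ≠ 0 → G.Adj u v

/-- The boundary of an edge chain. -/
def bdry (Z : V → V → ZMod 2) (v : V) : ZMod 2 := ∑ u, Z v u

/-- Elements of the mod-2 cycle space of `G`. -/
structure IsEven (G : SimpleGraph V) (Z : V → V → ZMod 2) : Prop extends IsEdgeChain G Z where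
  bdry_eq : ∀ v, bdry Z v = 0

/-- The chain consisting of the single edge `ab`. -/
noncomputable def single (a b : V) (u v : V) : ZMod 2 :=
  if (u = a ∧ v = b) ∨ (u = b ∧ v = a) then 1 else 0

variable {G : SimpleGraph V} {Z Z₁ Z₂ : V → V → ZMod 2}

theorem zmod_two_cases (x : ZMod 2) : x = 0 ∨ x = 1 := by
  revert x; decide

theorem zmod_two_ne_zero {x : ZMod 2} : x ≠ 0 ↔ x = 1 := by
  revert x; decide

theorem zmod_two_add_eq_zero {x y : ZMod 2} : x + y = 0 ↔ x = y := by
  revert x y; decide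

theorem zmod_two_add_self (x : ZMod 2) : x + x = 0 := by
  revert x; decide

@[simp] theorem bdry_add (Z₁ Z₂ : V → V → ZMod 2) (v : V) :
    bdry (Z₁ + Z₂) v = bdry Z₁ v + bdry Z₂ v := by
  simp [bdry, Finset.sum_add_distrib]

@[simp] theorem bdry_smul (c : ZMod 2) (Z : V → V → ZMod 2) (v : V) :
    bdry (c • Z) v = c * bdry Z v := by
  simp [bdry, Finset.mul_sum]

@[simp] theorem bdry_zero (v : V) : bdry (0 : V → V → ZMod 2) v = 0 := by
  simp [bdry]

theorem single_comm (a b : V) : single a b = single b a := by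
  funext u v; simp only [single]; congr 1; exact propext or_comm

theorem single_symm (a b u v : V) : single a b u v = single a b v u := by
  simp only [single]; congr 1; apply propext; tauto

theorem bdry_single {a b : V} (h : a ≠ b) (v : V) :
    bdry (single a b) v = (if v = a then 1 else 0) + (if v = b then 1 else 0) := by
  unfold bdry single
  have : ∀ u, (if (v = a ∧ u = b) ∨ (v = b ∧ u = a) then (1 : ZMod 2) else 0)
      = (if u = b then (if v = a then 1 else 0) else 0)
        + (if u = a then (if v = b then 1 else 0) else 0) := by
    intro u
    by_cases h1 : v = a <;> by_cases h2 : v = b <;> by_cases h3 : u = a <;>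
      by_cases h4 : u = b <;> simp_all
  simp [this, Finset.sum_add_distrib]

theorem IsEdgeChain.add (h₁ : IsEdgeChain G Z₁) (h₂ : IsEdgeChain G Z₂) :
    IsEdgeChain G (Z₁ + Z₂) where
  symm u v := by simp [h₁.symm u v, h₂.symm u v]
  supp u v h := by
    by_contra hn
    have e₁ : Z₁ u v = 0 := by by_contra hh; exact hn (h₁.supp _ _ hh)
    have e₂ : Z₂ u v = 0 := by by_contra hh; exact hn (h₂.supp _ _ hh)
    simp [e₁, e₂] at h

theorem IsEdgeChain.zero : IsEdgeChain G (0 : V → V → ZMod 2) where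
  symm := by simp
  supp := by simp

theorem IsEdgeChain.smul (c : ZMod 2) (h : IsEdgeChain G Z) : IsEdgeChain G (c • Z) where
  symm u v := by simp [h.symm u v]
  supp u v hh := h.supp u v (by intro h0; simp [h0] at hh)

theorem IsEdgeChain.mono {G' : SimpleGraph V} (hG : G ≤ G') (h : IsEdgeChain G Z) :
    IsEdgeChain G' Z where
  symm := h.symm
  supp u v hh := hG (h.supp u v hh)

theorem IsEdgeChain.eq_zero (h : IsEdgeChain G Z) {u v : V} (huv : ¬ G.Adj u v) : Z u v = 0 := by
  by_contra hh; exact huv (h.supp _ _ hh)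

theorem isEdgeChain_single {a b : V} (h : G.Adj a b) : IsEdgeChain G (single a b) where
  symm := single_symm a b
  supp u v hh := by
    unfold single at hh
    split_ifs at hh with h1
    · rcases h1 with ⟨rfl, rfl⟩ | ⟨rfl, rfl⟩
      · exact h
      · exact h.symm
    · simp at hh

theorem IsEven.add (h₁ : IsEven G Z₁) (h₂ : IsEven G Z₂) : IsEven G (Z₁ + Z₂) where
  toIsEdgeChain := h₁.toIsEdgeChain.add h₂.toIsEdgeChain
  bdry_eq v := by simp [h₁.bdry_eq, h₂.bdry_eq]

theorem IsEven.smul (c : ZMod 2) (h : IsEven G Z) : IsEven G (c • Z) where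
  toIsEdgeChain := h.toIsEdgeChain.smul c
  bdry_eq v := by simp [h.bdry_eq]

theorem IsEven.mono {G' : SimpleGraph V} (hG : G ≤ G') (h : IsEven G Z) : IsEven G' Z where
  toIsEdgeChain := h.toIsEdgeChain.mono hG
  bdry_eq := h.bdry_eq

end Chains

section Labellings

variable {V : Type*} [Fintype V]

/-- No vertex of `G` is a cut vertex, in terms of vertex partitions. -/
def NoCutVertex (G : SimpleGraph V) : Prop :=
  ∀ (v : V) (X : Set V), v ∉ X → X.Nonempty → (∃ w, w ∉ X ∧ w ≠ v) →
    ∃ a ∈ X, ∃ b, b ∉ X ∧ b ≠ v ∧ G.Adj a b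

/-- The dual coboundary of a function on face labels: an edge is in it when its two
sides carry labels with different values. -/
noncomputable def cob {ι : Type*} (G : SimpleGraph V) (φ : V → V → ι) (s : ι → ZMod 2) (u v : V) :
    ZMod 2 :=
  if G.Adj u v then s (φ u v) + s (φ v u) else 0

/-- `φ` labels the two sides of every edge by faces so that the boundaries of sets of faces are
exactly the elements of the cycle space. -/
structure IsFaceLabelling {ι : Type*} (G : SimpleGraph V) (φ : V → V → ι) : Prop where
  isEven : ∀ s, IsEven G (cob G φ s)
  span : ∀ Z, IsEven G Z → ∃ s, cob G φ s = Z

/-- MacLane's algebraic form of planarity. -/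
def IsMacLane (G : SimpleGraph V) : Prop :=
  ∃ (ι : Type) (_ : Finite ι) (φ : V → V → ι), IsFaceLabelling G φ

/-- The boundary of the face labelled `i`. -/
noncomputable def face {ι : Type*} (G : SimpleGraph V) (φ : V → V → ι) (i : ι) : V → V → ZMod 2 :=
  cob G φ (Pi.single i 1)

variable {ι : Type*} {G : SimpleGraph V} {φ : V → V → ι} {Z : V → V → ZMod 2}

theorem cob_add (s t : ι → ZMod 2) : cob G φ (s + t) = cob G φ s + cob G φ t := by
  funext u v
  simp only [cob, Pi.add_apply]
  split_ifs
  · ring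
  · simp

theorem cob_one : cob G φ 1 = 0 := by
  funext u v
  simp only [cob, Pi.one_apply, Pi.zero_apply]
  split_ifs
  · decide
  · rfl

theorem cob_apply (s : ι → ZMod 2) {u v : V} (h : G.Adj u v) :
    cob G φ s u v = s (φ u v) + s (φ v u) := by
  simp [cob, h]

/-- In a graph without cut vertices, two vertices other than `v` are joined by a chain
avoiding `v`. -/
theorem NoCutVertex.exists_chain (h : NoCutVertex G) {v a b : V} (ha : a ≠ v) (hb : b ≠ v) :
    ∃ Z, IsEdgeChain G Z ∧ (∀ u, Z v u = 0) ∧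
      ∀ w, bdry Z w = (if w = a then 1 else 0) + (if w = b then 1 else 0) := by
  by_contra hcon
  let X : Set V := {b | b ≠ v ∧ ∃ Z, IsEdgeChain G Z ∧ (∀ u, Z v u = 0) ∧
      ∀ w, bdry Z w = (if w = a then 1 else 0) + (if w = b then 1 else 0)}
  obtain ⟨c, ⟨hc, Z, hZ, hZv, hZb⟩, d, hd, hdv, hcd⟩ := h v X (by simp [X])
    ⟨a, ha, 0, .zero, by simp, by intro w; simp [zmod_two_add_self]⟩
    ⟨b, fun hbX => hcon hbX.2, hb⟩
  refine hd ⟨hdv, Z + single c d, hZ.add (isEdgeChain_single hcd), ?_, ?_⟩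
  · intro u
    simp [hZv, single, hc.symm, hdv.symm]
  · intro w
    rw [bdry_add, hZb, bdry_single hcd.ne]
    generalize (if w = a then (1 : ZMod 2) else 0) = x
    generalize (if w = c then (1 : ZMod 2) else 0) = y
    generalize (if w = d then (1 : ZMod 2) else 0) = z
    revert x y z; decide

/-- A local cocycle at a vertex that is not a cut vertex is constant. -/
theorem NoCutVertex.eq_of_orthogonal (h : NoCutVertex G) {v a b : V} (α : V → ZMod 2)
    (hα : ∀ Z, IsEven G Z → ∑ u, α u * Z v u = 0) (ha : G.Adj v a) (hb : G.Adj v b) :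
    α a = α b := by
  by_cases hab : a = b
  · rw [hab]
  obtain ⟨Z, hZ, hZv, hZb⟩ := h.exists_chain ha.ne' hb.ne'
  have key := hα (Z + single v a + single v b)
    ⟨(hZ.add (isEdgeChain_single ha)).add (isEdgeChain_single hb), by
      intro w
      rw [bdry_add, bdry_add, hZb, bdry_single ha.ne, bdry_single hb.ne]
      generalize (if w = a then (1 : ZMod 2) else 0) = x
      generalize (if w = b then (1 : ZMod 2) else 0) = y
      generalize (if w = v then (1 : ZMod 2) else 0) = z
      revert x y z; decide⟩
  have e : ∀ u, α u * (Z + single v a + single v b) v u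
      = (if u = a then α u else 0) + (if u = b then α u else 0) := by
    intro u
    have h1 : single v a v u = if u = a then 1 else 0 := by
      simp [single, ha.ne]
    have h2 : single v b v u = if u = b then 1 else 0 := by
      simp [single, hb.ne]
    simp only [Pi.add_apply, hZv, h1, h2]
    split_ifs <;> ring
  simp only [e, Finset.sum_add_distrib, Finset.sum_ite_eq', Finset.mem_univ, if_true] at key
  exact zmod_two_add_eq_zero.1 key

/-- Around a vertex not on the boundary of a set of faces, all labels lie on the same side. -/
theorem IsFaceLabelling.eq_at_vertex (hφ : IsFaceLabelling G φ) (h : NoCutVertex G)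
    {s : ι → ZMod 2} {v a b : V} (hv : ∀ u, cob G φ s v u = 0) (ha : G.Adj v a)
    (hb : G.Adj v b) : s (φ v a) = s (φ v b) := by
  refine h.eq_of_orthogonal (fun u => s (φ v u)) ?_ ha hb
  intro Z hZ
  obtain ⟨t, rfl⟩ := hφ.span Z hZ
  have e : ∀ u, s (φ v u) * cob G φ t v u = cob G φ (s * t) v u := by
    intro u
    by_cases huv : G.Adj v u
    · have := hv u
      rw [cob_apply _ huv] at this
      rw [cob_apply _ huv, cob_apply _ huv, Pi.mul_apply, Pi.mul_apply,
        zmod_two_add_eq_zero.1 this]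
      ring
    · simp [cob, huv]
  simp only [e]
  exact (hφ.isEven (s * t)).bdry_eq v

/-- Every edge of a graph without cut vertices (and with at least three vertices) has two different
faces on its sides. -/
theorem IsFaceLabelling.ne_of_adj (hφ : IsFaceLabelling G φ) (h : NoCutVertex G)
    {v a b : V} (ha : G.Adj v a) (hb : G.Adj v b) (hab : a ≠ b) : φ v a ≠ φ a v := by
  intro hl
  have : (fun u => if u = a then (1 : ZMod 2) else 0) a
      = (fun u => if u = a then (1 : ZMod 2) else 0) b := by
    refine h.eq_of_orthogonal (fun u => if u = a then (1 : ZMod 2) else 0) ?_ ha hb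
    intro Z hZ
    obtain ⟨t, rfl⟩ := hφ.span Z hZ
    simp [cob_apply _ ha, hl, zmod_two_add_self]
  simp [hab.symm] at this

/-- If the boundary of a set of faces avoids `v` but one of these faces is at `v`, then all edges at
`v` have only such faces on their sides. -/
theorem IsFaceLabelling.mem_of_closed (hφ : IsFaceLabelling G φ) (h : NoCutVertex G)
    {S : Finset ι} {v a b : V} (hv : ∀ u, ∑ i ∈ S, face G φ i v u = 0)
    (ha : ∃ i ∈ S, face G φ i v a ≠ 0) (hb : G.Adj v b) : ∃ i ∈ S, face G φ i v b ≠ 0 := by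
  have hsum : ∀ T : Finset ι, cob G φ (∑ i ∈ T, Pi.single i 1) = ∑ i ∈ T, face G φ i := by
    intro T
    induction T using Finset.induction_on with
    | empty => funext u v; simp [cob]
    | insert i T hi ih => rw [Finset.sum_insert hi, Finset.sum_insert hi, cob_add, ih]; rfl
  set s : ι → ZMod 2 := ∑ i ∈ S, Pi.single i 1 with hs
  have hsv : ∀ j, s j = if j ∈ S then 1 else 0 := by
    intro j
    simp [hs, Finset.sum_apply, Pi.single_apply]
  have hv' : ∀ u, cob G φ s v u = 0 := by
    intro u
    rw [hsum]
    simpa using hv u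
  obtain ⟨i, hi, hia⟩ := ha
  have hva : G.Adj v a := (hφ.isEven _).supp _ _ hia
  by_cases hab : a = b
  · exact ⟨i, hi, hab ▸ hia⟩
  have h1 : s (φ v a) = 1 := by
    have h0 := hv' a
    rw [cob_apply _ hva, zmod_two_add_eq_zero] at h0
    simp only [face, cob_apply _ hva, Pi.single_apply] at hia
    by_cases hh : φ v a = i
    · rw [hsv, hh, if_pos hi]
    · by_cases hh' : φ a v = i
      · rw [h0, hsv, hh', if_pos hi]
      · simp [hh, hh'] at hia
  have h2 : s (φ v b) = 1 := by rw [← hφ.eq_at_vertex h hv' hva hb, h1]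
  have hne := hφ.ne_of_adj h hb hva (Ne.symm hab)
  refine ⟨φ v b, ?_, ?_⟩
  · rw [hsv] at h2
    by_contra hn
    simp [hn] at h2
  · rw [face, cob_apply _ hb]
    simp [hne.symm]

end Labellings

section Circuits

variable {V : Type*} [Fintype V] {ι : Type*} {G : SimpleGraph V} {φ : V → V → ι}
  {C Z : V → V → ZMod 2}

/-- A nonempty even chain contained in the boundary of a face is the whole boundary. -/
theorem IsFaceLabelling.eq_face_of_le (hφ : IsFaceLabelling G φ) (h : NoCutVertex G) {i : ι}
    (hC : IsEven G C) (hC0 : C ≠ 0) (hCi : ∀ u v, C u v ≠ 0 → face G φ i u v ≠ 0) :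
    C = face G φ i := by
  obtain ⟨s, hs, hsi⟩ : ∃ s, cob G φ s = C ∧ s i = 0 := by
    obtain ⟨s, hs⟩ := hφ.span C hC
    rcases zmod_two_cases (s i) with h0 | h1
    · exact ⟨s, hs, h0⟩
    · refine ⟨s + 1, by rw [cob_add, cob_one, hs, add_zero], ?_⟩
      simp only [Pi.add_apply, Pi.one_apply, h1]
      rfl
  let α : V → V → ZMod 2 := fun v u =>
    s (φ v u) + s (φ u v) + s (φ v u) * s (φ u v)
  have αsymm : ∀ u v, α u v = α v u := fun u v => by simp only [α]; ring
  have key : ∀ v a b, G.Adj v a → G.Adj v b → α v a = α v b := by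
    intro v a b ha hb
    refine h.eq_of_orthogonal (α v) ?_ ha hb
    intro Z hZ
    obtain ⟨t, rfl⟩ := hφ.span Z hZ
    have e : ∀ u, α v u * cob G φ t v u = cob G φ (s * t) v u + t i * C v u := by
      intro u
      by_cases hvu : G.Adj v u
      · have hci := hCi v u
        rw [← hs, face, cob_apply _ hvu, cob_apply _ hvu] at hci
        rw [← hs, cob_apply _ hvu, cob_apply _ hvu, cob_apply _ hvu]
        simp only [α, Pi.mul_apply]
        by_cases h1 : φ v u = i
        · by_cases h2 : φ u v = i
          · simp [h1, h2, hsi]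
          · rw [h1, hsi]
            rcases zmod_two_cases (s (φ u v)) with h3 | h3 <;> rw [h3] <;> ring
        · by_cases h2 : φ u v = i
          · rw [h2, hsi]
            rcases zmod_two_cases (s (φ v u)) with h3 | h3 <;> rw [h3] <;> ring
          · simp only [Pi.single_apply, h1, h2, if_false, add_zero, ne_eq, not_true_eq_false,
              imp_false, not_not] at hci
            rw [zmod_two_add_eq_zero.1 hci]
            generalize s (φ u v) = x, t (φ u v) = y, t (φ v u) = z, t i = w
            revert x y z w; decide
      · rw [hC.eq_zero hvu]; simp [cob, hvu]
    simp only [e, Finset.sum_add_distrib, ← Finset.mul_sum]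
    have h1 := (hφ.isEven (s * t)).bdry_eq v
    have h2 := hC.bdry_eq v
    rw [bdry] at h1 h2
    rw [h1, h2]; simp
  have all : ∀ p q, G.Adj p q → α p q = 1 := by
    obtain ⟨x, y, hxy⟩ : ∃ x y, C x y ≠ 0 := by
      by_contra hn
      push Not at hn
      exact hC0 (by funext x y; simpa using hn x y)
    have hxyG := hC.supp _ _ hxy
    have hα1 : α x y = 1 := by
      have : C x y = 1 := zmod_two_ne_zero.1 hxy
      rw [← hs, cob_apply _ hxyG] at this
      simp only [α]
      generalize s (φ x y) = a, s (φ y x) = b at *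
      revert a b; decide
    intro p q hpq
    by_contra hn
    have hP : ∀ u, G.Adj p u → α p u ≠ 1 := fun u hu => by rwa [key p u q hu hpq]
    have hQ : ∀ u, G.Adj q u → α q u ≠ 1 := fun u hu => by
      rwa [key q u p hu hpq.symm, αsymm]
    obtain ⟨a, ⟨a', haa, ha1⟩, b, hb, -, hab⟩ := h q {v | ∃ u, G.Adj v u ∧ α v u = 1}
      (fun ⟨u, hu, hu1⟩ => hQ u hu hu1) ⟨x, y, hxyG, hα1⟩
      ⟨p, fun ⟨u, hu, hu1⟩ => hP u hu hu1, hpq.ne⟩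
    exact hb ⟨a, hab.symm, by rw [αsymm, key a b a' hab haa, ha1]⟩
  funext u v
  by_cases huv : G.Adj u v
  · rcases zmod_two_cases (face G φ i u v) with h0 | h1
    · rw [h0]; by_contra hn; exact hCi u v hn h0
    · rw [h1]
      have hα := all u v huv
      rw [← hs, cob_apply _ huv]
      rw [face, cob_apply _ huv] at h1
      simp only [α] at hα
      by_cases h3 : φ u v = i
      · rw [h3, hsi] at hα ⊢
        simpa using hα
      · by_cases h4 : φ v u = i
        · rw [h4, hsi] at hα ⊢
          simpa using hα
        · simp [h3, h4] at h1
  · rw [hC.eq_zero huv]; simp [face, cob, huv]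

/-- A minimal nonempty even chain. -/
structure IsCircuit (G : SimpleGraph V) (C : V → V → ZMod 2) : Prop extends IsEven G C where
  ne_zero : C ≠ 0
  eq_of_le : ∀ Z, IsEven G Z → Z ≠ 0 → (∀ u v, Z u v ≠ 0 → C u v ≠ 0) → Z = C

/-- An induced circuit which does not bound a face separates the graph. -/
theorem IsFaceLabelling.exists_face_or_separation (hφ : IsFaceLabelling G φ) (h : NoCutVertex G)
    (hC : IsCircuit G C)
    (hind : ∀ u v, G.Adj u v → C u v = 0 → (∀ w, C u w = 0) ∨ ∀ w, C v w = 0) :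
    (∃ i, face G φ i = C) ∨ ∃ X : Set V, X.Nonempty ∧ (∀ v ∈ X, ∀ w, C v w = 0) ∧
      (∃ v, v ∉ X ∧ ∀ w, C v w = 0) ∧
      ∀ u v, u ∈ X → G.Adj u v → (∃ w, C v w ≠ 0) ∨ v ∈ X := by
  by_contra hcon
  rw [not_or] at hcon
  obtain ⟨hcon1, hcon2⟩ := hcon
  have main : ∀ s, cob G φ s = C → ∃ u v, G.Adj u v ∧ (∀ w, C u w = 0) ∧ s (φ u v) = 0 := by
    intro s hs
    by_contra hn
    push Not at hn
    obtain ⟨x, y, hxy⟩ : ∃ x y, C x y ≠ 0 := by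
      by_contra hn
      push Not at hn
      exact hC.ne_zero (by funext x y; simpa using hn x y)
    have hxyG := hC.supp _ _ hxy
    have h1 : C x y = 1 := zmod_two_ne_zero.1 hxy
    rw [← hs, cob_apply _ hxyG] at h1
    obtain ⟨i, hi0, hi⟩ : ∃ i, s i = 0 ∧ face G φ i x y ≠ 0 := by
      have hne : φ x y ≠ φ y x := by
        intro he; rw [he, zmod_two_add_self] at h1; exact zero_ne_one h1
      rcases zmod_two_cases (s (φ x y)) with h2 | h2
      · exact ⟨φ x y, h2, by simp [face, cob_apply _ hxyG, hne.symm]⟩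
      · refine ⟨φ y x, ?_, by simp [face, cob_apply _ hxyG, hne]⟩
        rw [h2] at h1
        generalize s (φ y x) = z at *
        revert z; decide
    refine hcon1 ⟨i, hC.eq_of_le _ (hφ.isEven _)
      (fun h0 => hi (by rw [show face G φ i = 0 from h0]; rfl))
      ?_⟩
    intro u v huv hC0
    have hadj := (hφ.isEven _).supp _ _ huv
    have hs0 : s (φ u v) = s (φ v u) := by
      rw [← hs, cob_apply _ hadj] at hC0; exact zmod_two_add_eq_zero.1 hC0
    have hs1 : s (φ u v) ≠ 0 := by
      rcases hind u v hadj hC0 with hu | hv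
      · exact hn u v hadj hu
      · rw [hs0]; exact hn v u hadj.symm hv
    have hs2 : s (φ v u) ≠ 0 := hs0 ▸ hs1
    refine huv ?_
    rw [face, cob_apply _ hadj, Pi.single_eq_of_ne, Pi.single_eq_of_ne, add_zero]
    · rintro rfl; exact hs2 hi0
    · rintro rfl; exact hs1 hi0
  obtain ⟨s, hs⟩ := hφ.span C hC.toIsEven
  obtain ⟨a, b, hab, ha, hsa⟩ := main s hs
  obtain ⟨a', b', hab', ha', hsa'⟩ := main (s + 1) (by rw [cob_add, cob_one, hs, add_zero])
  have hsa1 : s (φ a' b') = 1 := by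
    rw [Pi.add_apply, Pi.one_apply] at hsa'
    exact zmod_two_add_eq_zero.1 hsa'
  refine hcon2 ⟨{v | (∀ w, C v w = 0) ∧ ∃ u, G.Adj v u ∧ s (φ v u) = 0}, ⟨a, ha, b, hab, hsa⟩,
    fun v hv => hv.1, ⟨a', ?_, ha'⟩, ?_⟩
  · rintro ⟨-, u, hu, hu0⟩
    have := hφ.eq_at_vertex h (s := s) (by rw [hs]; exact ha') hu hab'
    rw [hu0, hsa1] at this
    exact zero_ne_one this
  · rintro u v ⟨hu, w, hw, hw0⟩ huv
    by_cases hv : ∃ w, C v w ≠ 0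
    · exact Or.inl hv
    · push Not at hv
      refine Or.inr ⟨hv, u, huv.symm, ?_⟩
      have h1 := hφ.eq_at_vertex h (s := s) (by rw [hs]; exact hu) hw huv
      have h2 := hu v
      rw [← hs, cob_apply _ huv] at h2
      rw [← zmod_two_add_eq_zero.1 h2, ← h1, hw0]

end Circuits

section ShortCycles

variable {V : Type*} [Fintype V] {G : SimpleGraph V}

/-- The chain of a triangle. -/
noncomputable def tri (a b c : V) : V → V → ZMod 2 := single a b + single b c + single c a

/-- The chain of a 4-cycle. -/
noncomputable def quad (a b c d : V) : V → V → ZMod 2 :=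
  single a b + single b c + single c d + single d a

theorem isEven_tri {a b c : V} (hab : G.Adj a b) (hbc : G.Adj b c) (hca : G.Adj c a) :
    IsEven G (tri a b c) where
  toIsEdgeChain := ((isEdgeChain_single hab).add (isEdgeChain_single hbc)).add
    (isEdgeChain_single hca)
  bdry_eq v := by
    simp only [tri, bdry_add, bdry_single hab.ne, bdry_single hbc.ne, bdry_single hca.ne]
    generalize (if v = a then (1 : ZMod 2) else 0) = x
    generalize (if v = b then (1 : ZMod 2) else 0) = y
    generalize (if v = c then (1 : ZMod 2) else 0) = z
    revert x y z; decide

theorem isEven_quad {a b c d : V} (hab : G.Adj a b) (hbc : G.Adj b c) (hcd : G.Adj c d)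
    (hda : G.Adj d a) : IsEven G (quad a b c d) where
  toIsEdgeChain := (((isEdgeChain_single hab).add (isEdgeChain_single hbc)).add
    (isEdgeChain_single hcd)).add (isEdgeChain_single hda)
  bdry_eq v := by
    simp only [quad, bdry_add, bdry_single hab.ne, bdry_single hbc.ne, bdry_single hcd.ne,
      bdry_single hda.ne]
    generalize (if v = a then (1 : ZMod 2) else 0) = x
    generalize (if v = b then (1 : ZMod 2) else 0) = y
    generalize (if v = c then (1 : ZMod 2) else 0) = z
    generalize (if v = d then (1 : ZMod 2) else 0) = w
    revert x y z w; decide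

theorem single_ne_zero_iff {a b u v : V} :
    single a b u v ≠ 0 ↔ (u = a ∧ v = b) ∨ (u = b ∧ v = a) := by
  rw [single]; split_ifs with h <;> simp [h]

theorem tri_eq {a b c : V} (hab : a ≠ b) (hbc : b ≠ c) (hca : c ≠ a) (u v : V) :
    tri a b c u v = if (u = a ∧ v = b) ∨ (u = b ∧ v = a) ∨ (u = b ∧ v = c) ∨ (u = c ∧ v = b) ∨
      (u = c ∧ v = a) ∨ (u = a ∧ v = c) then 1 else 0 := by
  simp only [tri, single, Pi.add_apply]
  grind -ring -linarith

theorem quad_eq {a b c d : V} (hab : a ≠ b) (hbc : b ≠ c) (hcd : c ≠ d) (hda : d ≠ a)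
    (hac : a ≠ c) (hbd : b ≠ d) (u v : V) :
    quad a b c d u v = if (u = a ∧ v = b) ∨ (u = b ∧ v = a) ∨ (u = b ∧ v = c) ∨ (u = c ∧ v = b) ∨
      (u = c ∧ v = d) ∨ (u = d ∧ v = c) ∨ (u = d ∧ v = a) ∨ (u = a ∧ v = d) then 1 else 0 := by
  simp only [quad, single, Pi.add_apply]
  grind -ring -linarith

theorem bdry_eq_two {Z : V → V → ZMod 2} {a b v : V} (hab : a ≠ b)
    (h : ∀ u, u ≠ a → u ≠ b → Z v u = 0) : bdry Z v = Z v a + Z v b := by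
  rw [bdry, ← Finset.sum_pair hab]
  refine (Finset.sum_subset (Finset.subset_univ _) ?_).symm
  intro u _ hu
  simp only [Finset.mem_insert, Finset.mem_singleton, not_or] at hu
  exact h u hu.1 hu.2

theorem isCircuit_tri {a b c : V} (hab : G.Adj a b) (hbc : G.Adj b c) (hca : G.Adj c a) :
    IsCircuit G (tri a b c) where
  toIsEven := isEven_tri hab hbc hca
  ne_zero h := by
    have := congrFun (congrFun h a) b
    simp [tri_eq hab.ne hbc.ne hca.ne] at this
  eq_of_le Z hZ hZ0 hle := by
    simp only [tri_eq hab.ne hbc.ne hca.ne] at hle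
    have h1 := hZ.bdry_eq a
    have h2 := hZ.bdry_eq b
    have := hab.ne
    have := hbc.ne
    have := hca.ne
    rw [bdry_eq_two hbc.ne (by grind -ring -linarith)] at h1
    rw [bdry_eq_two hca.ne (by grind -ring -linarith)] at h2
    rw [zmod_two_add_eq_zero] at h1 h2
    have s1 := hZ.symm a b
    have s2 := hZ.symm b c
    have s3 := hZ.symm c a
    have h3 : Z a b ≠ 0 := by
      intro h0
      refine hZ0 ?_
      funext u v
      rw [Pi.zero_apply, Pi.zero_apply]
      by_contra hn
      have := hle u v hn
      grind -ring -linarith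
    rw [zmod_two_ne_zero] at h3
    funext u v
    rw [tri_eq hab.ne hbc.ne hca.ne]
    have := hle u v
    split_ifs with h
    · grind -ring -linarith
    · grind -ring -linarith

theorem isCircuit_quad {a b c d : V} (hab : G.Adj a b) (hbc : G.Adj b c) (hcd : G.Adj c d)
    (hda : G.Adj d a) (hac : a ≠ c) (hbd : b ≠ d) : IsCircuit G (quad a b c d) where
  toIsEven := isEven_quad hab hbc hcd hda
  ne_zero h := by
    have := congrFun (congrFun h a) b
    simp [quad_eq hab.ne hbc.ne hcd.ne hda.ne hac hbd] at this
  eq_of_le Z hZ hZ0 hle := by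
    simp only [quad_eq hab.ne hbc.ne hcd.ne hda.ne hac hbd] at hle
    have h1 := hZ.bdry_eq a
    have h2 := hZ.bdry_eq b
    have h4 := hZ.bdry_eq c
    have := hab.ne
    have := hbc.ne
    have := hcd.ne
    have := hda.ne
    rw [bdry_eq_two hbd (by grind -ring -linarith)] at h1
    rw [bdry_eq_two hac (by grind -ring -linarith)] at h2
    rw [bdry_eq_two hbd (by grind -ring -linarith)] at h4
    rw [zmod_two_add_eq_zero] at h1 h2 h4
    have s1 := hZ.symm a b
    have s2 := hZ.symm b c
    have s3 := hZ.symm c d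
    have s4 := hZ.symm d a
    have h3 : Z a b ≠ 0 := by
      intro h0
      refine hZ0 ?_
      funext u v
      rw [Pi.zero_apply, Pi.zero_apply]
      by_contra hn
      have := hle u v hn
      grind -ring -linarith
    rw [zmod_two_ne_zero] at h3
    funext u v
    rw [quad_eq hab.ne hbc.ne hcd.ne hda.ne hac hbd]
    have := hle u v
    split_ifs with h
    · grind -ring -linarith
    · grind -ring -linarith

end ShortCycles

section Crossing

variable {V : Type*} [Fintype V] {ι : Type*} {G : SimpleGraph V} {φ : V → V → ι}

/-- Two paths of length three joining the two opposite pairs of vertices of a 4-face meet. -/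
theorem IsFaceLabelling.not_crossing (hφ : IsFaceLabelling G φ) (h : NoCutVertex G) {i : ι}
    {v₀ v₁ v₂ v₃ a b c d : V} (hi : face G φ i = quad v₀ v₁ v₂ v₃)
    (h01 : G.Adj v₀ v₁) (h12 : G.Adj v₁ v₂) (h23 : G.Adj v₂ v₃) (h30 : G.Adj v₃ v₀)
    (h02 : v₀ ≠ v₂) (h13 : v₁ ≠ v₃)
    (h0a : G.Adj v₀ a) (hab : G.Adj a b) (hb2 : G.Adj b v₂)
    (h1c : G.Adj v₁ c) (hcd : G.Adj c d) (hd3 : G.Adj d v₃)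
    (ha1 : a ≠ v₁) (ha3 : a ≠ v₃) (hb1 : b ≠ v₁) (hb3 : b ≠ v₃)
    (hc0 : c ≠ v₀) (hc2 : c ≠ v₂) (hc3 : c ≠ v₃) (hd0 : d ≠ v₀) (hd2 : d ≠ v₂)
    (hac : a ≠ c) (had : a ≠ d) (hbc : b ≠ c) (hbd : b ≠ d) : False := by
  have hZ : IsEven G (single v₀ a + single a b + single b v₂ + single v₂ v₁ + single v₁ v₀) :=
    { toIsEdgeChain := ((((isEdgeChain_single h0a).add (isEdgeChain_single hab)).add
        (isEdgeChain_single hb2)).add (isEdgeChain_single h12.symm)).add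
        (isEdgeChain_single h01.symm)
      bdry_eq := fun v => by
        simp only [bdry_add, bdry_single h0a.ne, bdry_single hab.ne, bdry_single hb2.ne,
          bdry_single h12.ne', bdry_single h01.ne']
        generalize (if v = v₀ then (1 : ZMod 2) else 0) = x₁
        generalize (if v = a then (1 : ZMod 2) else 0) = x₂
        generalize (if v = b then (1 : ZMod 2) else 0) = x₃
        generalize (if v = v₁ then (1 : ZMod 2) else 0) = x₄
        generalize (if v = v₂ then (1 : ZMod 2) else 0) = x₅
        revert x₁ x₂ x₃ x₄ x₅; decide }
  obtain ⟨s, hs, hsi⟩ : ∃ s, cob G φ s = _ ∧ s i = 0 := by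
    obtain ⟨s, hs⟩ := hφ.span _ hZ
    rcases zmod_two_cases (s i) with h0 | h1
    · exact ⟨s, hs, h0⟩
    · refine ⟨s + 1, by rw [cob_add, cob_one, hs, add_zero], ?_⟩
      simp only [Pi.add_apply, Pi.one_apply, h1]
      rfl
  obtain ⟨r, hr⟩ : ∃ r : ι → ZMod 2, r = s + Pi.single i 1 := ⟨_, rfl⟩
  have hs' : cob G φ r = single v₀ a + single a b + single b v₂ + single v₂ v₃ + single v₃ v₀ := by
    rw [hr, cob_add, hs]
    change _ + face G φ i = _
    rw [hi, quad, single_comm v₂ v₁, single_comm v₁ v₀]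
    funext x y
    simp only [Pi.add_apply]
    generalize single v₀ a x y = x₁, single a b x y = x₂, single b v₂ x y = x₃,
      single v₁ v₂ x y = x₄, single v₀ v₁ x y = x₅, single v₂ v₃ x y = x₆,
      single v₃ v₀ x y = x₇
    revert x₁ x₂ x₃ x₄ x₅ x₆ x₇; decide
  have hzero : ∀ w, w ≠ v₀ → w ≠ a → w ≠ b → w ≠ v₂ → w ≠ v₃ → ∀ u,
      cob G φ r w u = 0 := by
    intro w k0 ka kb k2 k3 u
    rw [hs']
    simp [single, k0, ka, kb, k2, k3]
  have hzero' : ∀ w, w ≠ v₀ → w ≠ a → w ≠ b → w ≠ v₂ → w ≠ v₁ → ∀ u,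
      cob G φ s w u = 0 := by
    intro w k0 ka kb k2 k3 u
    rw [hs]
    simp [single, k0, ka, kb, k2, k3]
  have hz1 := hzero v₁ h01.ne' ha1.symm hb1.symm h12.ne h13
  have hzc := hzero c hc0 hac.symm hbc.symm hc2 hc3
  have hzd := hzero d hd0 had.symm hbd.symm hd2 hd3.ne
  have hz3 := hzero' v₃ h30.ne ha3.symm hb3.symm h23.ne' h13.symm
  have side : ∀ {q : ι → ZMod 2} {w x : V}, (∀ u, cob G φ q w u = 0) → G.Adj w x →
      q (φ w x) = q (φ x w) := fun {_ _ x} hw hx => by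
    have := hw x
    rwa [cob_apply _ hx, zmod_two_add_eq_zero] at this
  have hf : ∀ {x y : V}, G.Adj x y → face G φ i x y ≠ 0 → φ x y = i ∨ φ y x = i := by
    intro x y hxy hne
    by_contra hn
    rw [not_or] at hn
    exact hne (by simp [face, cob_apply _ hxy, hn.1, hn.2])
  have e12 : face G φ i v₁ v₂ ≠ 0 := by
    rw [hi, quad_eq h01.ne h12.ne h23.ne h30.ne h02 h13]; simp
  have e30 : face G φ i v₃ v₀ ≠ 0 := by
    rw [hi, quad_eq h01.ne h12.ne h23.ne h30.ne h02 h13]; simp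
  have hti : r i = 1 := by simp [hr, hsi]
  have t12 : r (φ v₁ v₂) = 1 := by
    rcases hf h12 e12 with h1 | h1
    · rw [h1, hti]
    · rw [side hz1 h12, h1, hti]
  have t1c := (hφ.eq_at_vertex h hz1 h1c h12).trans t12
  have tcd := (hφ.eq_at_vertex h hzc hcd h1c.symm).trans ((side hzc h1c.symm).trans t1c)
  have td3 := (hφ.eq_at_vertex h hzd hd3 hcd.symm).trans ((side hzd hcd.symm).trans tcd)
  have t3d := (side hzd hd3).symm.trans td3
  have s30 : s (φ v₃ v₀) = 0 := by
    rcases hf h30 e30 with h1 | h1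
    · rw [h1, hsi]
    · rw [side hz3 h30, h1, hsi]
  have s3d := (hφ.eq_at_vertex h hz3 hd3.symm h30).trans s30
  have sd3 := (side hz3 hd3.symm).symm.trans s3d
  have eq_i : ∀ j, r j = 1 → s j = 0 → j = i := by
    intro j h1 h0
    by_contra hne
    rw [hr, Pi.add_apply, h0, Pi.single_eq_of_ne hne] at h1
    exact absurd h1 (by decide)
  exact hφ.ne_of_adj h hd3.symm h30 hd0 ((eq_i _ t3d s3d).trans (eq_i _ td3 sd3).symm)

end Crossing

section Operations

variable {V : Type*} [Fintype V] {W : Type*} [Fintype W] {G : SimpleGraph V} {H : SimpleGraph W}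

theorem IsEven.sum_sum_comm_eq_zero {Z : V → V → ZMod 2} (h : ∀ u v, Z u v = Z v u)
    (hd : ∀ v, Z v v = 0) (S : Finset V) : ∑ u ∈ S, ∑ v ∈ S, Z u v = 0 := by
  induction S using Finset.induction_on with
  | empty => simp
  | insert a S ha ih =>
    simp only [Finset.sum_insert ha, Finset.sum_add_distrib, ih, hd, zero_add, add_zero]
    rw [zmod_two_add_eq_zero]
    exact Finset.sum_congr rfl fun v _ => h a v

/-- The class of MacLane graphs is closed under taking subgraphs. -/
theorem IsMacLane.of_injective (h : IsMacLane G) (f : W → V) (hf : Function.Injective f)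
    (hadj : ∀ a b, H.Adj a b → G.Adj (f a) (f b)) : IsMacLane H := by
  obtain ⟨ι, hι, φ, hφ⟩ := h
  let r : ι → ι → Prop := fun i j => ∃ u v, G.Adj u v ∧
    (¬ ∃ a b, f a = u ∧ f b = v ∧ H.Adj a b) ∧ i = φ u v ∧ j = φ v u
  let ψ : W → W → Quot r := fun a b => Quot.mk r (φ (f a) (f b))
  have hcob : ∀ (s : Quot r → ZMod 2) a b, cob H ψ s a b = cob G φ (s ∘ Quot.mk r) (f a) (f b) := by
    intro s a b
    by_cases hab : H.Adj a b
    · rw [cob_apply _ hab, cob_apply _ (hadj a b hab)]; rfl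
    · rw [cob, if_neg hab, cob]
      split_ifs with hG
      · have : Quot.mk r (φ (f a) (f b)) = Quot.mk r (φ (f b) (f a)) := Quot.sound
          ⟨f a, f b, hG, fun ⟨a', b', ha, hb, hab'⟩ => hab (hf ha ▸ hf hb ▸ hab'), rfl, rfl⟩
        simp only [Function.comp, this, zmod_two_add_self]
      · rfl
  have hout : ∀ (s : Quot r → ZMod 2) a v, (∀ b, f b ≠ v) →
      cob G φ (s ∘ Quot.mk r) a v = 0 := by
    intro s a v hv
    rw [cob]
    split_ifs with hG
    · have : Quot.mk r (φ a v) = Quot.mk r (φ v a) := Quot.sound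
        ⟨a, v, hG, fun ⟨a', b', ha, hb, hab'⟩ => hv b' hb, rfl, rfl⟩
      simp only [Function.comp, this, zmod_two_add_self]
    · rfl
  refine ⟨Quot r, inferInstance, ψ, ?_, ?_⟩
  · intro s
    have hs := hφ.isEven (s ∘ Quot.mk r)
    refine ⟨⟨fun u v => by rw [hcob, hcob, hs.symm], ?_⟩, ?_⟩
    · intro u v huv
      by_contra hn
      exact huv (by simp [cob, hn])
    · intro a
      rw [← hs.bdry_eq (f a), bdry, bdry]
      simp only [hcob]
      rw [← Finset.sum_image (f := fun v => cob G φ (s ∘ Quot.mk r) (f a) v)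
        (fun x _ y _ hxy => hf hxy)]
      refine Finset.sum_subset (Finset.subset_univ _) ?_
      intro v _ hv
      exact hout s _ v fun b hb => hv (Finset.mem_image.2 ⟨b, Finset.mem_univ _, hb⟩)
  · intro Z hZ
    let Z' : V → V → ZMod 2 := fun u v => ∑ a, ∑ b, if f a = u ∧ f b = v then Z a b else 0
    have hZ' : ∀ a b, Z' (f a) (f b) = Z a b := by
      intro a b
      simp only [Z', hf.eq_iff]
      rw [Finset.sum_eq_single a (by intro x _ hx; simp [hx]) (by simp),
        Finset.sum_eq_single b (by intro x _ hx; simp [hx]) (by simp)]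
      simp
    have hZ'0 : ∀ u v, Z' u v ≠ 0 → ∃ a b, f a = u ∧ f b = v ∧ H.Adj a b := by
      intro u v huv
      obtain ⟨a, -, ha⟩ := Finset.exists_ne_zero_of_sum_ne_zero huv
      obtain ⟨b, -, hb⟩ := Finset.exists_ne_zero_of_sum_ne_zero ha
      split_ifs at hb with hc
      · exact ⟨a, b, hc.1, hc.2, hZ.supp _ _ hb⟩
      · exact absurd rfl hb
    have hev : IsEven G Z' := by
      refine ⟨⟨?_, ?_⟩, ?_⟩
      · intro u v
        simp only [Z']
        rw [Finset.sum_comm]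
        refine Finset.sum_congr rfl fun a _ => Finset.sum_congr rfl fun b _ => ?_
        rw [hZ.symm]; simp only [and_comm]
      · intro u v huv
        obtain ⟨a, b, rfl, rfl, hab⟩ := hZ'0 u v huv
        exact hadj _ _ hab
      · intro u
        by_cases hu : ∃ a, f a = u
        · obtain ⟨a, rfl⟩ := hu
          rw [← hZ.bdry_eq a, bdry, bdry]
          simp only [← hZ']
          rw [← Finset.sum_image (f := fun v => Z' (f a) v) (fun x _ y _ hxy => hf hxy)]
          refine (Finset.sum_subset (Finset.subset_univ _) ?_).symm
          intro v _ hv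
          by_contra hn
          obtain ⟨a, b, -, hb, -⟩ := hZ'0 _ _ hn
          exact hv (Finset.mem_image.2 ⟨b, Finset.mem_univ _, hb⟩)
        · rw [bdry]
          refine Finset.sum_eq_zero fun v _ => ?_
          by_contra hn
          obtain ⟨a, b, ha, -, -⟩ := hZ'0 _ _ hn
          exact hu ⟨a, ha⟩
    obtain ⟨t, ht⟩ := hφ.span Z' hev
    have htr : ∀ i j, r i j → t i = t j := by
      rintro i j ⟨u, v, huv, hn, rfl, rfl⟩
      have : Z' u v = 0 := by
        by_contra h0; exact hn (hZ'0 _ _ h0)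
      rw [← ht, cob_apply _ huv] at this
      exact zmod_two_add_eq_zero.1 this
    refine ⟨Quot.lift t htr, ?_⟩
    funext a b
    rw [hcob, ← hZ', ← ht]
    rfl

theorem IsMacLane.mono {G' : SimpleGraph V} (h : IsMacLane G') (hG : G ≤ G') : IsMacLane G :=
  h.of_injective id Function.injective_id fun _ _ hab => hG hab

/-- The class of MacLane graphs is closed under contracting an edge in no triangle. -/
theorem IsMacLane.contract (h : IsMacLane G) (π : V → W) {x z : V} (hxz : G.Adj x z)
    (hπ : π x = π z) (hinj : ∀ a b, π a = π b → a = b ∨ (a = x ∧ b = z) ∨ (a = z ∧ b = x))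
    (hno : ∀ u, ¬ (G.Adj x u ∧ G.Adj z u))
    (hH : ∀ u v, H.Adj u v ↔ u ≠ v ∧ ∃ a b, π a = u ∧ π b = v ∧ G.Adj a b) : IsMacLane H := by
  obtain ⟨ι, hι, φ, hφ⟩ := h
  have huniq : ∀ a b a' b', G.Adj a b → G.Adj a' b' → π a = π a' → π b = π b' → π a ≠ π b →
      a = a' ∧ b = b' := by
    intro a b a' b' hab hab' ha hb hne
    have h1 := hno b
    have h2 := hno a
    have := hinj a a' ha
    have := hinj b b' hb
    have := hab.symm
    have := hab'.symm
    grind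
  have hsurj : ∀ u v, ∃ p : V × V, H.Adj u v → π p.1 = u ∧ π p.2 = v ∧ G.Adj p.1 p.2 := by
    intro u v
    by_cases huv : H.Adj u v
    · obtain ⟨-, a, b, h1⟩ := (hH u v).1 huv
      exact ⟨(a, b), fun _ => h1⟩
    · exact ⟨(x, x), fun h => absurd h huv⟩
  choose p hp using hsurj
  let ψ : W → W → ι := fun u v => φ (p u v).1 (p u v).2
  have hψ : ∀ a b, G.Adj a b → π a ≠ π b → ψ (π a) (π b) = φ a b := by
    intro a b hab hne
    obtain ⟨h1, h2, h3⟩ := hp (π a) (π b) ((hH _ _).2 ⟨hne, a, b, rfl, rfl, hab⟩)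
    obtain ⟨h4, h5⟩ := huniq _ _ _ _ h3 hab h1 h2 (by rw [h1, h2]; exact hne)
    simp only [ψ, h4, h5]
  have hcob : ∀ s a b, π a ≠ π b → G.Adj a b → cob H ψ s (π a) (π b) = cob G φ s a b := by
    intro s a b hne hab
    rw [cob_apply _ ((hH _ _).2 ⟨hne, a, b, rfl, rfl, hab⟩), cob_apply _ hab, hψ a b hab hne,
      hψ b a hab.symm hne.symm]
  have hfib : ∀ Z : W → W → ZMod 2, IsEdgeChain H Z → ∀ w v, w ≠ v → Z w v =
      ∑ a with π a = w, ∑ b with π b = v, if G.Adj a b then Z (π a) (π b) else 0 := by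
    intro Z hZ w v hwv
    by_cases hadj : H.Adj w v
    · obtain ⟨h1, h2, h3⟩ := hp w v hadj
      rw [Finset.sum_eq_single (p w v).1, Finset.sum_eq_single (p w v).2]
      · rw [if_pos h3, h1, h2]
      · intro b hb hne
        rw [if_neg]
        intro hadj'
        simp only [Finset.mem_filter, Finset.mem_univ, true_and] at hb
        exact hne (huniq _ _ _ _ hadj' h3 rfl (by rw [hb, h2]) (by rw [h1, hb]; exact hwv)).2
      · intro hn; exact absurd (by simp [h2]) hn
      · intro a ha hne
        refine Finset.sum_eq_zero fun b hb => ?_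
        rw [if_neg]
        intro hadj'
        simp only [Finset.mem_filter, Finset.mem_univ, true_and] at ha hb
        exact hne (huniq _ _ _ _ hadj' h3 (by rw [ha, h1]) (by rw [hb, h2])
          (by rw [ha, hb]; exact hwv)).1
      · intro hn; exact absurd (by simp [h1]) hn
    · rw [hZ.eq_zero hadj]
      refine (Finset.sum_eq_zero fun a ha => Finset.sum_eq_zero fun b hb => ?_).symm
      simp only [Finset.mem_filter, Finset.mem_univ, true_and] at ha hb
      rw [ha, hb, hZ.eq_zero hadj]; simp
  have hbd : ∀ Z : W → W → ZMod 2, IsEdgeChain H Z → ∀ w, bdry Z w =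
      ∑ a with π a = w, ∑ b, if G.Adj a b ∧ π a ≠ π b then Z (π a) (π b) else 0 := by
    intro Z hZ w
    have e1 : ∀ v, Z w v = ∑ a with π a = w, ∑ b with π b = v,
        if G.Adj a b ∧ π a ≠ π b then Z (π a) (π b) else 0 := by
      intro v
      by_cases hwv : w = v
      · subst hwv
        rw [hZ.eq_zero (H.irrefl)]
        refine (Finset.sum_eq_zero fun a ha => Finset.sum_eq_zero fun b hb => ?_).symm
        simp only [Finset.mem_filter, Finset.mem_univ, true_and] at ha hb
        simp [ha, hb]
      · rw [hfib Z hZ w v hwv]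
        refine Finset.sum_congr rfl fun a ha => Finset.sum_congr rfl fun b hb => ?_
        simp only [Finset.mem_filter, Finset.mem_univ, true_and] at ha hb
        simp [ha, hb, hwv]
    rw [bdry]
    simp only [e1]
    rw [Finset.sum_comm]
    refine Finset.sum_congr rfl fun a _ => ?_
    exact Finset.sum_fiberwise _ _ _
  have hself : ∀ a b, G.Adj a b → π a = π b → (a = x ∧ b = z) ∨ (a = z ∧ b = x) := by
    intro a b hab he
    rcases hinj a b he with h1 | h1
    · exact absurd h1 hab.ne
    · exact h1
  refine ⟨ι, hι, ψ, ?_, ?_⟩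
  · intro s
    have hch : IsEdgeChain H (cob H ψ s) := by
      refine ⟨fun u v => ?_, ?_⟩
      · simp only [cob, H.adj_comm u v, add_comm]
      · intro u v huv
        by_contra hn
        exact huv (by simp [cob, hn])
    refine ⟨hch, fun w => ?_⟩
    rw [hbd _ hch]
    have hs := hφ.isEven s
    have e2 : ∀ a, (∑ b, if G.Adj a b ∧ π a ≠ π b then cob H ψ s (π a) (π b) else 0)
        = ∑ b with π b = π a, cob G φ s a b := by
      intro a
      have h0 := hs.bdry_eq a
      rw [bdry, ← Finset.sum_filter_add_sum_filter_not _ (fun b => π b = π a)] at h0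
      rw [zmod_two_add_eq_zero.1 h0, Finset.sum_filter]
      refine Finset.sum_congr rfl fun b _ => ?_
      by_cases hab : G.Adj a b
      · by_cases hne : π a = π b
        · simp [hne]
        · simp [hab, hne, Ne.symm hne, hcob s a b hne hab]
      · simp [hab, cob]
    simp only [e2]
    rw [Finset.sum_congr rfl (g := fun a => ∑ b with π b = w, cob G φ s a b)]
    · exact IsEven.sum_sum_comm_eq_zero hs.symm (fun v => hs.eq_zero G.irrefl) _
    · intro a ha
      simp only [Finset.mem_filter, Finset.mem_univ, true_and] at ha
      rw [ha]
  · intro Z hZ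
    let Z₀ : V → V → ZMod 2 := fun a b => if G.Adj a b ∧ π a ≠ π b then Z (π a) (π b) else 0
    have hZ₀ : IsEdgeChain G Z₀ := by
      refine ⟨fun u v => ?_, fun u v huv => ?_⟩
      · simp only [Z₀, G.adj_comm u v, ne_comm, hZ.symm (π u)]
      · by_contra hn; exact huv (by simp [Z₀, hn])
    have hfx : ∀ a, π a = π x ↔ a = x ∨ a = z := by
      intro a
      refine ⟨fun ha => ?_, ?_⟩
      · have := hinj a x ha; tauto
      · rintro (rfl | rfl) <;> simp [hπ]
    have hsum : bdry Z₀ x + bdry Z₀ z = 0 := by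
      rw [← hZ.bdry_eq (π x), hbd Z hZ.toIsEdgeChain, ← Finset.sum_pair hxz.ne]
      refine Finset.sum_congr ?_ fun a _ => rfl
      ext a; simp [hfx]
    have hother : ∀ a, a ≠ x → a ≠ z → bdry Z₀ a = 0 := by
      intro a hax haz
      rw [← hZ.bdry_eq (π a), hbd Z hZ.toIsEdgeChain]
      rw [Finset.sum_eq_single_of_mem a (by simp)]
      · rfl
      · intro b hb hba
        simp only [Finset.mem_filter, Finset.mem_univ, true_and] at hb
        have := hinj b a hb
        tauto
    obtain ⟨t, ht⟩ := hφ.span (Z₀ + bdry Z₀ x • single x z)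
      ⟨hZ₀.add ((isEdgeChain_single hxz).smul _), by
        intro v
        rw [bdry_add, bdry_smul, bdry_single hxz.ne]
        by_cases hvx : v = x
        · subst hvx; simp [hxz.ne, zmod_two_add_self]
        · by_cases hvz : v = z
          · subst hvz
            simp only [hvx, if_false, if_true, zero_add, mul_one]
            rw [add_comm]; exact hsum
          · simp [hvx, hvz, hother v hvx hvz]⟩
    refine ⟨t, ?_⟩
    funext u v
    by_cases huv : H.Adj u v
    · obtain ⟨h1, h2, h3⟩ := hp u v huv
      generalize (p u v).1 = a, (p u v).2 = b at h1 h2 h3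
      subst h1 h2
      have hne : π a ≠ π b := huv.ne
      rw [hcob _ _ _ hne h3, ht]
      have : single x z a b = 0 := by
        rw [single, if_neg]
        rintro (⟨h4, h5⟩ | ⟨h4, h5⟩)
        · rw [h4, h5] at hne; exact hne hπ
        · rw [h4, h5] at hne; exact hne hπ.symm
      simp only [Pi.add_apply, Pi.smul_apply, this, Z₀, if_pos (And.intro h3 hne), smul_zero,
        add_zero]
    · rw [hZ.eq_zero huv]; simp [cob, huv]

end Operations

section Augment

variable {V : Type*} [Fintype V] {G G' : SimpleGraph V} {C : V → V → ZMod 2}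

/-- `C` is the boundary of a face in some face labelling of `G`. -/
def HasFace (G : SimpleGraph V) (C : V → V → ZMod 2) : Prop :=
  ∃ (ι : Type) (_ : Finite ι) (φ : V → V → ι), IsFaceLabelling G φ ∧ ∃ i, face G φ i = C

theorem HasFace.isMacLane (h : HasFace G C) : IsMacLane G :=
  let ⟨ι, hι, φ, hφ, _⟩ := h
  ⟨ι, hι, φ, hφ⟩

/-- Subdividing a face by a new even chain. -/
theorem HasFace.augment (h : HasFace G C) (hG : G ≤ G') {t : V → V → ZMod 2} (ht : IsEven G' t)
    (htC : ∀ u v, G.Adj u v → t u v ≠ 0 → C u v ≠ 0)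
    (htn : ∀ u v, G'.Adj u v → ¬ G.Adj u v → t u v = 1)
    (hspan : ∀ Z, IsEven G' Z → ∃ c : ZMod 2, ∀ u v, ¬ G.Adj u v → Z u v = c * t u v) :
    HasFace G' (C + t) := by
  obtain ⟨ι, hι, φ, hφ, i, hi⟩ := h
  let ψ : V → V → Option ι := fun u v =>
    if G.Adj u v then if t u v = 1 ∧ φ u v = i then none else some (φ u v)
    else if WellOrderingRel u v then some i else none
  have htri : ∀ u v : V, u ≠ v → (WellOrderingRel u v ∧ ¬ WellOrderingRel v u) ∨
      (WellOrderingRel v u ∧ ¬ WellOrderingRel u v) := by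
    intro u v huv
    have h1 : ¬ (WellOrderingRel u v ∧ WellOrderingRel v u) := fun ⟨h1, h2⟩ =>
      asymm_of WellOrderingRel h1 h2
    rcases trichotomous_of WellOrderingRel u v with h2 | h2 | h2
    · tauto
    · exact absurd h2 huv
    · tauto
  have hcob : ∀ s : Option ι → ZMod 2, cob G' ψ s =
      cob G φ (s ∘ some) + (s (some i) + s none) • t := by
    intro s
    funext u v
    simp only [Pi.add_apply, Pi.smul_apply, smul_eq_mul]
    by_cases huv : G.Adj u v
    · rw [cob_apply _ (hG huv), cob_apply _ huv]
      simp only [ψ, if_pos huv, if_pos huv.symm, Function.comp]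
      rw [ht.symm v u]
      rcases zmod_two_cases (t u v) with h0 | h1
      · simp [h0]
      · have hC := htC u v huv (by rw [h1]; exact one_ne_zero)
        rw [← hi, face, cob_apply _ huv] at hC
        rw [h1]
        by_cases h2 : φ u v = i <;> by_cases h3 : φ v u = i
        · simp [h2, h3, zmod_two_add_self] at hC
        · simp only [h2, h3]
          simp only [and_self, and_false, if_true, if_false]
          generalize s none = x, s (some i) = y, s (some (φ v u)) = z
          revert x y z; decide
        · simp only [h2, h3]
          simp only [and_self, and_false, if_true, if_false]
          generalize s none = x, s (some i) = y, s (some (φ u v)) = z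
          revert x y z; decide
        · simp [h2, h3] at hC
    · by_cases huv' : G'.Adj u v
      · rw [cob_apply _ huv', htn u v huv' huv, cob, if_neg huv]
        simp only [ψ, if_neg huv, if_neg (fun h => huv h.symm : ¬ G.Adj v u)]
        rcases htri u v huv'.ne with ⟨h1, h2⟩ | ⟨h1, h2⟩
        · simp [h1, h2]
        · simp [h1, h2, add_comm]
      · rw [ht.eq_zero huv']; simp [cob, huv, huv']
  refine ⟨Option ι, inferInstance, ψ, ⟨fun s => ?_, fun Z hZ => ?_⟩, some i, ?_⟩
  · rw [hcob]
    exact ((hφ.isEven _).mono hG).add (ht.smul _)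
  · obtain ⟨c, hc⟩ := hspan Z hZ
    have hev := hZ.add (ht.smul c)
    obtain ⟨s, hs⟩ := hφ.span (Z + c • t) ⟨⟨hev.symm, fun u v huv => by
      by_contra hn
      refine huv ?_
      rw [Pi.add_apply, Pi.add_apply, hc u v hn]
      exact zmod_two_add_self _⟩, hev.bdry_eq⟩
    refine ⟨fun o => o.elim (s i + c) s, ?_⟩
    rw [hcob]
    change cob G φ s + (s i + (s i + c)) • t = Z
    rw [hs, ← add_assoc, zmod_two_add_self, zero_add, add_assoc, ← add_smul, zmod_two_add_self,
      zero_smul, add_zero]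
  · rw [face, hcob, ← hi, face]
    congr 1
    · congr 1
      funext j
      simp [Pi.single_apply]
    · simp

/-- The graph obtained from `G` by adding the edge `ab`. -/
abbrev addEdge (G : SimpleGraph V) (a b : V) : SimpleGraph V := G ⊔ edge a b

theorem addEdge_adj {a b u v : V} : (addEdge G a b).Adj u v ↔
    G.Adj u v ∨ (((a = u ∧ b = v) ∨ (a = v ∧ b = u)) ∧ u ≠ v) := by
  simp [addEdge, edge_adj]
  grind

/-- Adding an edge between the ends of two consecutive edges of a face. -/
theorem HasFace.corner (h : HasFace G C) {a b c : V} (hab : C a b ≠ 0) (hbc : C b c ≠ 0)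
    (hac : a ≠ c) (hn : ¬ G.Adj a c) : HasFace (addEdge G a c) (C + tri a b c) := by
  obtain ⟨ι, hι, φ, hφ, i, hi⟩ := id h
  have hCe : IsEven G C := hi ▸ hφ.isEven _
  have gab := hCe.supp _ _ hab
  have gbc := hCe.supp _ _ hbc
  have hle : G ≤ addEdge G a c := le_sup_left
  have gac : (addEdge G a c).Adj a c := addEdge_adj.2 (Or.inr ⟨by tauto, hac⟩)
  refine h.augment hle (isEven_tri (hle gab) (hle gbc) gac.symm) ?_ ?_ ?_
  · intro u v huv
    rw [tri_eq gab.ne gbc.ne hac.symm]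
    split_ifs with hc
    · have := hCe.symm a b
      have := hCe.symm b c
      have := huv.symm
      intro _
      grind
    · intro h0; exact absurd rfl h0
  · intro u v huv huv'
    rw [tri_eq gab.ne gbc.ne hac.symm, if_pos]
    rw [addEdge_adj] at huv
    grind
  · intro Z hZ
    refine ⟨Z a c, fun u v huv => ?_⟩
    rw [tri_eq gab.ne gbc.ne hac.symm]
    by_cases huv' : (addEdge G a c).Adj u v
    · have := hZ.symm a c
      rw [addEdge_adj] at huv'
      grind
    · rw [hZ.eq_zero huv']
      have := gab.symm
      have := gbc.symm
      have := gac.symm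
      have : ∀ {u v}, G.Adj u v → (addEdge G a c).Adj u v := fun h => hle h
      split_ifs with hc
      · grind
      · simp

/-- Adding a new vertex adjacent to the ends of an edge of a face. -/
theorem HasFace.ear (h : HasFace G C) {a b x : V} (hab : C a b ≠ 0)
    (hx : ∀ u, ¬ G.Adj x u) : HasFace (addEdge (addEdge G x a) x b) (C + tri x a b) := by
  obtain ⟨ι, hι, φ, hφ, i, hi⟩ := id h
  have hCe : IsEven G C := hi ▸ hφ.isEven _
  have gab := hCe.supp _ _ hab
  have hxa : x ≠ a := by rintro rfl; exact hx _ gab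
  have hxb : x ≠ b := by rintro rfl; exact hx _ gab.symm
  have hle : G ≤ addEdge (addEdge G x a) x b := le_sup_left.trans le_sup_left
  have adj : ∀ u v, (addEdge (addEdge G x a) x b).Adj u v ↔ G.Adj u v ∨
      ((x = u ∧ a = v) ∨ (x = v ∧ a = u) ∨ (x = u ∧ b = v) ∨ (x = v ∧ b = u)) := by
    intro u v
    rw [addEdge_adj, addEdge_adj]
    grind
  have gxa : (addEdge (addEdge G x a) x b).Adj x a := by rw [adj]; tauto
  have gxb : (addEdge (addEdge G x a) x b).Adj x b := by rw [adj]; tauto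
  refine h.augment hle (isEven_tri gxa (hle gab) gxb.symm) ?_ ?_ ?_
  · intro u v huv
    rw [tri_eq hxa gab.ne hxb.symm]
    have := hCe.symm a b
    have := huv.symm
    split_ifs with hc
    · intro _
      grind
    · intro h0; exact absurd rfl h0
  · intro u v huv huv'
    rw [tri_eq hxa gab.ne hxb.symm, if_pos]
    rw [adj] at huv
    grind
  · intro Z hZ
    have hz : Z x a = Z x b := by
      have h0 := hZ.bdry_eq x
      rw [bdry_eq_two gab.ne, zmod_two_add_eq_zero] at h0
      · exact h0
      · intro u h1 h2
        refine hZ.eq_zero ?_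
        rw [adj]
        have := hx u
        grind
    refine ⟨Z x a, fun u v huv => ?_⟩
    rw [tri_eq hxa gab.ne hxb.symm]
    by_cases huv' : (addEdge (addEdge G x a) x b).Adj u v
    · have := hZ.symm x a
      have := hZ.symm x b
      rw [adj] at huv'
      grind
    · rw [hZ.eq_zero huv']
      rw [adj] at huv'
      have := gab.symm
      split_ifs with hc
      · grind
      · simp

/-- Identifying two opposite vertices of a face corner. -/
theorem HasFace.identify {W : Type*} [Fintype W] {H : SimpleGraph W} (h : HasFace G C)
    {x m z : V} (hxm : C x m ≠ 0) (hmz : C m z ≠ 0) (hxz : x ≠ z) (hn : ¬ G.Adj x z)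
    (π : V → W) (hπ : π x = π z)
    (hinj : ∀ a b, π a = π b → a = b ∨ (a = x ∧ b = z) ∨ (a = z ∧ b = x))
    (hH : ∀ u v, H.Adj u v ↔ ∃ a b, π a = u ∧ π b = v ∧ G.Adj a b) : IsMacLane H := by
  have h1 := (h.corner hxm hmz hxz hn).isMacLane
  let G₂ : SimpleGraph V :=
    { Adj := fun u v => (addEdge G x z).Adj u v ∧ ¬ (u = z ∧ G.Adj x v) ∧ ¬ (v = z ∧ G.Adj x u)
      symm := ⟨fun u v huv => ⟨huv.1.symm, huv.2.2, huv.2.1⟩⟩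
      loopless := ⟨fun u hu => hu.1.ne rfl⟩ }
  have h2 : IsMacLane G₂ := h1.mono fun u v huv => huv.1
  have hne : ∀ a b, G.Adj a b → π a ≠ π b := by
    intro a b hab he
    rcases hinj a b he with rfl | ⟨rfl, rfl⟩ | ⟨rfl, rfl⟩
    · exact hab.ne rfl
    · exact hn hab
    · exact hn hab.symm
  refine h2.contract π (x := x) (z := z) ?_ hπ hinj ?_ ?_
  · refine ⟨addEdge_adj.2 (by tauto), by tauto, ?_⟩
    rintro ⟨-, hh⟩
    exact hh.ne rfl
  · rintro u ⟨⟨h3, h4⟩, h5, h6⟩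
    rw [addEdge_adj] at h3 h5
    grind
  · intro u v
    rw [hH]
    constructor
    · rintro ⟨a, b, rfl, rfl, hab⟩
      refine ⟨hne a b hab, ?_⟩
      by_cases h3 : a = z ∧ G.Adj x b
      · refine ⟨x, b, by rw [hπ, h3.1], rfl, addEdge_adj.2 (Or.inl h3.2), ?_, ?_⟩
        · exact fun h => hxz h.1
        · exact fun h => G.irrefl h.2
      · by_cases h4 : b = z ∧ G.Adj x a
        · refine ⟨a, x, rfl, by rw [hπ, h4.1], addEdge_adj.2 (Or.inl h4.2.symm), ?_, ?_⟩
          · exact fun h => G.irrefl h.2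
          · exact fun h => hxz h.1
        · exact ⟨a, b, rfl, rfl, addEdge_adj.2 (Or.inl hab), h3, h4⟩
    · rintro ⟨huv, a, b, rfl, rfl, hab, -, -⟩
      rw [addEdge_adj] at hab
      rcases hab with hab | ⟨⟨rfl, rfl⟩ | ⟨rfl, rfl⟩, -⟩
      · exact ⟨a, b, rfl, rfl, hab⟩
      · exact absurd hπ huv
      · exact absurd hπ.symm huv

end Augment

section Reduced

variable {V : Type*} [Fintype V] {G : SimpleGraph V}

/-- A MacLane graph has a labelling whose only relation is the sum of all faces. -/
theorem IsMacLane.exists_reduced (h : IsMacLane G) :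
    ∃ (ι : Type) (_ : Fintype ι) (φ : V → V → ι), IsFaceLabelling G φ ∧
      ∀ s, cob G φ s = 0 → ∀ i j, s i = s j := by
  have hex : ∃ n : ℕ, ∃ (ι : Type) (_ : Fintype ι) (φ : V → V → ι), IsFaceLabelling G φ ∧
      Fintype.card ι = n := by
    obtain ⟨ι, hι, φ, hφ⟩ := h
    have := Fintype.ofFinite ι
    exact ⟨_, ι, inferInstance, φ, hφ, rfl⟩
  obtain ⟨ι, hι, φ, hφ, hcard⟩ := Nat.find_spec hex
  refine ⟨ι, hι, φ, hφ, ?_⟩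
  by_contra hcon
  push Not at hcon
  obtain ⟨s, hs, i, j, hij⟩ := hcon
  have hne : i ≠ j := fun h => hij (h ▸ rfl)
  let f : ι → {k // k ≠ j} := fun k => if hk : k = j then ⟨i, hne⟩ else ⟨k, hk⟩
  have hcob : ∀ t : {k // k ≠ j} → ZMod 2, cob G (fun u v => f (φ u v)) t = cob G φ (t ∘ f) :=
    fun t => rfl
  refine Nat.find_min hex (m := Fintype.card {k // k ≠ j}) ?_
    ⟨_, inferInstance, fun u v => f (φ u v), ⟨fun t => ?_, fun Z hZ => ?_⟩, rfl⟩
  · rw [← hcard]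
    exact Fintype.card_subtype_lt (x := j) (by simp)
  · rw [hcob]; exact hφ.isEven _
  · obtain ⟨t, ht⟩ := hφ.span Z hZ
    obtain ⟨t', ht', he⟩ : ∃ t', cob G φ t' = Z ∧ t' i = t' j := by
      by_cases hij' : t i = t j
      · exact ⟨t, ht, hij'⟩
      · refine ⟨t + s, by rw [cob_add, hs, ht, add_zero], ?_⟩
        simp only [Pi.add_apply]
        generalize t i = x, t j = y, s i = z, s j = w at *
        revert x y z w; decide
    refine ⟨fun k => t' k, ?_⟩
    rw [hcob, ← ht']
    congr 1
    funext k
    by_cases hk : k = j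
    · simp [f, hk, he]
    · simp [f, hk]

end Reduced

set_option synthInstance.maxSize 1000 in
set_option synthInstance.maxHeartbeats 200000 in
theorem zmod_two_four_vertices : ∀ x₁ x₂ x₃ x₄ x₅ x₆ : ZMod 2,
    0 + x₁ + x₂ + x₃ = 0 → x₁ + 0 + x₄ + x₅ = 0 → x₂ + x₄ + 0 + x₆ = 0 →
    x₃ + x₅ + x₆ + 0 = 0 → ¬(x₁ = 0 ∧ x₂ = 0 ∧ x₃ = 0) → ¬(x₁ = 0 ∧ x₄ = 0 ∧ x₅ = 0) →
    ¬(x₂ = 0 ∧ x₄ = 0 ∧ x₆ = 0) → ¬(x₃ = 0 ∧ x₅ = 0 ∧ x₆ = 0) →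
    x₁ = 1 ∧ x₄ = 1 ∧ x₆ = 1 ∧ x₃ = 1 ∧ x₂ = 0 ∧ x₅ = 0 ∨
      x₂ = 1 ∧ x₄ = 1 ∧ x₅ = 1 ∧ x₃ = 1 ∧ x₁ = 0 ∧ x₆ = 0 ∨
        x₁ = 1 ∧ x₅ = 1 ∧ x₆ = 1 ∧ x₂ = 1 ∧ x₃ = 0 ∧ x₄ = 0 := by
  decide

section Counting

variable {V : Type*} [Fintype V] {G : SimpleGraph V}

theorem IsEven.exists_eq_quad {Z : V → V → ZMod 2} (hZ : IsEven G Z) {K : Finset V}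
    (hK : ∀ u v, Z u v ≠ 0 → u ∈ K ∧ v ∈ K) {p q r s : V} (h1 : Z p q = 1) (h2 : Z q r = 1)
    (h3 : Z r s = 1) (h4 : Z s p = 1) (h5 : Z p r = 0) (h6 : Z q s = 0) (hpr : p ≠ r) (hqs : q ≠ s)
    (hm : ∀ v, v ∈ K ↔ v = p ∨ v = q ∨ v = r ∨ v = s) :
    ∃ a b c d, G.Adj a b ∧ G.Adj b c ∧ G.Adj c d ∧ G.Adj d a ∧ a ≠ c ∧ b ≠ d ∧
      Z = quad a b c d := by
  have adj : ∀ {u v}, Z u v = 1 → G.Adj u v := fun {u v} h =>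
    hZ.supp u v (by rw [h]; exact one_ne_zero)
  have hirr : ∀ v, Z v v = 0 := fun v => hZ.eq_zero G.irrefl
  refine ⟨p, q, r, s, adj h1, adj h2, adj h3, adj h4, hpr, hqs, ?_⟩
  funext u v
  rw [quad_eq (adj h1).ne (adj h2).ne (adj h3).ne (adj h4).ne hpr hqs]
  by_cases hu : u ∈ K ∧ v ∈ K
  · have t1 := hZ.symm p q ▸ h1
    have t2 := hZ.symm q r ▸ h2
    have t3 := hZ.symm r s ▸ h3
    have t4 := hZ.symm s p ▸ h4
    have t5 := hZ.symm p r ▸ h5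
    have t6 := hZ.symm q s ▸ h6
    have n1 := (adj h1).ne
    have n2 := (adj h2).ne
    have n3 := (adj h3).ne
    have n4 := (adj h4).ne
    obtain ⟨hu, hv⟩ := hu
    rw [hm] at hu hv
    rcases hu with hu | hu | hu | hu <;> rcases hv with hv | hv | hv | hv <;> rw [hu, hv] <;>
      simp only [h1, h2, h3, h4, h5, h6, t1, t2, t3, t4, t5, t6, hirr, n1, n2, n3, n4, n1.symm,
        n2.symm, n3.symm, n4.symm, hpr, hqs, hpr.symm, hqs.symm, and_true, and_false,
        or_false, if_true, if_false, and_self, or_true]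
  · have hz : Z u v = 0 := by
      by_contra hn; exact hu (hK _ _ hn)
    rw [hz, if_neg]
    simp only [hm] at hu
    grind

/-- Nonempty even chains are triangles, 4-cycles, or have at least five edges. -/
theorem IsEven.classify {Z : V → V → ZMod 2} (hZ : IsEven G Z) (h0 : Z ≠ 0) :
    ((∃ a b c, G.Adj a b ∧ G.Adj b c ∧ G.Adj c a ∧ Z = tri a b c) ∧
      6 ≤ (Finset.univ.filter fun p : V × V => Z p.1 p.2 ≠ 0).card) ∨
    ((∃ a b c d, G.Adj a b ∧ G.Adj b c ∧ G.Adj c d ∧ G.Adj d a ∧ a ≠ c ∧ b ≠ d ∧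
        Z = quad a b c d) ∧
      8 ≤ (Finset.univ.filter fun p : V × V => Z p.1 p.2 ≠ 0).card) ∨
    10 ≤ (Finset.univ.filter fun p : V × V => Z p.1 p.2 ≠ 0).card := by
  let K : Finset V := Finset.univ.filter fun v => ∃ u, Z v u ≠ 0
  have hK : ∀ u v, Z u v ≠ 0 → u ∈ K ∧ v ∈ K := by
    intro u v huv
    simp only [K, Finset.mem_filter, Finset.mem_univ, true_and]
    exact ⟨⟨v, huv⟩, ⟨u, by rwa [hZ.symm]⟩⟩
  have hirr : ∀ v, Z v v = 0 := fun v => hZ.eq_zero G.irrefl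
  have hdeg : ∀ v ∈ K, ∃ a b, a ≠ b ∧ Z v a ≠ 0 ∧ Z v b ≠ 0 := by
    intro v hv
    simp only [K, Finset.mem_filter, Finset.mem_univ, true_and] at hv
    obtain ⟨a, ha⟩ := hv
    by_contra hn
    push Not at hn
    have := hZ.bdry_eq v
    rw [bdry, Finset.sum_eq_single a (fun b _ hb => hn a b hb.symm ha) (by simp)] at this
    exact ha this
  have hcard : 2 * K.card ≤ (Finset.univ.filter fun p : V × V => Z p.1 p.2 ≠ 0).card := by
    rw [Finset.card_eq_sum_card_fiberwise (f := Prod.fst) (t := K)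
      (fun p hp => (hK _ _ (Finset.mem_filter.1 hp).2).1), mul_comm, ← smul_eq_mul,
      ← Finset.sum_const]
    refine Finset.sum_le_sum fun v hv => ?_
    obtain ⟨a, b, hab, ha, hb⟩ := hdeg v hv
    have h2 : ({(v, a), (v, b)} : Finset (V × V)).card = 2 :=
      Finset.card_pair (by simpa using hab)
    refine le_trans h2.ge (Finset.card_le_card ?_)
    intro p hp
    simp only [Finset.mem_insert, Finset.mem_singleton] at hp
    rcases hp with rfl | rfl <;> simp [ha, hb]
  have hK3 : 3 ≤ K.card := by
    obtain ⟨u, v, huv⟩ : ∃ u v, Z u v ≠ 0 := by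
      by_contra hn
      push Not at hn
      exact h0 (by funext u v; exact hn u v)
    obtain ⟨a, b, hab, ha, hb⟩ := hdeg u (hK _ _ huv).1
    have hua : u ≠ a := by rintro rfl; exact ha (hirr u)
    have hub : u ≠ b := by rintro rfl; exact hb (hirr u)
    rw [← Finset.card_eq_three.2 ⟨u, a, b, hua, hub, hab, rfl⟩]
    refine Finset.card_le_card ?_
    intro p hp
    simp only [Finset.mem_insert, Finset.mem_singleton] at hp
    rcases hp with rfl | rfl | rfl
    · exact (hK _ _ huv).1
    · exact (hK _ _ ha).2
    · exact (hK _ _ hb).2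
  rcases Nat.lt_or_ge K.card 4 with h4 | h4
  · left
    refine ⟨?_, by omega⟩
    obtain ⟨a, b, c, hab, hac, hbc, hKe⟩ := Finset.card_eq_three.1 (show K.card = 3 by omega)
    have hmem : ∀ v, v ∈ K ↔ v = a ∨ v = b ∨ v = c := by intro v; rw [hKe]; simp
    have hin : ∀ u v, (v ≠ a ∧ v ≠ b ∧ v ≠ c) → Z u v = 0 := by
      intro u v hv
      by_contra hn
      have := (hmem v).1 (hK u v hn).2
      tauto
    have e1 : ∀ v, bdry Z v = Z v a + Z v b + Z v c := by
      intro v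
      rw [bdry, ← Finset.sum_subset (Finset.subset_univ {a, b, c})]
      · rw [Finset.sum_insert (by simp [hab, hac]), Finset.sum_pair hbc, add_assoc]
      · intro u _ hu
        simp only [Finset.mem_insert, Finset.mem_singleton, not_or] at hu
        exact hin v u hu
    have ea := (e1 a).symm.trans (hZ.bdry_eq a)
    have eb := (e1 b).symm.trans (hZ.bdry_eq b)
    rw [hirr, zero_add, zmod_two_add_eq_zero] at ea
    rw [hirr, add_zero, zmod_two_add_eq_zero] at eb
    have hab1 : Z a b = 1 := by
      rw [← zmod_two_ne_zero]
      intro h00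
      obtain ⟨u, -, -, hu, -⟩ := hdeg a ((hmem a).2 (Or.inl rfl))
      rcases (hmem u).1 (hK _ _ hu).2 with rfl | rfl | rfl
      · exact hu (hirr _)
      · exact hu h00
      · exact hu (ea ▸ h00)
    have hac1 : Z a c = 1 := ea ▸ hab1
    have hbc1 : Z b c = 1 := by rw [← eb, hZ.symm, hab1]
    have adj : ∀ {u v}, Z u v = 1 → G.Adj u v := fun {u v} h =>
      hZ.supp u v (by rw [h]; exact one_ne_zero)
    refine ⟨a, b, c, adj hab1, adj hbc1, (adj hac1).symm, ?_⟩
    funext u v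
    rw [tri_eq hab hbc hac.symm]
    have s1 := hZ.symm a b
    have s2 := hZ.symm a c
    have s3 := hZ.symm b c
    have := hin u v
    have := hin v u
    have := hZ.symm u v
    have := hirr u
    split_ifs with hc
    · grind -ring -linarith
    · grind -ring -linarith
  · rcases Nat.lt_or_ge K.card 5 with h5 | h5
    · right; left
      refine ⟨?_, by omega⟩
      obtain ⟨a, hKa⟩ : K.Nonempty := Finset.card_pos.1 (by omega)
      obtain ⟨b, c, d, hbc, hbd, hcd, hKe⟩ := Finset.card_eq_three.1
        (show (K.erase a).card = 3 by rw [Finset.card_erase_of_mem hKa]; omega)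
      have hmem : ∀ v, v ∈ K ↔ v = a ∨ v = b ∨ v = c ∨ v = d := by
        intro v
        rw [← Finset.insert_erase hKa, hKe]; simp
      have hne : ∀ v, v ∈ K.erase a → a ≠ v := fun v hv => (Finset.ne_of_mem_erase hv).symm
      have hab := hne b (by rw [hKe]; simp)
      have hac := hne c (by rw [hKe]; simp)
      have had := hne d (by rw [hKe]; simp)
      have hin : ∀ u v, (v ≠ a ∧ v ≠ b ∧ v ≠ c ∧ v ≠ d) → Z u v = 0 := by
        intro u v hv
        by_contra hn
        have := (hmem v).1 (hK u v hn).2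
        tauto
      have e1 : ∀ v, bdry Z v = Z v a + Z v b + Z v c + Z v d := by
        intro v
        rw [bdry, ← Finset.sum_subset (Finset.subset_univ {a, b, c, d})]
        · rw [Finset.sum_insert (by simp [hab, hac, had]), Finset.sum_insert (by simp [hbc, hbd]),
            Finset.sum_pair hcd, ← add_assoc, ← add_assoc]
        · intro u _ hu
          simp only [Finset.mem_insert, Finset.mem_singleton, not_or] at hu
          exact hin v u hu
      have ea := (e1 a).symm.trans (hZ.bdry_eq a)
      have eb := (e1 b).symm.trans (hZ.bdry_eq b)
      have ec := (e1 c).symm.trans (hZ.bdry_eq c)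
      have ed := (e1 d).symm.trans (hZ.bdry_eq d)
      have hnz : ∀ v ∈ K, ¬ (Z v a = 0 ∧ Z v b = 0 ∧ Z v c = 0 ∧ Z v d = 0) := by
        rintro v hv ⟨h1, h2, h3, h4⟩
        obtain ⟨u, -, -, hu, -⟩ := hdeg v hv
        rcases (hmem u).1 (hK _ _ hu).2 with rfl | rfl | rfl | rfl <;> contradiction
      have na := hnz a ((hmem a).2 (by tauto))
      have nb := hnz b ((hmem b).2 (by tauto))
      have nc := hnz c ((hmem c).2 (by tauto))
      have nd := hnz d ((hmem d).2 (by tauto))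
      have s1 := hZ.symm a b
      have s2 := hZ.symm a c
      have s3 := hZ.symm a d
      have s4 := hZ.symm b c
      have s5 := hZ.symm b d
      have s6 := hZ.symm c d
      have key : (Z a b = 1 ∧ Z b c = 1 ∧ Z c d = 1 ∧ Z a d = 1 ∧ Z a c = 0 ∧ Z b d = 0) ∨
          (Z a c = 1 ∧ Z b c = 1 ∧ Z b d = 1 ∧ Z a d = 1 ∧ Z a b = 0 ∧ Z c d = 0) ∨
          (Z a b = 1 ∧ Z b d = 1 ∧ Z c d = 1 ∧ Z a c = 1 ∧ Z a d = 0 ∧ Z b c = 0) := by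
        rw [hirr] at ea eb ec ed na nb nc nd
        rw [← s1] at eb nb
        rw [← s2, ← s4] at ec nc
        rw [← s3, ← s5, ← s6] at ed nd
        simp only [true_and, and_true] at na nb nc nd
        exact zmod_two_four_vertices _ _ _ _ _ _ ea eb ec ed na nb nc nd
      rcases key with ⟨h1, h2, h3, h4, h5, h6⟩ | ⟨h1, h2, h3, h4, h5, h6⟩ | ⟨h1, h2, h3, h4, h5, h6⟩
      · exact hZ.exists_eq_quad hK h1 h2 h3 (s3 ▸ h4) h5 h6 hac hbd hmem
      · exact hZ.exists_eq_quad hK h1 (s4 ▸ h2) h3 (s3 ▸ h4) h5 h6 hab hcd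
          fun v => (hmem v).trans (or_congr_right or_left_comm)
      · exact hZ.exists_eq_quad hK h1 h2 (s6 ▸ h3) (s2 ▸ h4) h5 h6 had hbc
          fun v => (hmem v).trans (or_congr_right (or_congr_right or_comm))
    · right; right; omega

/-- Twice the number of edges. -/
noncomputable def dartCount (G : SimpleGraph V) : ℕ :=
  (Finset.univ.filter fun p : V × V => G.Adj p.1 p.2).card

theorem dartCount_eq (G : SimpleGraph V) : dartCount G = 2 * Fintype.card G.edgeSet := by
  have h := G.sum_degrees_eq_twice_card_edges
  have h' : G.edgeFinset.card = Fintype.card G.edgeSet := by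
    rw [← Set.toFinset_card]; congr
  rw [← h', ← h, dartCount]
  rw [Finset.card_eq_sum_card_fiberwise (f := Prod.fst) (t := Finset.univ) (by simp)]
  refine Finset.sum_congr rfl fun v _ => ?_
  rw [← G.card_neighborFinset_eq_degree]
  refine Finset.card_bij' (fun p _ => p.2) (fun u _ => (v, u)) ?_ ?_ ?_ ?_ <;> aesop

end Counting

section Euler

variable {V : Type*} [Fintype V] {G : SimpleGraph V}

/-- Half of Euler's formula. -/
theorem IsFaceLabelling.card_edgeSet_add_two_le {ι : Type*} [Fintype ι] {φ : V → V → ι}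
    (hφ : IsFaceLabelling G φ) (v₀ : V) :
    Fintype.card G.edgeSet + 2 ≤ Fintype.card V + Fintype.card ι := by
  let i₀ := φ v₀ v₀
  let A := G.edgeSet → ZMod 2
  let c : A → V → V → ZMod 2 := fun x u v => if h : G.Adj u v then x ⟨s(u, v), h⟩ else 0
  have hc : ∀ x, IsEdgeChain G (c x) := by
    intro x
    refine ⟨fun u v => ?_, fun u v h => ?_⟩
    · simp only [c, G.adj_comm v u]
      split_ifs
      · congr 2; exact Sym2.eq_swap
      · rfl
    · by_contra hn
      exact h (by simp [c, hn])
  let B : A → {v // v ≠ v₀} → ZMod 2 := fun x v => bdry (c x) v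
  have hev : ∀ x y, B x = B y → IsEven G (c x + c y) := by
    intro x y hxy
    refine ⟨(hc x).add (hc y), ?_⟩
    have h1 : ∀ v, v ≠ v₀ → bdry (c x + c y) v = 0 := by
      intro v hv
      rw [bdry_add, zmod_two_add_eq_zero]
      exact congrFun hxy ⟨v, hv⟩
    intro v
    by_cases hv : v = v₀
    · subst hv
      have hz := ((hc x).add (hc y))
      have h2 : ∑ u, bdry (c x + c y) u = 0 :=
        IsEven.sum_sum_comm_eq_zero hz.symm (fun u => hz.eq_zero G.irrefl) Finset.univ
      rwa [Finset.sum_eq_single v (fun u _ hu => h1 u hu) (by simp)] at h2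
    · exact h1 v hv
  have hs : ∀ Z, IsEven G Z → ∃ s : ι → ZMod 2, s i₀ = 0 ∧ cob G φ s = Z := by
    intro Z hZ
    obtain ⟨s, hs⟩ := hφ.span Z hZ
    rcases zmod_two_cases (s i₀) with h | h
    · exact ⟨s, h, hs⟩
    · exact ⟨s + 1, by rw [Pi.add_apply, h]; exact zmod_two_add_self 1,
        by rw [cob_add, cob_one, hs, add_zero]⟩
  have hr : ∀ b : {v // v ≠ v₀} → ZMod 2, ∃ y, (∃ x, B x = b) → B y = b := by
    intro b
    by_cases h : ∃ x, B x = b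
    · exact ⟨h.choose, fun _ => h.choose_spec⟩
    · exact ⟨0, fun h' => absurd h' h⟩
  choose r hr using hr
  have hx : ∀ x, ∃ s : ι → ZMod 2, s i₀ = 0 ∧ cob G φ s = c x + c (r (B x)) := fun x =>
    hs _ (hev _ _ (hr (B x) ⟨x, rfl⟩).symm)
  choose σ hσ0 hσ using hx
  let F : A → ({v // v ≠ v₀} → ZMod 2) × ({i // i ≠ i₀} → ZMod 2) := fun x => (B x, fun i => σ x i)
  have hF : Function.Injective F := by
    intro x y hxy
    have h1 : B x = B y := congrArg Prod.fst hxy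
    have h2 : σ x = σ y := by
      funext i
      by_cases hi : i = i₀
      · rw [hi, hσ0, hσ0]
      · exact congrFun (congrArg Prod.snd hxy) ⟨i, hi⟩
    have h3 : c x = c y := by
      have := hσ x
      rw [h2, hσ y, h1] at this
      exact (add_right_cancel this).symm
    funext e
    obtain ⟨e, he⟩ := e
    induction e using Sym2.ind with
    | _ u v =>
      have := congrFun (congrFun h3 u) v
      have huv : G.Adj u v := he
      simpa [c, huv] using this
  have hcard := Fintype.card_le_of_injective F hF
  rw [Fintype.card_prod, Fintype.card_fun, Fintype.card_fun, Fintype.card_fun, ZMod.card, ← pow_add,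
    Nat.pow_le_pow_iff_right (by norm_num)] at hcard
  have hV : Fintype.card {v // v ≠ v₀} + 1 = Fintype.card V := by
    rw [Fintype.card_subtype_compl, Fintype.card_subtype_eq]
    exact Nat.sub_add_cancel (Fintype.card_pos_iff.2 ⟨v₀⟩)
  have hI : Fintype.card {i // i ≠ i₀} + 1 = Fintype.card ι := by
    rw [Fintype.card_subtype_compl, Fintype.card_subtype_eq]
    exact Nat.sub_add_cancel (Fintype.card_pos_iff.2 ⟨i₀⟩)
  omega

theorem IsFaceLabelling.sum_card_face_le {ι : Type*} [Fintype ι] (φ : V → V → ι) :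
    ∑ i, (Finset.univ.filter fun p : V × V => face G φ i p.1 p.2 ≠ 0).card ≤ 2 * dartCount G := by
  have h1 : ∀ i, (Finset.univ.filter fun p : V × V => face G φ i p.1 p.2 ≠ 0).card ≤
      ((Finset.univ.filter fun p : V × V => G.Adj p.1 p.2).filter fun p => φ p.1 p.2 = i).card +
      ((Finset.univ.filter fun p : V × V => G.Adj p.1 p.2).filter fun p => φ p.2 p.1 = i).card := by
    intro i
    refine le_trans (Finset.card_le_card ?_) (Finset.card_union_le _ _)
    intro p hp
    simp only [Finset.mem_filter, Finset.mem_univ, true_and, Finset.mem_union] at hp ⊢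
    by_contra hn
    apply hp
    unfold face cob
    split_ifs with ha
    · simp only [ha, true_and, not_or] at hn
      rw [Pi.single_eq_of_ne hn.1, Pi.single_eq_of_ne hn.2, add_zero]
    · rfl
  refine (Finset.sum_le_sum fun i _ => h1 i).trans ?_
  rw [Finset.sum_add_distrib,
    ← Finset.card_eq_sum_card_fiberwise (f := fun p : V × V => φ p.1 p.2)
      (fun _ _ => Finset.mem_univ _),
    ← Finset.card_eq_sum_card_fiberwise (f := fun p : V × V => φ p.2 p.1)
      (fun _ _ => Finset.mem_univ _), two_mul, dartCount]

theorem tri_eq_of_clique {a b c : V} (hab : a ≠ b) (hbc : b ≠ c) (hca : c ≠ a) :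
    tri a b c = fun u v => if u ∈ ({a, b, c} : Finset V) ∧ v ∈ ({a, b, c} : Finset V) ∧ u ≠ v
      then 1 else 0 := by
  funext u v
  rw [tri_eq hab hbc hca]
  congr 1
  simp only [Finset.mem_insert, Finset.mem_singleton]
  grind

/-- A MacLane graph with more edges than vertices has many faces of length four, unless it has many
triangles or few edges. -/
theorem IsMacLane.exists_quad_faces (h : IsMacLane G) (hd : 2 * Fintype.card V < dartCount G) :
    ∃ (ι : Type) (_ : Fintype ι) (φ : V → V → ι) (S : Finset ι), IsFaceLabelling G φ ∧
      (∀ i ∈ S, ∃ a b c d, G.Adj a b ∧ G.Adj b c ∧ G.Adj c d ∧ G.Adj d a ∧ a ≠ c ∧ b ≠ d ∧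
        face G φ i = quad a b c d) ∧ Function.Injective (face G φ) ∧
      3 * dartCount G + 20 ≤
        10 * Fintype.card V + 4 * {t : Finset V | G.IsNClique 3 t}.ncard + 2 * S.card := by
  obtain ⟨ι, hι, φ, hφ, hred⟩ := h.exists_reduced
  have hV : Nonempty V := by
    by_contra hV
    rw [not_nonempty_iff] at hV
    simp [dartCount] at hd
  obtain ⟨v₀⟩ := hV
  have heul := hφ.card_edgeSet_add_two_le v₀
  have hde := dartCount_eq G
  have h3 : 3 ≤ Fintype.card ι := by omega
  have hne : ∀ i, face G φ i ≠ 0 := by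
    intro i h0
    obtain ⟨j, hj⟩ : ∃ j, j ≠ i := by
      by_contra hn
      push Not at hn
      have := Fintype.card_le_one_iff.2 fun a b => (hn a).trans (hn b).symm
      omega
    have := hred _ h0 i j
    simp [hj] at this
  have hinj : Function.Injective (face G φ) := by
    intro i j hij
    by_contra hne
    obtain ⟨k, hki, hkj⟩ : ∃ k, k ≠ i ∧ k ≠ j := by
      by_contra hn
      push Not at hn
      have : (Finset.univ : Finset ι) ⊆ {i, j} := by
        intro k _
        by_cases h : k = i <;> simp [h]
        exact hn k h
      have := (Finset.card_le_card this).trans Finset.card_le_two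
      rw [Finset.card_univ] at this
      omega
    have h0 : cob G φ (Pi.single i 1 + Pi.single j 1) = 0 := by
      rw [cob_add]
      change face G φ i + face G φ j = 0
      rw [hij]
      funext u v
      exact zmod_two_add_self _
    have := hred _ h0 i k
    simp [hki, hkj, hne] at this
  let T : Finset ι := Finset.univ.filter fun i => ∃ a b c, G.Adj a b ∧ G.Adj b c ∧ G.Adj c a ∧
    face G φ i = tri a b c
  let S : Finset ι := Finset.univ.filter fun i => ∃ a b c d, G.Adj a b ∧ G.Adj b c ∧ G.Adj c d ∧
    G.Adj d a ∧ a ≠ c ∧ b ≠ d ∧ face G φ i = quad a b c d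
  refine ⟨ι, hι, φ, S, hφ, fun i hi => by simpa [S] using hi, hinj, ?_⟩
  have hT : T.card ≤ {t : Finset V | G.IsNClique 3 t}.ncard := by
    rw [Set.ncard_eq_toFinset_card', ← Finset.card_image_of_injective T hinj]
    refine le_trans (Finset.card_le_card ?_) (Finset.card_image_le
      (f := fun (t : Finset V) (u v : V) => if u ∈ t ∧ v ∈ t ∧ u ≠ v then (1 : ZMod 2) else 0))
    intro Z hZ
    obtain ⟨i, hi, rfl⟩ := Finset.mem_image.1 hZ
    obtain ⟨a, b, c, hab, hbc, hca, he⟩ := (Finset.mem_filter.1 hi).2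
    refine Finset.mem_image.2 ⟨{a, b, c}, ?_, ?_⟩
    · simp only [Set.mem_toFinset, Set.mem_ofPred_eq]
      exact is3Clique_triple_iff.2 ⟨hab, hca.symm, hbc⟩
    · rw [he, tri_eq_of_clique hab.ne hbc.ne hca.ne]
  have hsum := IsFaceLabelling.sum_card_face_le (G := G) φ
  have hlow : ∀ i, 10 ≤ (Finset.univ.filter fun p : V × V => face G φ i p.1 p.2 ≠ 0).card +
      ((if i ∈ T then 4 else 0) + (if i ∈ S then 2 else 0)) := by
    intro i
    rcases (hφ.isEven (Pi.single i 1)).classify (hne i) with ⟨⟨a, b, c, hh⟩, h6⟩ |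
      ⟨⟨a, b, c, d, hh⟩, h8⟩ | h10
    · have hi : i ∈ T := by
        simp only [T, Finset.mem_filter, Finset.mem_univ, true_and]
        exact ⟨a, b, c, hh⟩
      rw [if_pos hi]
      have h6' : 6 ≤ (Finset.univ.filter fun p : V × V => face G φ i p.1 p.2 ≠ 0).card := h6
      omega
    · have hi : i ∈ S := by
        simp only [S, Finset.mem_filter, Finset.mem_univ, true_and]
        exact ⟨a, b, c, d, hh⟩
      rw [if_pos hi]
      have h8' : 8 ≤ (Finset.univ.filter fun p : V × V => face G φ i p.1 p.2 ≠ 0).card := h8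
      omega
    · exact le_trans h10 (Nat.le_add_right _ _)
  have hlow' := Finset.sum_le_sum fun i (_ : i ∈ (Finset.univ : Finset ι)) => hlow i
  rw [Finset.sum_add_distrib, Finset.sum_add_distrib, Finset.sum_const, Finset.card_univ,
    ← Finset.sum_filter, ← Finset.sum_filter, Finset.sum_const, Finset.sum_const,
    Finset.filter_mem_eq_inter, Finset.filter_mem_eq_inter, Finset.univ_inter,
    Finset.univ_inter] at hlow'
  simp only [smul_eq_mul] at hlow'
  omega

end Euler

section Coloring

variable {V : Type*} {G G' : SimpleGraph V} {A B : Set V}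

/-- `c` is a proper coloring of the subgraph induced by `A`. -/
def ProperOn (G : SimpleGraph V) (A : Set V) (c : V → Fin 3) : Prop :=
  ∀ u ∈ A, ∀ v ∈ A, G.Adj u v → c u ≠ c v

/-- The subgraph induced by `A` is 3-colorable. -/
def ColorableOn (G : SimpleGraph V) (A : Set V) : Prop := ∃ c, ProperOn G A c

theorem ProperOn.mono {c : V → Fin 3} (h : ProperOn G B c) (hAB : A ⊆ B) : ProperOn G A c :=
  fun u hu v hv huv => h u (hAB hu) v (hAB hv) huv

theorem ColorableOn.mono (h : ColorableOn G B) (hAB : A ⊆ B) : ColorableOn G A :=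
  h.imp fun _ hc => hc.mono hAB

theorem ColorableOn.mono_left (h : ColorableOn G' A)
    (hG : ∀ u ∈ A, ∀ v ∈ A, G.Adj u v → G'.Adj u v) : ColorableOn G A :=
  h.imp fun _ hc u hu v hv huv => hc u hu v hv (hG u hu v hv huv)

theorem colorableOn_univ : ColorableOn G Set.univ ↔ G.Colorable 3 :=
  ⟨fun ⟨c, hc⟩ => ⟨Coloring.mk c fun {u v} huv => hc u trivial v trivial huv⟩,
    fun ⟨c⟩ => ⟨c, fun _ _ _ _ huv => c.valid huv⟩⟩

theorem ProperOn.comp_perm {c : V → Fin 3} (h : ProperOn G A c) (σ : Equiv.Perm (Fin 3)) :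
    ProperOn G A (fun v => σ (c v)) :=
  fun u hu v hv huv he => h u hu v hv huv (σ.injective he)

theorem ProperOn.glue {c d : V → Fin 3} (hc : ProperOn G A c) (hd : ProperOn G B d)
    (hAB : ∀ v ∈ A, v ∈ B → c v = d v) (hcov : ∀ v, v ∈ A ∨ v ∈ B)
    (hsep : ∀ u v, u ∉ A → v ∉ B → ¬ G.Adj u v) :
    ∃ e, ProperOn G Set.univ e ∧ (∀ v ∈ A, e v = c v) ∧ ∀ v ∈ B, e v = d v := by
  have hB : ∀ v ∈ B, (if v ∈ A then c v else d v) = d v := by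
    intro v hv
    split_ifs with h
    · exact hAB v h hv
    · rfl
  refine ⟨fun v => if v ∈ A then c v else d v, ?_, fun v hv => if_pos hv, hB⟩
  intro u _ v _ huv
  beta_reduce
  by_cases hu : u ∈ A <;> by_cases hv : v ∈ A
  · simpa only [if_pos hu, if_pos hv] using hc u hu v hv huv
  · have hvB := (hcov v).resolve_left hv
    by_cases huB : u ∈ B
    · rw [hB u huB, hB v hvB]; exact hd u huB v hvB huv
    · exact absurd huv.symm (hsep v u hv huB)
  · have huB := (hcov u).resolve_left hu
    by_cases hvB : v ∈ B
    · rw [hB u huB, hB v hvB]; exact hd u huB v hvB huv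
    · exact absurd huv (hsep u v hu hvB)
  · have huB := (hcov u).resolve_left hu
    have hvB := (hcov v).resolve_left hv
    rw [hB u huB, hB v hvB]; exact hd u huB v hvB huv

/-- Colorings injective on the overlap can be matched. -/
theorem exists_perm_eqOn {c d : V → Fin 3} (K : Set V) (hc : Set.InjOn c K) (hd : Set.InjOn d K) :
    ∃ σ : Equiv.Perm (Fin 3), ∀ v ∈ K, c v = σ (d v) := by
  let e : {x // x ∈ d '' K} ≃ {x // x ∈ c '' K} :=
    (Equiv.Set.imageOfInjOn d K hd).symm.trans (Equiv.Set.imageOfInjOn c K hc)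
  refine ⟨e.extendSubtype, fun v hv => ?_⟩
  rw [Equiv.extendSubtype_apply_of_mem e (d v) ⟨v, hv, rfl⟩]
  have : (Equiv.Set.imageOfInjOn d K hd).symm ⟨d v, v, hv, rfl⟩ = ⟨v, hv⟩ := by
    rw [Equiv.symm_apply_eq]; rfl
  change _ = ((Equiv.Set.imageOfInjOn c K hc) ((Equiv.Set.imageOfInjOn d K hd).symm _) : Fin 3)
  rw [this]; rfl

theorem ProperOn.extend {c : V → Fin 3} {v : V} (h : ProperOn G {v}ᶜ c) {k : Fin 3}
    (hk : ∀ u, G.Adj v u → c u ≠ k) : ProperOn G Set.univ (Function.update c v k) := by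
  intro a _ b _ hab
  by_cases ha : a = v
  · subst ha
    rw [Function.update_self, Function.update_of_ne hab.ne']
    exact (hk b hab).symm
  · by_cases hb : b = v
    · subst hb
      rw [Function.update_self, Function.update_of_ne hab.ne]
      exact hk a hab.symm
    · rw [Function.update_of_ne ha, Function.update_of_ne hb]
      exact h a ha b hb hab

theorem exists_color_ne (i j : Fin 3) : ∃ k, i ≠ k ∧ j ≠ k := by
  revert i j; decide

/-- `G` is not 3-colorable, but all its vertex-deleted subgraphs are. -/
structure IsCritical (G : SimpleGraph V) : Prop where
  not_colorable : ¬ ColorableOn G Set.univ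
  colorable : ∀ v, ColorableOn G {v}ᶜ

theorem IsCritical.colorable_of_notMem (h : IsCritical G) {v : V} (hv : v ∉ A) :
    ColorableOn G A :=
  (h.colorable v).mono fun _ hu huv => hv (huv ▸ hu)

theorem IsCritical.exists_adj (h : IsCritical G) (v a b : V) : ∃ u, G.Adj v u ∧ u ≠ a ∧ u ≠ b := by
  by_contra hn
  push Not at hn
  obtain ⟨c, hc⟩ := h.colorable v
  obtain ⟨k, hk1, hk2⟩ := exists_color_ne (c a) (c b)
  refine h.not_colorable ⟨_, hc.extend (k := k) fun u hu => ?_⟩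
  by_cases hua : u = a
  · rwa [hua]
  · rwa [hn u hu hua]

theorem IsCritical.noCutVertex (h : IsCritical G) : NoCutVertex G := by
  intro v X hv hX ⟨w, hw, hwv⟩
  by_contra hn
  push Not at hn
  obtain ⟨x, hx⟩ := hX
  obtain ⟨c, hc⟩ := h.colorable_of_notMem (A := X ∪ {v}) (v := w) (by simp [hw, hwv])
  obtain ⟨d, hd⟩ := h.colorable_of_notMem (A := Xᶜ) (v := x) (by simpa using hx)
  obtain ⟨σ, hσ⟩ := exists_perm_eqOn (c := c) (d := d) {v} (by simp) (by simp)
  obtain ⟨e, he, -⟩ := hc.glue (hd.comp_perm σ) (fun u hu huX => by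
      rcases hu with hu | hu
      · exact absurd hu huX
      · exact hσ u hu) (fun u => by
      by_cases hu : u ∈ X
      · exact Or.inl (Or.inl hu)
      · exact Or.inr hu) (fun u w hu hw huw => by
      simp only [Set.mem_union, Set.mem_singleton_iff, not_or] at hu
      exact hn w (by simpa using hw) u hu.1 hu.2 huw.symm)
  exact h.not_colorable ⟨e, he⟩

end Coloring

section Cross

variable {V : Type*} {G G' : SimpleGraph V} {A B C D : Finset V}

/-- The number of ordered adjacent pairs in `A × B`. -/
noncomputable def cross (G : SimpleGraph V) (A B : Finset V) : ℕ :=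
  ∑ a ∈ A, ∑ b ∈ B, if G.Adj a b then 1 else 0

theorem cross_comm : cross G A B = cross G B A := by
  rw [cross, Finset.sum_comm, cross]
  simp only [G.adj_comm]

theorem cross_union_left (h : Disjoint A B) : cross G (A ∪ B) C = cross G A C + cross G B C :=
  Finset.sum_union h

theorem cross_union_right (h : Disjoint A B) : cross G C (A ∪ B) = cross G C A + cross G C B := by
  rw [cross_comm, cross_union_left h, cross_comm, cross_comm (A := B)]

theorem cross_union_self (h : Disjoint A B) :
    cross G (A ∪ B) (A ∪ B) = cross G A A + cross G B B + 2 * cross G A B := by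
  rw [cross_union_left h, cross_union_right h, cross_union_right h, cross_comm (A := B) (B := A)]
  ring

theorem cross_singleton (a b : V) : cross G {a} {b} = if G.Adj a b then 1 else 0 := by
  rw [cross, Finset.sum_singleton, Finset.sum_singleton]

theorem cross_singleton_left (a : V) : cross G {a} B = ∑ b ∈ B, if G.Adj a b then 1 else 0 := by
  simp [cross]

theorem cross_mono (hA : A ⊆ C) (hB : B ⊆ D) : cross G A B ≤ cross G C D :=
  (Finset.sum_le_sum fun _ _ => Finset.sum_le_sum_of_subset hB).trans
    (Finset.sum_le_sum_of_subset hA)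

theorem cross_insert_self {a : V} (h : a ∉ A) :
    cross G (insert a A) (insert a A) = cross G A A + 2 * cross G {a} A := by
  rw [Finset.insert_eq, cross_union_self (by simpa using h), cross_singleton]
  simp

theorem even_cross (A : Finset V) : ∃ e, cross G A A = 2 * e := by
  induction A using Finset.induction_on with
  | empty => exact ⟨0, by simp [cross]⟩
  | insert a A ha ih =>
    obtain ⟨e, he⟩ := ih
    exact ⟨e + cross G {a} A, by rw [cross_insert_self ha, he]; ring⟩

theorem cross_self_le (A : Finset V) : cross G A A ≤ A.card * (A.card - 1) := by
  rw [cross, ← smul_eq_mul, ← Finset.sum_const]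
  refine Finset.sum_le_sum fun a ha => ?_
  rw [← Finset.card_filter, ← Finset.card_erase_of_mem ha]
  refine Finset.card_le_card fun b hb => ?_
  simp only [Finset.mem_filter] at hb
  exact Finset.mem_erase.2 ⟨hb.2.ne', hb.1⟩

theorem dartCount_eq_cross [Fintype V] : dartCount G = cross G Finset.univ Finset.univ := by
  rw [dartCount, cross, Finset.card_filter, ← Finset.univ_product_univ, Finset.sum_product]

/-- Twice the Kostochka–Yancey potential of a vertex set. -/
noncomputable def potential (G : SimpleGraph V) (A : Finset V) : ℤ := 10 * A.card - 3 * cross G A A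

theorem colorableOn_of_card_le (h : A.card ≤ 3) : ColorableOn G (A : Set V) := by
  obtain ⟨f⟩ : Nonempty (A ↪ Fin 3) :=
    Function.Embedding.nonempty_of_card_le (by simpa using h)
  refine ⟨fun v => if hv : v ∈ A then f ⟨v, hv⟩ else 0, fun u hu v hv huv => ?_⟩
  rw [Finset.mem_coe] at hu hv
  beta_reduce
  rw [dif_pos hu, dif_pos hv]
  intro he
  exact huv.ne (congrArg Subtype.val (f.injective he))

end Cross

section Collapse

variable {V : Type u} {G : SimpleGraph V}

/-- The graph obtained from `G` by replacing the colored set `R` by a triangle of colors. -/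
def collapse (G : SimpleGraph V) (R : Finset V) (φ : V → Fin 3) : SimpleGraph (V ⊕ Fin 3) where
  Adj
    | .inl u, .inl v => G.Adj u v
    | .inl u, .inr c => ∃ r ∈ R, φ r = c ∧ G.Adj u r
    | .inr c, .inl u => ∃ r ∈ R, φ r = c ∧ G.Adj u r
    | .inr c, .inr d => c ≠ d
  symm := ⟨fun x y h => by
    cases x <;> cases y
    · exact G.symm.symm _ _ h
    · exact h
    · exact h
    · exact Ne.symm h⟩
  loopless := ⟨fun x h => by
    cases x
    · exact G.irrefl h
    · exact h rfl⟩

variable {R : Finset V} {φ : V → Fin 3}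

@[simp] theorem collapse_inl_inl {u v : V} :
    (collapse G R φ).Adj (.inl u) (.inl v) ↔ G.Adj u v := Iff.rfl

@[simp] theorem collapse_inl_inr {u : V} {c : Fin 3} :
    (collapse G R φ).Adj (.inl u) (.inr c) ↔ ∃ r ∈ R, φ r = c ∧ G.Adj u r := Iff.rfl

@[simp] theorem collapse_inr_inr {c d : Fin 3} :
    (collapse G R φ).Adj (.inr c) (.inr d) ↔ c ≠ d := Iff.rfl

theorem ColorableOn.of_collapse [Fintype V] (hφ : ProperOn G R φ)
    (h : ColorableOn (collapse G R φ) ((Rᶜ).disjSum (Finset.univ : Finset (Fin 3)) : Finset _)) :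
    ColorableOn G Set.univ := by
  obtain ⟨d, hd⟩ := h
  have hr : ∀ c : Fin 3, Sum.inr c ∈ (((Rᶜ).disjSum (Finset.univ : Finset (Fin 3)) : Finset _) :
    Set (V ⊕ Fin 3)) := by simp
  have hl : ∀ v ∉ R, Sum.inl v ∈ (((Rᶜ).disjSum (Finset.univ : Finset (Fin 3)) : Finset _) :
    Set (V ⊕ Fin 3)) := by simp
  refine ⟨fun v => if v ∈ R then d (.inr (φ v)) else d (.inl v), fun u _ v _ huv => ?_⟩
  beta_reduce
  split_ifs with hu hv hv
  · exact hd _ (hr _) _ (hr _) (hφ u hu v hv huv)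
  · exact (hd _ (hl v hv) _ (hr _) ⟨u, hu, rfl, huv.symm⟩).symm
  · exact hd _ (hl u hu) _ (hr _) ⟨v, hv, rfl, huv⟩
  · exact hd _ (hl u hu) _ (hl v hv) huv

theorem cross_collapse_le (W : Finset V) (X : Finset (Fin 3)) :
    cross (collapse G R φ) (W.disjSum X) (W.disjSum X) ≤
      cross G W W + 2 * cross G W (R.filter fun r => φ r ∈ X) + X.card * (X.card - 1) := by
  have h1 : ∑ c ∈ X, ∑ d ∈ X, (if (collapse G R φ).Adj (.inr c) (.inr d) then 1 else 0) ≤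
      X.card * (X.card - 1) := by
    rw [← smul_eq_mul, ← Finset.sum_const]
    refine Finset.sum_le_sum fun c hc => ?_
    rw [← Finset.card_filter, ← Finset.card_erase_of_mem hc]
    refine Finset.card_le_card fun d hd => ?_
    simp only [Finset.mem_filter, collapse_inr_inr] at hd
    exact Finset.mem_erase.2 ⟨hd.2.symm, hd.1⟩
  have h2 : ∑ w ∈ W, ∑ c ∈ X, (if (collapse G R φ).Adj (.inl w) (.inr c) then 1 else 0) ≤
      cross G W (R.filter fun r => φ r ∈ X) := by
    refine Finset.sum_le_sum fun w _ => ?_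
    rw [← Finset.card_filter, ← Finset.card_filter]
    refine (Finset.card_le_card ?_).trans (Finset.card_image_le (f := φ))
    intro c hc
    simp only [Finset.mem_filter, collapse_inl_inr] at hc
    obtain ⟨hcX, r, hr, rfl, hwr⟩ := hc
    exact Finset.mem_image_of_mem _ (by simp [hr, hcX, hwr])
  have h3 : ∑ c ∈ X, ∑ w ∈ W, (if (collapse G R φ).Adj (.inr c) (.inl w) then 1 else 0) =
      ∑ w ∈ W, ∑ c ∈ X, (if (collapse G R φ).Adj (.inl w) (.inr c) then 1 else 0) := by
    rw [Finset.sum_comm]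
    simp only [adj_comm]
  rw [cross, Finset.sum_disjSum]
  simp only [Finset.sum_disjSum, Finset.sum_add_distrib, collapse_inl_inl]
  rw [h3]
  unfold cross at *
  omega

end Collapse

/-- The critical subgraph bound, for vertex sets with fewer than `n` elements. -/
def DenseBelow (n : ℕ) : Prop :=
  ∀ (V : Type u) (G : SimpleGraph V) (S : Finset V), S.card < n → ¬ ColorableOn G S →
    ∃ W ⊆ S, ¬ ColorableOn G W ∧ potential G W ≤ 4

section Potential

variable {V : Type u} [Fintype V] {G : SimpleGraph V}

theorem IsCritical.exists_collapse (h : IsCritical G) (ih : DenseBelow.{u} (Fintype.card V))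
    {R : Finset V} (hR : 4 ≤ R.card) {φ : V → Fin 3} (hφ : ProperOn G R φ) :
    ∃ (W : Finset V) (X : Finset (Fin 3)), Disjoint R W ∧ X.Nonempty ∧
      potential G (R ∪ W) + 6 * cross G W (R.filter fun r => φ r ∉ X) +
        (10 * X.card - 3 * (X.card * (X.card - 1) : ℕ)) ≤ potential G R + 4 := by
  have hRV := Finset.card_le_univ R
  obtain ⟨Y, hYS, hYc, hYp⟩ := ih _ (collapse G R φ) ((Rᶜ).disjSum Finset.univ)
    (by rw [Finset.card_disjSum, Finset.card_compl, Finset.card_univ, Fintype.card_fin]; omega)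
    (fun hc => h.not_colorable (hc.of_collapse hφ))
  obtain ⟨W, X, rfl⟩ : ∃ W X, Y = Finset.disjSum W X :=
    ⟨_, _, (Finset.toLeft_disjSum_toRight).symm⟩
  have hdis : Disjoint R W := by
    rw [Finset.disjoint_left]
    intro r hr hrW
    have : Sum.inl r ∈ (Rᶜ).disjSum (Finset.univ : Finset (Fin 3)) :=
      hYS (Finset.inl_mem_disjSum.2 hrW)
    rw [Finset.inl_mem_disjSum] at this
    exact (Finset.mem_compl.1 this) hr
  refine ⟨W, X, hdis, ?_, ?_⟩
  · by_contra hX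
    rw [Finset.not_nonempty_iff_eq_empty] at hX
    subst hX
    obtain ⟨r, hr⟩ : R.Nonempty := Finset.card_pos.1 (by omega)
    obtain ⟨c, hc⟩ := h.colorable_of_notMem (A := (W : Set V)) (v := r)
      (fun hrW => Finset.disjoint_left.1 hdis hr hrW)
    refine hYc ⟨Sum.elim c fun _ => 0, ?_⟩
    rintro (x | x) hx (y | y) hy hxy
    · exact hc x (by simpa using hx) y (by simpa using hy) hxy
    · simp at hy
    · simp at hx
    · simp at hx
  · have hle := cross_collapse_le (G := G) (R := R) (φ := φ) W X
    have hsplit : cross G W R = cross G W (R.filter fun r => φ r ∈ X) +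
        cross G W (R.filter fun r => φ r ∉ X) := by
      rw [← cross_union_right (Finset.disjoint_filter_filter_not _ _ _),
        Finset.filter_union_filter_not_eq]
    have hun := cross_union_self (G := G) hdis
    rw [cross_comm (A := R) (B := W)] at hun
    unfold potential at hYp ⊢
    rw [Finset.card_union_of_disjoint hdis, hun]
    rw [Finset.card_disjSum] at hYp
    generalize X.card * (X.card - 1) = k at *
    omega

theorem even_potential (A : Finset V) : ∃ k : ℤ, potential G A = 2 * k := by
  obtain ⟨e, he⟩ := even_cross (G := G) A
  exact ⟨5 * A.card - 3 * e, by rw [potential, he]; push_cast; ring⟩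

theorem potential_complete {X : Finset (Fin 3)} (hX : X.Nonempty) :
    (10 : ℤ) ≤ 10 * X.card - 3 * (X.card * (X.card - 1) : ℕ) ∧
      (2 ≤ X.card → (12 : ℤ) ≤ 10 * X.card - 3 * (X.card * (X.card - 1) : ℕ)) := by
  have h1 := Finset.card_pos.2 hX
  have h2 := Finset.card_le_univ X
  rw [Fintype.card_fin] at h2
  generalize X.card = k at *
  interval_cases k <;> simp

/-- Proper subsets of a sparse critical graph have potential at least that of a triangle. -/
theorem IsCritical.twelve_le_potential (h : IsCritical G) (ih : DenseBelow.{u} (Fintype.card V))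
    (hV : 4 < potential G Finset.univ) {R : Finset V} (hR : R ≠ Finset.univ) (h2 : 2 ≤ R.card) :
    12 ≤ potential G R := by
  rcases Nat.lt_or_ge R.card 4 with h4 | h4
  · have := cross_self_le (G := G) R
    unfold potential
    generalize R.card = k at *
    interval_cases k <;> omega
  · by_contra hlt
    obtain ⟨S, hS, hmin⟩ := Finset.exists_min_image
      (Finset.univ.filter fun S : Finset V => S ≠ Finset.univ ∧ 4 ≤ S.card) (potential G)
      ⟨R, by simp [hR, h4]⟩
    simp only [Finset.mem_filter, Finset.mem_univ, true_and] at hS hmin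
    obtain ⟨v, hv⟩ : ∃ v, v ∉ S := by
      by_contra hn
      push Not at hn
      exact hS.1 (Finset.eq_univ_of_forall hn)
    obtain ⟨φ, hφ⟩ := h.colorable_of_notMem (A := (S : Set V)) (by simpa using hv)
    obtain ⟨W, X, hd, hX, hp⟩ := h.exists_collapse ih hS.2 hφ
    have := (potential_complete hX).1
    have hSR := hmin R ⟨hR, h4⟩
    by_cases hu : S ∪ W = Finset.univ
    · rw [hu] at hp
      obtain ⟨k, hk⟩ := even_potential (G := G) (Finset.univ : Finset V)
      omega
    · have := hmin (S ∪ W) ⟨hu, hS.2.trans (Finset.card_le_card Finset.subset_union_left)⟩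
      omega

theorem cross_addEdge_le (a b : V) (W : Finset V) :
    cross (addEdge G a b) W W ≤ cross G W W + 2 := by
  obtain ⟨H, hH⟩ : ∃ H, H = addEdge G a b := ⟨_, rfl⟩
  rw [← hH]
  have : ∀ u v, (if H.Adj u v then 1 else 0) ≤ (if G.Adj u v then 1 else 0) +
      ((if u = a then (if v = b then 1 else 0) else 0) +
        (if u = b then (if v = a then 1 else 0) else 0)) := by
    intro u v
    simp only [hH, addEdge_adj]
    grind
  refine (Finset.sum_le_sum fun u _ => Finset.sum_le_sum fun v _ => this u v).trans ?_
  simp only [Finset.sum_add_distrib, cross]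
  have key : ∀ x y : V, ∑ u ∈ W, ∑ v ∈ W, (if u = x then (if v = y then 1 else 0) else 0) ≤ 1 := by
    intro x y
    have : ∀ u ∈ W, ∑ v ∈ W, (if u = x then (if v = y then 1 else 0) else 0) ≤
        if u = x then 1 else 0 := by
      intro u _
      split_ifs
      · rw [Finset.sum_ite_eq']; split_ifs <;> simp
      · simp
    refine (Finset.sum_le_sum this).trans ?_
    rw [Finset.sum_ite_eq']; split_ifs <;> simp
  have := key a b
  have := key b a
  omega

theorem potential_le_addEdge (a b : V) (W : Finset V) :
    potential G W ≤ potential (addEdge G a b) W + 6 := by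
  have := cross_addEdge_le (G := G) a b W
  unfold potential
  omega

/-- A proper subset of a sparse critical graph is still colorable when an edge is added. -/
theorem IsCritical.colorableOn_addEdge (h : IsCritical G) (ih : DenseBelow.{u} (Fintype.card V))
    (hV : 4 < potential G Finset.univ) {R : Finset V} (hR : R ≠ Finset.univ) (a b : V) :
    ColorableOn (addEdge G a b) R := by
  obtain ⟨v, hv⟩ : ∃ v, v ∉ R := by
    by_contra hn
    push Not at hn
    exact hR (Finset.eq_univ_of_forall hn)
  by_contra hc
  obtain ⟨W, hWR, hWc, hWp⟩ := ih V (addEdge G a b) R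
    (Finset.card_lt_univ_of_notMem hv) hc
  have h1 := potential_le_addEdge (G := G) a b W
  have h4 : ¬ W.card ≤ 3 := fun h3 => hWc (colorableOn_of_card_le h3)
  have hW : W ≠ Finset.univ := by
    rintro rfl
    exact hv (hWR (Finset.mem_univ v))
  have := h.twelve_le_potential ih hV hW (by omega)
  omega

theorem IsCritical.fourteen_le_potential (h : IsCritical G) (ih : DenseBelow.{u} (Fintype.card V))
    (hV : 4 < potential G Finset.univ) {R : Finset V} (hR : R ≠ Finset.univ) (h4 : 4 ≤ R.card) :
    14 ≤ potential G R := by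
  by_contra hlt
  obtain ⟨k, hk⟩ := even_potential (G := G) R
  obtain ⟨z, hz⟩ : ∃ v, v ∉ R := by
    by_contra hn
    push Not at hn
    exact hR (Finset.eq_univ_of_forall hn)
  have hbd : ∀ r ∈ R, ∃ u ∈ R, u ≠ r ∧ ∃ w, w ∉ R ∧ G.Adj u w := by
    intro r hr
    obtain ⟨s, hs, hsr⟩ := Finset.exists_mem_ne (show 1 < R.card by omega) r
    obtain ⟨a, ha, b, hb, hbr, hab⟩ := h.noCutVertex r {x | x ∉ R} (by simpa using hr) ⟨z, hz⟩
      ⟨s, by simpa using hs, hsr⟩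
    exact ⟨b, by simpa using hb, hbr, a, ha, hab.symm⟩
  obtain ⟨r, hr⟩ : R.Nonempty := Finset.card_pos.1 (by omega)
  obtain ⟨u, hu, -, wu, hwu, huw⟩ := hbd r hr
  obtain ⟨v, hv, hvu, wv, hwv, hvw⟩ := hbd u hu
  obtain ⟨φ, hφ⟩ := h.colorableOn_addEdge ih hV hR u v
  have hφuv : φ u ≠ φ v := hφ u hu v hv (addEdge_adj.2 (Or.inr ⟨Or.inl ⟨rfl, rfl⟩, hvu.symm⟩))
  obtain ⟨W, X, hd, hX, hp⟩ := h.exists_collapse ih h4 (R := R) (φ := φ)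
    fun a ha b hb hab => hφ a ha b hb (addEdge_adj.2 (Or.inl hab))
  obtain ⟨hX1, hX2⟩ := potential_complete hX
  have hlow : R ∪ W ≠ Finset.univ → 12 ≤ potential G (R ∪ W) := fun hne =>
    h.twelve_le_potential ih hV hne
      ((show 2 ≤ R.card by omega).trans (Finset.card_le_card Finset.subset_union_left))
  by_cases huniv : R ∪ W = Finset.univ
  · rcases Nat.lt_or_ge X.card 2 with hXc | hXc
    · have hout : ∃ r ∈ R, φ r ∉ X ∧ ∃ w, w ∉ R ∧ G.Adj r w := by
        by_contra hn
        push Not at hn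
        have h1 : φ u ∈ X := by by_contra hx; exact hn u hu hx wu hwu huw
        have h2 : φ v ∈ X := by by_contra hx; exact hn v hv hx wv hwv hvw
        have := Finset.one_lt_card.2 ⟨_, h1, _, h2, hφuv⟩
        omega
      obtain ⟨r, hr, hrX, w, hw, hrw⟩ := hout
      have hwW : w ∈ W := (Finset.mem_union.1 (huniv ▸ Finset.mem_univ w)).resolve_left hw
      have hcr : 1 ≤ cross G W (R.filter fun r => φ r ∉ X) := by
        have := cross_mono (G := G) (Finset.singleton_subset_iff.2 hwW)
          (Finset.singleton_subset_iff.2 (show r ∈ R.filter fun r => φ r ∉ X by simp [hr, hrX]))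
        rwa [cross_singleton, if_pos hrw.symm] at this
      rw [huniv] at hp
      omega
    · have := hX2 hXc
      rw [huniv] at hp
      omega
  · have := hlow huniv
    omega

end Potential

section Merge

variable {V W : Type*} {G : SimpleGraph V}

/-- The simple graph induced on the image of a map. -/
def image (π : V → W) (G : SimpleGraph V) : SimpleGraph W where
  Adj u v := u ≠ v ∧ ∃ a b, π a = u ∧ π b = v ∧ G.Adj a b
  symm := ⟨fun _ _ ⟨h, a, b, ha, hb, hab⟩ => ⟨h.symm, b, a, hb, ha, hab.symm⟩⟩
  loopless := ⟨fun _ h => h.1 rfl⟩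

theorem image_adj {π : V → W} {u v : W} :
    (image π G).Adj u v ↔ u ≠ v ∧ ∃ a b, π a = u ∧ π b = v ∧ G.Adj a b := Iff.rfl

theorem ProperOn.comp_image {π : V → W} {A : Set W} {c : W → Fin 3}
    (hc : ProperOn (image π G) A c) :
    ∀ u v, π u ∈ A → π v ∈ A → π u ≠ π v → G.Adj u v → c (π u) ≠ c (π v) :=
  fun u v hu hv hne huv => hc _ hu _ hv ⟨hne, u, v, rfl, rfl, huv⟩

theorem cross_image_le {s t : V} {A : Finset V} (hs : s ∈ A) (ht : t ∉ A) (hst : s ≠ t) :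
    cross (image (Function.update id t s) G) A A ≤ cross G (insert t A) (insert t A) := by
  obtain ⟨H, hH⟩ : ∃ H, H = image (Function.update id t s) G := ⟨_, rfl⟩
  rw [← hH]
  have hA : A = insert s (A.erase s) := (Finset.insert_erase hs).symm
  have hadj : ∀ u v, u ≠ s → u ≠ t → v ≠ t → H.Adj u v → G.Adj u v ∨ (v = s ∧ G.Adj u t) := by
    intro u v hus hut hvt huv
    rw [hH, image_adj] at huv
    obtain ⟨-, a, b, rfl, rfl, hab⟩ := huv
    by_cases ha : a = t
    · subst ha; simp at hus
    · rw [Function.update_of_ne ha] at *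
      by_cases hb : b = t
      · subst hb
        right
        exact ⟨by simp, hab⟩
      · rw [Function.update_of_ne hb] at *
        exact Or.inl hab
  have e1 : cross H (A.erase s) (A.erase s) ≤ cross G (A.erase s) (A.erase s) := by
    refine Finset.sum_le_sum fun u hu => Finset.sum_le_sum fun v hv => ?_
    rw [Finset.mem_erase] at hu hv
    have := hadj u v hu.1 (fun h => ht (h ▸ hu.2)) (fun h => ht (h ▸ hv.2))
    split_ifs with h1 h2 <;> simp
    exact h2 ((this h1).resolve_right fun h => hv.1 h.1)
  have e2 : cross H {s} (A.erase s) ≤ cross G {s} (A.erase s) + cross G {t} (A.erase s) := by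
    rw [cross_singleton_left, cross_singleton_left, cross_singleton_left, ← Finset.sum_add_distrib]
    refine Finset.sum_le_sum fun u hu => ?_
    rw [Finset.mem_erase] at hu
    have := hadj u s hu.1 (fun h => ht (h ▸ hu.2)) hst
    rw [H.adj_comm, G.adj_comm s, G.adj_comm t]
    split_ifs with h1 h2 h3 h4 <;> simp
    rcases this h1 with h | h
    · exact h2 h
    · exact h4 h.2
  rw [cross_insert_self ht, hA, cross_insert_self (Finset.notMem_erase s A),
    cross_insert_self (Finset.notMem_erase s A), ← hA]
  have := cross_mono (G := G) (Finset.Subset.refl {t}) (Finset.erase_subset s A)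
  omega

end Merge

section Degree

variable {V : Type u} [Fintype V] {G : SimpleGraph V}

theorem cross_univ_eq_sum_degree : cross G Finset.univ Finset.univ = ∑ v, G.degree v := by
  refine Finset.sum_congr rfl fun v _ => ?_
  rw [← Finset.card_filter, ← G.card_neighborFinset_eq_degree]
  congr 1
  ext u; simp

theorem exists_third_neighbor {x y z : V} (hd : G.degree x = 3) (hy : G.Adj x y) (hz : G.Adj x z)
    (hyz : y ≠ z) :
    ∃ w, w ≠ y ∧ w ≠ z ∧ G.Adj x w ∧ ∀ u, G.Adj x u → u = y ∨ u = z ∨ u = w := by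
  rw [← G.card_neighborFinset_eq_degree] at hd
  have h2 : ({y, z} : Finset V) ⊆ G.neighborFinset x := by
    intro u hu
    rcases Finset.mem_insert.1 hu with rfl | hu
    · simpa using hy
    · rw [Finset.mem_singleton] at hu
      subst hu; simpa using hz
  have hc : (G.neighborFinset x \ {y, z}).card = 1 := by
    rw [Finset.card_sdiff_of_subset h2, Finset.card_pair hyz, hd]
  obtain ⟨w, hw⟩ := Finset.card_eq_one.1 hc
  have hm : ∀ u, (G.Adj x u ∧ u ≠ y ∧ u ≠ z) ↔ u = w := by
    intro u
    rw [← Finset.mem_singleton, ← hw]; simp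
  have := (hm w).2 rfl
  refine ⟨w, this.2.1, this.2.2, this.1, fun u hu => ?_⟩
  by_contra hn
  push Not at hn
  exact hn.2.2 ((hm u).1 ⟨hu, hn.1, hn.2.1⟩)

theorem exists_two_neighbors {x y : V} (hd : G.degree x = 3) (hy : G.Adj x y) :
    ∃ z w, z ≠ y ∧ w ≠ y ∧ z ≠ w ∧ G.Adj x z ∧ G.Adj x w ∧
      ∀ u, G.Adj x u → u = y ∨ u = z ∨ u = w := by
  have : 1 < (G.neighborFinset x).card := by rw [G.card_neighborFinset_eq_degree]; omega
  obtain ⟨z, hz, hzy⟩ := Finset.exists_mem_ne this y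
  rw [mem_neighborFinset] at hz
  obtain ⟨w, hwy, hwz, hw, hall⟩ := exists_third_neighbor hd hy hz hzy.symm
  exact ⟨z, w, hzy, hwy, hwz.symm, hz, hw, hall⟩

theorem IsCritical.three_le_degree (h : IsCritical G) (v : V) : 3 ≤ G.degree v := by
  by_contra hlt
  obtain ⟨a, b, hab⟩ : ∃ a b, ∀ u, G.Adj v u → u = a ∨ u = b := by
    obtain ⟨a, ha, -⟩ := h.exists_adj v v v
    obtain ⟨b, hb, hba, -⟩ := h.exists_adj v a a
    refine ⟨a, b, fun u hu => ?_⟩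
    by_contra hn
    push Not at hn
    have : ({a, b, u} : Finset V) ⊆ G.neighborFinset v := by
      intro x hx
      simp only [Finset.mem_insert, Finset.mem_singleton] at hx
      rcases hx with rfl | rfl | rfl <;> simpa
    have := Finset.card_le_card this
    rw [Finset.card_eq_three.2 ⟨a, b, u, hba.symm, hn.1.symm, hn.2.symm, rfl⟩,
      G.card_neighborFinset_eq_degree] at this
    exact hlt this
  obtain ⟨u, hu, hua, hub⟩ := h.exists_adj v a b
  rcases hab u hu with h | h
  · exact hua h
  · exact hub h

theorem IsCritical.five_le_card (h : IsCritical G) (hV : 4 < potential G Finset.univ) :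
    5 ≤ Fintype.card V := by
  by_contra hlt
  rcases Nat.lt_or_ge (Fintype.card V) 4 with h4 | h4
  · refine h.not_colorable ?_
    have := colorableOn_of_card_le (G := G) (A := Finset.univ) (by rw [Finset.card_univ]; omega)
    simpa using this
  · have h1 : ∑ v : V, 3 ≤ ∑ v, G.degree v := Finset.sum_le_sum fun v _ => h.three_le_degree v
    rw [← cross_univ_eq_sum_degree, Finset.sum_const, Finset.card_univ, smul_eq_mul] at h1
    unfold potential at hV
    rw [Finset.card_univ] at hV
    omega

theorem exists_color_pair (i j k : Fin 3) (h : j ≠ k) :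
    ∃ p q, p ≠ q ∧ p ≠ i ∧ p ≠ j ∧ q ≠ i ∧ q ≠ k := by
  revert i j k; decide

theorem IsCritical.not_triangle_degree_three (h : IsCritical G)
    (ih : DenseBelow.{u} (Fintype.card V)) (hV : 4 < potential G Finset.univ) {x y z : V}
    (hxy : G.Adj x y) (hyz : G.Adj y z) (hxz : G.Adj x z) (hx : G.degree x = 3)
    (hy : G.degree y = 3) : False := by
  obtain ⟨a, hay, haz, hxa, hax⟩ := exists_third_neighbor hx hxy hxz hyz.ne
  obtain ⟨b, hbx, hbz, hyb, hbx'⟩ := exists_third_neighbor hy hxy.symm hyz hxz.ne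
  by_cases hab : a = b
  · subst hab
    have hyz' : y ∉ ({z, a} : Finset V) := by simp [hyz.ne, hyb.ne]
    have hx' : x ∉ ({y, z, a} : Finset V) := by simp [hxy.ne, hxz.ne, hxa.ne]
    have hc : ({x, y, z, a} : Finset V).card = 4 := by
      rw [Finset.card_insert_of_notMem hx', Finset.card_insert_of_notMem hyz',
        Finset.card_pair haz.symm]
    have hne : ({x, y, z, a} : Finset V) ≠ Finset.univ := by
      intro hu
      have := h.five_le_card hV
      rw [← Finset.card_univ, ← hu] at this
      omega
    have := h.fourteen_le_potential ih hV hne hc.ge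
    unfold potential at this
    have h1 : cross G {x, y, z, a} {x, y, z, a} =
        cross G {z, a} {z, a} + 2 * cross G {y} {z, a} + 2 * cross G {x} {y, z, a} := by
      rw [cross_insert_self hx', cross_insert_self hyz']
    have h2 : cross G {y} {z, a} = 2 := by
      rw [cross_singleton_left, Finset.sum_pair haz.symm, if_pos hyz, if_pos hyb]
    have h3 : cross G {x} {y, z, a} = 3 := by
      rw [cross_singleton_left, Finset.sum_insert hyz', Finset.sum_pair haz.symm, if_pos hxy,
        if_pos hxz, if_pos hxa]
      norm_num
    omega
  · obtain ⟨c, hc⟩ := h.colorableOn_addEdge ih hV (R := {x, y}ᶜ)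
      (by intro hu; have := Finset.mem_univ x; rw [← hu] at this; simp at this) a b
    have hmem : ∀ v, v ≠ x → v ≠ y → v ∈ ((({x, y}ᶜ : Finset V)) : Set V) := by
      intro v h1 h2; simp [h1, h2]
    have hcab := hc a (hmem a hxa.ne' hay) b (hmem b hbx hyb.ne')
      (addEdge_adj.2 (Or.inr ⟨Or.inl ⟨rfl, rfl⟩, hab⟩))
    obtain ⟨p, q, hpq, hpz, hpa, hqz, hqb⟩ := exists_color_pair (c z) (c a) (c b) hcab
    refine h.not_colorable ⟨fun v => if v = x then p else if v = y then q else c v, ?_⟩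
    have hc' : ∀ u v, u ≠ x → u ≠ y → v ≠ x → v ≠ y → G.Adj u v → c u ≠ c v :=
      fun u v h1 h2 h3 h4 huv => hc u (hmem u h1 h2) v (hmem v h3 h4) (addEdge_adj.2 (Or.inl huv))
    intro u _ v _ huv
    have h1 := hax u
    have h2 := hax v
    have h3 := hbx' u
    have h4 := hbx' v
    have h5 := hc' u v
    have h6 := huv.symm
    have h7 := huv.ne
    grind

theorem IsCritical.adj_of_degree_three (h : IsCritical G)
    (ih : DenseBelow.{u} (Fintype.card V)) (hV : 4 < potential G Finset.univ) {x y s t : V}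
    (hxy : G.Adj x y) (hy : G.degree y = 3)
    (hs : G.Adj x s) (ht : G.Adj x t) (hsy : s ≠ y) (hty : t ≠ y) (hst : s ≠ t)
    (hall : ∀ u, G.Adj x u → u = y ∨ u = s ∨ u = t) : G.Adj s t := by
  by_contra hn
  let π : V → V := Function.update id t s
  have hπt : π t = s := by simp [π]
  have hπ : ∀ v, v ≠ t → π v = v := fun v hv => by simp [π, hv]
  have hcard : ({x, y, t}ᶜ : Finset V).card < Fintype.card V :=
    Finset.card_lt_univ_of_notMem (x := x) (by simp)
  by_cases hc : ColorableOn (image π G) (({x, y, t}ᶜ : Finset V) : Set V)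
  · obtain ⟨c, hc⟩ := hc
    have hmem : ∀ v, v ≠ x → v ≠ y → π v ∈ ((({x, y, t}ᶜ : Finset V)) : Set V) := by
      intro v h1 h2
      by_cases hv : v = t
      · rw [hv, hπt]; simp [hs.ne', hsy, hst]
      · rw [hπ v hv]; simp [h1, h2, hv]
    have hc' : ∀ u v, u ≠ x → u ≠ y → v ≠ x → v ≠ y → G.Adj u v → c (π u) ≠ c (π v) := by
      intro u v h1 h2 h3 h4 huv
      refine hc.comp_image u v (hmem u h1 h2) (hmem v h3 h4) (fun he => ?_) huv
      have h5 := hπ u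
      have h6 := hπ v
      have h7 := huv.ne
      have h8 := huv.symm
      grind
    obtain ⟨a, b, hax, hbx, hab, hya, hyb, hally⟩ := exists_two_neighbors hy hxy.symm
    obtain ⟨q, hq1, hq2⟩ := exists_color_ne (c (π a)) (c (π b))
    obtain ⟨p, hp1, hp2⟩ := exists_color_ne (c (π s)) q
    refine h.not_colorable ⟨fun v => if v = x then p else if v = y then q else c (π v), ?_⟩
    intro u _ v _ huv
    have h1 := hall u
    have h2 := hall v
    have h3 := hally u
    have h4 := hally v
    have h5 := hc' u v
    have h6 := huv.symm
    have h7 := huv.ne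
    have h8 : π s = s := hπ s hst
    have h9 := hxy.ne
    clear hc hc' hmem hπ hcard
    grind
  · obtain ⟨W, hWS, hWc, hWp⟩ := ih V (image π G) _ hcard hc
    have hWx : x ∉ W := fun hx => by have := hWS hx; simp at this
    have hWy : y ∉ W := fun hx => by have := hWS hx; simp at this
    have hWt : t ∉ W := fun hx => by have := hWS hx; simp at this
    have hWs : s ∈ W := by
      by_contra hWs
      refine hWc ((h.colorable_of_notMem (A := (W : Set V)) (v := x) hWx).mono_left ?_)
      rintro u hu v hv ⟨-, a, b, rfl, rfl, hab⟩
      have ha : a ≠ t := by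
        rintro rfl; rw [hπt] at hu; exact hWs hu
      have hb : b ≠ t := by
        rintro rfl; rw [hπt] at hv; exact hWs hv
      rwa [hπ a ha, hπ b hb]
    have h1 : cross (image π G) W W ≤ _ := cross_image_le (G := G) hWs hWt hst
    have hx' : x ∉ insert t W := by simp [hWx, ht.ne]
    have h4 : ¬ W.card ≤ 3 := fun h3 => hWc (colorableOn_of_card_le h3)
    have hcd : (insert x (insert t W)).card = W.card + 2 := by
      rw [Finset.card_insert_of_notMem hx', Finset.card_insert_of_notMem hWt]
    have h5 := h.fourteen_le_potential ih hV (R := insert x (insert t W))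
      (fun hu => by
        have := Finset.mem_univ y
        rw [← hu] at this
        simp [hxy.ne', hty.symm, hWy] at this) (by omega)
    have h6 : 2 ≤ cross G {x} (insert t W) := by
      have := cross_mono (G := G) (Finset.Subset.refl {x}) (show {s, t} ⊆ insert t W by
        intro u hu
        rcases Finset.mem_insert.1 hu with rfl | hu
        · simp [hWs]
        · simp [Finset.mem_singleton.1 hu])
      rwa [cross_singleton_left (B := {s, t}), Finset.sum_pair hst, if_pos hs, if_pos ht] at this
    unfold potential at h5 hWp
    rw [cross_insert_self hx', hcd] at h5
    omega

theorem IsCritical.two_le_cross (h : IsCritical G) (ih : DenseBelow.{u} (Fintype.card V))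
    (hV : 4 < potential G Finset.univ) {x : V} (hx : G.degree x = 3) :
    2 ≤ cross G {x} (Finset.univ.filter fun v => 4 ≤ G.degree v) := by
  have key : ∃ s t, s ≠ t ∧ G.Adj x s ∧ G.Adj x t ∧ 4 ≤ G.degree s ∧ 4 ≤ G.degree t := by
    by_cases hy : ∃ y, G.Adj x y ∧ G.degree y = 3
    · obtain ⟨y, hxy, hy⟩ := hy
      obtain ⟨s, t, hsy, hty, hst, hs, ht, hall⟩ := exists_two_neighbors hx hxy
      have hadj := h.adj_of_degree_three ih hV hxy hy hs ht hsy hty hst hall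
      refine ⟨s, t, hst, hs, ht, ?_, ?_⟩
      · have h3 := h.three_le_degree s
        rcases h3.lt_or_eq with h4 | h4
        · exact h4
        · exact (h.not_triangle_degree_three ih hV hs hadj ht hx h4.symm).elim
      · have h3 := h.three_le_degree t
        rcases h3.lt_or_eq with h4 | h4
        · exact h4
        · exact (h.not_triangle_degree_three ih hV ht hadj.symm hs hx h4.symm).elim
    · push Not at hy
      obtain ⟨y, hxy, -⟩ := h.exists_adj x x x
      obtain ⟨s, t, hsy, hty, hst, hs, ht, hall⟩ := exists_two_neighbors hx hxy
      refine ⟨s, t, hst, hs, ht, ?_, ?_⟩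
      · exact lt_of_le_of_ne (h.three_le_degree s) (hy s hs).symm
      · exact lt_of_le_of_ne (h.three_le_degree t) (hy t ht).symm
  obtain ⟨s, t, hst, hs, ht, hds, hdt⟩ := key
  have := cross_mono (G := G) (Finset.Subset.refl {x})
    (show {s, t} ⊆ Finset.univ.filter fun v => 4 ≤ G.degree v by
      intro u hu
      rcases Finset.mem_insert.1 hu with rfl | hu
      · simpa using hds
      · rw [Finset.mem_singleton] at hu; subst hu; simpa using hdt)
  rwa [cross_singleton_left (B := {s, t}), Finset.sum_pair hst, if_pos hs, if_pos ht] at this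

/-- The Kostochka–Yancey bound for 4-critical graphs. -/
theorem IsCritical.potential_le (h : IsCritical G) (ih : DenseBelow.{u} (Fintype.card V)) :
    potential G Finset.univ ≤ 4 := by
  by_contra hV
  push Not at hV
  let L : Finset V := Finset.univ.filter fun v => ¬ 4 ≤ G.degree v
  let M : Finset V := Finset.univ.filter fun v => 4 ≤ G.degree v
  have hL : ∀ v ∈ L, G.degree v = 3 := by
    intro v hv
    have h1 := (Finset.mem_filter.1 hv).2
    have h2 := h.three_le_degree v
    omega
  have h1 : L.card * 2 ≤ cross G L M := by
    rw [cross, ← smul_eq_mul, ← Finset.sum_const]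
    refine Finset.sum_le_sum fun v hv => ?_
    rw [← cross_singleton_left]
    exact h.two_le_cross ih hV (hL v hv)
  have h2 : cross G L M ≤ ∑ v ∈ M, G.degree v := by
    rw [cross_comm]
    refine Finset.sum_le_sum fun v _ => ?_
    rw [← G.card_neighborFinset_eq_degree, ← Finset.card_filter]
    refine Finset.card_le_card fun u hu => ?_
    simpa using (Finset.mem_filter.1 hu).2
  have h3 : M.card * 4 ≤ ∑ v ∈ M, G.degree v := by
    rw [← smul_eq_mul, ← Finset.sum_const]
    exact Finset.sum_le_sum fun v hv => (Finset.mem_filter.1 hv).2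
  have h4 : ∑ v ∈ L, G.degree v = L.card * 3 := by
    rw [← smul_eq_mul, ← Finset.sum_const]
    exact Finset.sum_congr rfl hL
  have h5 : ∑ v, G.degree v = ∑ v ∈ M, G.degree v + ∑ v ∈ L, G.degree v :=
    (Finset.sum_filter_add_sum_filter_not _ _ _).symm
  have h6 : M.card + L.card = (Finset.univ : Finset V).card :=
    Finset.card_filter_add_card_filter_not _
  unfold potential at hV
  rw [cross_univ_eq_sum_degree, h5, ← h6] at hV
  generalize ∑ v ∈ M, G.degree v = m at *
  omega

end Degree

section Dense

variable {V : Type u} {G : SimpleGraph V}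

theorem exists_dense_of_minimal {W : Finset V} (ih : DenseBelow.{u} W.card)
    (hW : ¬ ColorableOn G W) (hmin : ∀ v ∈ W, ColorableOn G (W.erase v : Finset V)) :
    potential G W ≤ 4 := by
  have hcrit : IsCritical (G.comap (Subtype.val : {v // v ∈ W} → V)) := by
    refine ⟨fun ⟨c, hc⟩ => hW ⟨fun v => if hv : v ∈ W then c ⟨v, hv⟩ else 0, ?_⟩, fun v => ?_⟩
    · intro u hu v hv huv
      rw [Finset.mem_coe] at hu hv
      beta_reduce
      rw [dif_pos hu, dif_pos hv]
      exact hc ⟨u, hu⟩ trivial ⟨v, hv⟩ trivial huv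
    · obtain ⟨c, hc⟩ := hmin v v.2
      refine ⟨fun u => c u, fun a ha b hb hab => hc a ?_ b ?_ hab⟩
      · simp only [Finset.coe_erase, Set.mem_sdiff, Finset.mem_coe, Set.mem_singleton_iff]
        exact ⟨a.2, fun h => ha (Subtype.ext h)⟩
      · simp only [Finset.coe_erase, Set.mem_sdiff, Finset.mem_coe, Set.mem_singleton_iff]
        exact ⟨b.2, fun h => hb (Subtype.ext h)⟩
  have := hcrit.potential_le (by rwa [Fintype.card_coe])
  unfold potential at this ⊢
  rw [Finset.card_univ, Fintype.card_coe] at this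
  convert this using 4
  unfold cross
  rw [← Finset.sum_coe_sort]
  refine Finset.sum_congr rfl fun a _ => ?_
  rw [← Finset.sum_coe_sort]
  refine Finset.sum_congr rfl fun b _ => ?_
  simp only [comap_adj]

theorem exists_minimal_not_colorableOn (S : Finset V) (hS : ¬ ColorableOn G S) :
    ∃ W ⊆ S, ¬ ColorableOn G W ∧ ∀ v ∈ W, ColorableOn G (W.erase v : Finset V) := by
  induction S using Finset.strongInduction with
  | H S ih =>
    by_cases h : ∀ v ∈ S, ColorableOn G (S.erase v : Finset V)
    · exact ⟨S, Finset.Subset.refl S, hS, h⟩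
    · push Not at h
      obtain ⟨v, hv, hc⟩ := h
      obtain ⟨W, hWS, hW⟩ := ih _ (Finset.erase_ssubset hv) hc
      exact ⟨W, hWS.trans (Finset.erase_subset v S), hW⟩

theorem denseBelow (n : ℕ) : DenseBelow.{u} n := by
  induction n with
  | zero => intro V G S hS; omega
  | succ n ih =>
    intro V G S hS hc
    obtain ⟨W, hWS, hWc, hmin⟩ := exists_minimal_not_colorableOn S hc
    have hcard := Finset.card_le_card hWS
    exact ⟨W, hWS, hWc, exists_dense_of_minimal
      (fun V' G' S' hS' hc' => ih V' G' S' (by omega) hc') hWc hmin⟩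

/-- Every set that is not 3-colorable contains a dense one. -/
theorem exists_dense {S : Finset V} (hS : ¬ ColorableOn G S) :
    ∃ W ⊆ S, ¬ ColorableOn G W ∧ potential G W ≤ 4 :=
  denseBelow (S.card + 1) V G S (Nat.lt_succ_self _) hS

end Dense

section Corners

variable {V : Type*} [Fintype V] {G : SimpleGraph V} {ι : Type} [Finite ι] {φ : V → V → ι}

/-- The face `i` enters `v` from `a` and leaves towards `b`. -/
def Corner (G : SimpleGraph V) (φ : V → V → ι) (i : ι) (v a b : V) : Prop :=
  ∀ u, face G φ i v u = if u = a ∨ u = b then 1 else 0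

theorem Corner.symm {i : ι} {v a b : V} (h : Corner G φ i v a b) : Corner G φ i v b a := by
  intro u
  rw [h u]
  simp only [or_comm]

theorem Corner.ne {i j : ι} {v a b c d : V} (h : Corner G φ i v a b) (h' : Corner G φ j v c d)
    (hac : a ≠ c) (had : a ≠ d) : i ≠ j := by
  rintro rfl
  have := (h a).symm.trans (h' a)
  simp [hac, had] at this

theorem corner_tri {i : ι} {a b c : V} (hi : face G φ i = tri a b c) (hab : a ≠ b) (hbc : b ≠ c)
    (hca : c ≠ a) : Corner G φ i a b c := by
  intro u
  rw [hi, tri_eq hab hbc hca]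
  grind -ring -linarith

theorem corner_quad {i : ι} {a b c d : V} (hi : face G φ i = quad a b c d) (hab : a ≠ b)
    (hbc : b ≠ c) (hcd : c ≠ d) (hda : d ≠ a) (hac : a ≠ c) (hbd : b ≠ d) :
    Corner G φ i a b d := by
  intro u
  rw [hi, quad_eq hab hbc hcd hda hac hbd]
  grind -ring -linarith

theorem tri_rotate (a b c : V) : tri a b c = tri b c a := by
  unfold tri; abel

theorem quad_rotate (a b c d : V) : quad a b c d = quad b c d a := by
  unfold quad; abel

theorem quad_reverse (a b c d : V) : quad a b c d = quad a d c b := by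
  unfold quad; rw [single_comm a b, single_comm b c, single_comm c d, single_comm d a]; abel

theorem IsFaceLabelling.fan_two (hφ : IsFaceLabelling G φ) (h : NoCutVertex G) {i j : ι}
    {v x y u : V} (hi : Corner G φ i v x y) (hj : Corner G φ j v x y) (hij : i ≠ j)
    (hu : G.Adj v u) : u = x ∨ u = y := by
  obtain ⟨k, hk, hku⟩ := hφ.mem_of_closed h (S := {i, j}) (v := v) (a := x) (b := u) (fun w => by
      rw [Finset.sum_pair hij, hi w, hj w, zmod_two_add_self])
    ⟨i, by simp, by rw [hi x, if_pos (Or.inl rfl)]; exact one_ne_zero⟩ hu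
  simp only [Finset.mem_insert, Finset.mem_singleton] at hk
  by_contra hn
  rcases hk with rfl | rfl
  · exact hku (by rw [hi u, if_neg hn])
  · exact hku (by rw [hj u, if_neg hn])

theorem IsFaceLabelling.fan_three (hφ : IsFaceLabelling G φ) (h : NoCutVertex G) {i j k : ι}
    {v x y z u : V} (hi : Corner G φ i v x y) (hj : Corner G φ j v y z) (hk : Corner G φ k v z x)
    (hxy : x ≠ y) (hyz : y ≠ z) (hzx : z ≠ x) (hu : G.Adj v u) : u = x ∨ u = y ∨ u = z := by
  have hij : i ≠ j := hi.ne hj hxy hzx.symm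
  have hjk : j ≠ k := hj.ne hk hyz hxy.symm
  have hki : k ≠ i := hk.ne hi hzx hyz.symm
  obtain ⟨l, hl, hlu⟩ := hφ.mem_of_closed h (S := {i, j, k}) (v := v) (a := x) (b := u)
    (fun w => by
      rw [Finset.sum_insert (by simp [hij, hki.symm]), Finset.sum_pair hjk, hi w, hj w, hk w]
      by_cases h1 : w = x
      · subst h1; simp [hxy, hzx.symm, zmod_two_add_self]
      · by_cases h2 : w = y
        · subst h2; simp [hyz, h1, zmod_two_add_self]
        · by_cases h3 : w = z
          · subst h3; simp [h1, h2, zmod_two_add_self]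
          · simp [h1, h2, h3])
    ⟨i, by simp, by rw [hi x, if_pos (Or.inl rfl)]; exact one_ne_zero⟩ hu
  simp only [Finset.mem_insert, Finset.mem_singleton] at hl
  by_contra hn
  push Not at hn
  rcases hl with rfl | rfl | rfl
  · exact hlu (by rw [hi u, if_neg (by simp [hn])])
  · exact hlu (by rw [hj u, if_neg (by simp [hn])])
  · exact hlu (by rw [hk u, if_neg (by simp [hn])])

theorem IsFaceLabelling.fan_four (hφ : IsFaceLabelling G φ) (h : NoCutVertex G) {i j k l : ι}
    {v x y z t u : V} (hi : Corner G φ i v x y) (hj : Corner G φ j v y z)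
    (hk : Corner G φ k v z t) (hl : Corner G φ l v t x) (hxy : x ≠ y) (hyz : y ≠ z) (hzt : z ≠ t)
    (htx : t ≠ x) (hxz : x ≠ z) (hyt : y ≠ t) (hu : G.Adj v u) :
    u = x ∨ u = y ∨ u = z ∨ u = t := by
  have hij : i ≠ j := hi.ne hj hxy hxz
  have hik : i ≠ k := hi.ne hk hxz htx.symm
  have hil : l ≠ i := hl.ne hi htx hyt.symm
  have hjk : j ≠ k := hj.ne hk hyz hyt
  have hjl : j ≠ l := hj.ne hl hyt hxy.symm
  have hkl : k ≠ l := hk.ne hl hzt hxz.symm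
  obtain ⟨m, hm, hmu⟩ := hφ.mem_of_closed h (S := {i, j, k, l}) (v := v) (a := x) (b := u)
    (fun w => by
      rw [Finset.sum_insert (by simp [hij, hik, hil.symm]),
        Finset.sum_insert (by simp [hjk, hjl]), Finset.sum_pair hkl, hi w, hj w, hk w, hl w]
      by_cases h1 : w = x
      · subst h1; simp [hxy, hxz, htx.symm, zmod_two_add_self]
      · by_cases h2 : w = y
        · subst h2; simp [hyz, hyt, h1, zmod_two_add_self]
        · by_cases h3 : w = z
          · subst h3; simp [h1, h2, hzt, zmod_two_add_self]
          · by_cases h4 : w = t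
            · subst h4; simp [h1, h2, h3, zmod_two_add_self]
            · simp [h1, h2, h3, h4])
    ⟨i, by simp, by rw [hi x, if_pos (Or.inl rfl)]; exact one_ne_zero⟩ hu
  simp only [Finset.mem_insert, Finset.mem_singleton] at hm
  by_contra hn
  push Not at hn
  rcases hm with rfl | rfl | rfl | rfl
  · exact hmu (by rw [hi u, if_neg (by simp [hn])])
  · exact hmu (by rw [hj u, if_neg (by simp [hn])])
  · exact hmu (by rw [hk u, if_neg (by simp [hn])])
  · exact hmu (by rw [hl u, if_neg (by simp [hn])])

/-- The edges `a b c d` in this cyclic order form a 4-cycle. -/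
structure IsFourCycle (G : SimpleGraph V) (a b c d : V) : Prop where
  ab : G.Adj a b
  bc : G.Adj b c
  cd : G.Adj c d
  da : G.Adj d a
  ac : a ≠ c
  bd : b ≠ d

theorem IsFourCycle.rotate {a b c d : V} (h : IsFourCycle G a b c d) : IsFourCycle G b c d a :=
  ⟨h.bc, h.cd, h.da, h.ab, h.bd, h.ac.symm⟩

theorem IsFourCycle.reverse {a b c d : V} (h : IsFourCycle G a b c d) : IsFourCycle G a d c b :=
  ⟨h.da.symm, h.cd.symm, h.bc.symm, h.ab.symm, h.ac, h.bd.symm⟩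

theorem IsFourCycle.corner {i : ι} {a b c d : V} (h : IsFourCycle G a b c d)
    (hi : face G φ i = quad a b c d) : Corner G φ i a b d :=
  corner_quad hi h.ab.ne h.bc.ne h.cd.ne h.da.ne h.ac h.bd

theorem IsFourCycle.corner' {i : ι} {a b c d : V} (h : IsFourCycle G a b c d)
    (hi : face G φ i = quad a b c d) : Corner G φ i b a c :=
  (h.rotate.corner (hi.trans (quad_rotate _ _ _ _))).symm

/-- A vertex `u` off the 4-cycle adjacent to `a` and `b`, continued by paths from `u` to the other
two vertices. -/
def Hub (G : SimpleGraph V) (a b c d u x y : V) : Prop :=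
  G.Adj u a ∧ G.Adj u b ∧ (u ≠ c ∧ u ≠ d) ∧ (G.Adj u x ∧ G.Adj x c ∧ x ≠ a ∧ x ≠ b ∧ x ≠ d) ∧
    G.Adj u y ∧ G.Adj y d ∧ y ≠ a ∧ y ≠ b ∧ y ≠ c

/-- Some path of length three joins `x` and `z` and avoids `m` and `n`. -/
def HasDetour (G : SimpleGraph V) (x m z n : V) : Prop :=
  ∃ a b, G.Adj x a ∧ G.Adj a b ∧ G.Adj b z ∧ (a ≠ m ∧ a ≠ n) ∧ b ≠ m ∧ b ≠ n

theorem IsFaceLabelling.exists_hub (hφ : IsFaceLabelling G φ) (h : NoCutVertex G) {i : ι}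
    {a b c d : V} (hc : IsFourCycle G a b c d) (hi : face G φ i = quad a b c d)
    (hac : ¬ G.Adj a c) (hbd : ¬ G.Adj b d) (h1 : HasDetour G a b c d) (h2 : HasDetour G b a d c) :
    (∃ u x y, Hub G a b c d u x y) ∨ (∃ u x y, Hub G a d c b u x y) ∨
      (∃ u x y, Hub G c b a d u x y) ∨ ∃ u x y, Hub G c d a b u x y := by
  obtain ⟨p, q, hap, hpq, hqc, ⟨hpb, hpd⟩, hqb, hqd⟩ := h1
  obtain ⟨r, s, hbr, hrs, hsd, ⟨hra, hrc⟩, hsa, hsc⟩ := h2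
  have hpc : p ≠ c := fun h => hac (h ▸ hap)
  have hqa : q ≠ a := fun h => hac (h ▸ hqc)
  have hrd : r ≠ d := fun h => hbd (h ▸ hbr)
  have hsb : s ≠ b := fun h => hbd (h ▸ hsd)
  by_cases hpr : p = r
  · subst hpr
    exact Or.inl ⟨p, q, s, hap.symm, hbr.symm, ⟨hpc, hpd⟩, ⟨hpq, hqc, hqa, hqb, hqd⟩, hrs, hsd,
      hsa, hsb, hsc⟩
  by_cases hps : p = s
  · subst hps
    exact Or.inr (Or.inl ⟨p, q, r, hap.symm, hsd, ⟨hpc, hpb⟩, ⟨hpq, hqc, hqa, hqd, hqb⟩, hrs.symm,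
      hbr.symm, hra, hrd, hrc⟩)
  by_cases hqr : q = r
  · subst hqr
    exact Or.inr (Or.inr (Or.inl ⟨q, p, s, hqc, hbr.symm, ⟨hqa, hqd⟩,
      ⟨hpq.symm, hap.symm, hpc, hpb, hpd⟩, hrs, hsd, hsc, hsb, hsa⟩))
  by_cases hqs : q = s
  · subst hqs
    exact Or.inr (Or.inr (Or.inr ⟨q, p, r, hqc, hsd, ⟨hqa, hqb⟩,
      ⟨hpq.symm, hap.symm, hpc, hpd, hpb⟩, hrs.symm, hbr.symm, hrc, hrd, hra⟩))
  exact (hφ.not_crossing h hi hc.ab hc.bc hc.cd hc.da hc.ac hc.bd hap hpq hqc hbr hrs hsd hpb hpd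
    hqb hqd hra hrc hrd hsa hsc hpr hps hqr hqs).elim

end Corners

section Triangles

variable {V W : Type*} {G : SimpleGraph V} {A B : Set V}

/-- The number of triangles inside a set of vertices. -/
noncomputable def triCount (G : SimpleGraph V) (A : Set V) : ℕ :=
  {t : Finset V | G.IsNClique 3 t ∧ (t : Set V) ⊆ A}.ncard

theorem triCount_univ : triCount G Set.univ = {t : Finset V | G.IsNClique 3 t}.ncard := by
  simp [triCount]

theorem isNClique_three {a b c : V} (hab : G.Adj a b) (hac : G.Adj a c) (hbc : G.Adj b c) :
    G.IsNClique 3 {a, b, c} :=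
  is3Clique_triple_iff.2 ⟨hab, hac, hbc⟩

theorem triCount_comap [Finite V] (f : W → V) (hf : Function.Injective f) (hA : ∀ w, f w ∈ A) :
    triCount (G.comap f) Set.univ ≤ triCount G A := by
  have := Finite.of_injective f hf
  rw [triCount_univ]
  refine Set.ncard_le_ncard_of_injOn (fun t => t.map ⟨f, hf⟩) (fun t ht => ⟨?_, ?_⟩)
    (fun s _ t _ hst => Finset.map_injective _ hst) (Set.toFinite _)
  · refine ⟨?_, by rw [Finset.card_map]; exact ht.card_eq⟩
    have h1 := ht.isClique
    intro a ha b hb hab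
    simp only [Finset.coe_map, Set.mem_image, Finset.mem_coe] at ha hb
    obtain ⟨a, ha, rfl⟩ := ha
    obtain ⟨b, hb, rfl⟩ := hb
    exact h1 ha hb (fun h => hab (by rw [h]))
  · intro v hv
    simp only [Finset.coe_map, Set.mem_image, Finset.mem_coe] at hv
    obtain ⟨a, -, rfl⟩ := hv
    exact hA a

theorem triCount_mono [Finite V] (hAB : A ⊆ B) : triCount G A ≤ triCount G B :=
  Set.ncard_le_ncard (fun _ ht => ⟨ht.1, ht.2.trans hAB⟩) (Set.toFinite _)

theorem triCount_add_le [Finite V]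
    (h : ∀ a b c, a ∈ A ∩ B → b ∈ A ∩ B → c ∈ A ∩ B → G.Adj a b → G.Adj b c → ¬ G.Adj a c) :
    triCount G A + triCount G B ≤ triCount G Set.univ := by
  rw [triCount, triCount, ← Set.ncard_union_eq ?_ (Set.toFinite _) (Set.toFinite _)]
  · refine Set.ncard_le_ncard (fun t ht => ⟨?_, Set.subset_univ _⟩) (Set.toFinite _)
    rcases ht with ht | ht
    · exact ht.1
    · exact ht.1
  · rw [Set.disjoint_left]
    rintro t ⟨ht, htA⟩ ⟨-, htB⟩
    obtain ⟨a, b, c, hab, hac, hbc, rfl⟩ := is3Clique_iff.1 ht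
    exact h a b c ⟨htA (by simp), htB (by simp)⟩ ⟨htA (by simp), htB (by simp)⟩
      ⟨htA (by simp), htB (by simp)⟩ hab hbc hac

/-- A graph with at most one triangle has no two adjacent triangles. -/
theorem IsFourCycle.not_adj [Finite V] (h : triCount G Set.univ ≤ 1) {a b c d : V}
    (hc : IsFourCycle G a b c d) : ¬ G.Adj a c := by
  intro hac
  have h2 : ({{a, b, c}, {a, d, c}} : Set (Finset V)).ncard ≤ triCount G Set.univ := by
    rw [triCount_univ]
    refine Set.ncard_le_ncard (fun t ht => ?_) (Set.toFinite _)
    rcases ht with rfl | rfl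
    · exact isNClique_three hc.ab hac hc.bc
    · exact isNClique_three hc.da.symm hac hc.cd.symm
  rw [Set.ncard_pair] at h2
  · omega
  · intro he
    have : b ∈ ({a, d, c} : Finset V) := he ▸ (by simp)
    simp only [Finset.mem_insert, Finset.mem_singleton] at this
    rcases this with h | h | h
    · exact hc.ab.ne h.symm
    · exact hc.bd h
    · exact hc.bc.ne h

end Triangles

section Quotient

variable {V : Type u} [Fintype V] {G : SimpleGraph V} {C : V → V → ZMod 2}

/-- Identifying opposite corners of a face without creating new triangles. -/
theorem HasFace.exists_quotient (h : HasFace G C) {x m z n : V} (hxm : C x m ≠ 0)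
    (hmz : C m z ≠ 0) (hxz : x ≠ z) (hn : ¬ G.Adj x z) (hnx : G.Adj n x) (hnz : G.Adj n z)
    (hd : ¬ HasDetour G x m z n) :
    ∃ (W : Type u) (_ : Fintype W) (H : SimpleGraph W) (π : V → W),
      Fintype.card W < Fintype.card V ∧ IsMacLane H ∧
      triCount H Set.univ ≤ triCount G Set.univ ∧ π x = π z ∧
      (∀ a b, π a = π b → a = b ∨ (a = x ∧ b = z) ∨ (a = z ∧ b = x)) ∧
      ∀ a b, G.Adj a b → H.Adj (π a) (π b) := by
  obtain ⟨ι, _, φ, hφ, i, hi⟩ := id h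
  have hCe : IsEven G C := hi ▸ hφ.isEven _
  have axm := hCe.supp _ _ hxm
  have amz := hCe.supp _ _ hmz
  obtain ⟨π, hπ⟩ : ∃ π : V → {v // v ≠ z},
      ∀ v, (π v : V) = if v = z then x else v :=
    ⟨fun v => ⟨if v = z then x else v, by split_ifs with hv; exacts [hxz, hv]⟩, fun _ => rfl⟩
  have hπxz : π x = π z := Subtype.ext (by rw [hπ, hπ, if_neg hxz, if_pos rfl])
  have hinj : ∀ a b, π a = π b → a = b ∨ (a = x ∧ b = z) ∨ (a = z ∧ b = x) := by
    intro a b hab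
    have := congrArg Subtype.val hab
    rw [hπ, hπ] at this
    grind
  have hne : ∀ a b, G.Adj a b → π a ≠ π b := by
    intro a b hab he
    rcases hinj a b he with h | ⟨rfl, rfl⟩ | ⟨rfl, rfl⟩
    · exact hab.ne h
    · exact hn hab
    · exact hn hab.symm
  have hsurj : ∀ w, ∃ v, π v = w := fun w =>
    ⟨w, Subtype.ext (by rw [hπ, if_neg w.2])⟩
  have hadj : ∀ a b, G.Adj a b → (image π G).Adj (π a) (π b) :=
    fun a b hab => ⟨hne a b hab, a, b, rfl, rfl, hab⟩
  have hM : IsMacLane (image π G) := h.identify hxm hmz hxz hn π hπxz hinj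
    (fun u v => ⟨fun h => h.2, fun ⟨a, b, ha, hb, hab⟩ => by
      subst ha; subst hb; exact hadj a b hab⟩)
  refine ⟨{v // v ≠ z}, inferInstance, image π G, π,
    Fintype.card_subtype_lt (x := z) (by simp), hM, ?_, hπxz, hinj, hadj⟩
  rw [triCount_univ, triCount_univ]
  have key : ∀ t, (image π G).IsNClique 3 t → ∃ s, G.IsNClique 3 s ∧ s.image π = t := by
    intro t ht
    obtain ⟨u₁, u₂, u₃, h12, h13, h23, rfl⟩ := is3Clique_iff.1 ht
    suffices hs : ∃ a b c, G.Adj a b ∧ G.Adj a c ∧ G.Adj b c ∧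
        ({u₁, u₂, u₃} : Finset _) = {π a, π b, π c} by
      obtain ⟨a, b, c, hab, hac, hbc, he⟩ := hs
      exact ⟨{a, b, c}, isNClique_three hab hac hbc, by
        rw [he, Finset.image_insert, Finset.image_insert, Finset.image_singleton]⟩
    have main : ∀ {v₁ v₂ v₃ : {v // v ≠ z}}, (image π G).Adj v₁ v₂ → (image π G).Adj v₁ v₃ →
        (image π G).Adj v₂ v₃ → v₂ ≠ π x → v₃ ≠ π x → ∃ a b c, G.Adj a b ∧ G.Adj a c ∧
        G.Adj b c ∧ ({v₁, v₂, v₃} : Finset _) = {π a, π b, π c} := by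
      rintro v₁ v₂ v₃ ⟨-, a, b, rfl, rfl, hab⟩ ⟨-, a', c, ha', rfl, hac⟩ ⟨-, b', c', hb', hc', hbc⟩
        hb hc
      have e1 : b' = b := by
        rcases hinj _ _ hb' with h | ⟨-, h⟩ | ⟨-, h⟩
        · exact h
        · exact absurd (h ▸ hπxz.symm) hb
        · exact absurd (h ▸ rfl) hb
      have e2 : c' = c := by
        rcases hinj _ _ hc' with h | ⟨-, h⟩ | ⟨-, h⟩
        · exact h
        · exact absurd (h ▸ hπxz.symm) hc
        · exact absurd (h ▸ rfl) hc
      subst e1; subst e2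
      have lift : ∀ p q r, G.Adj p q → G.Adj p r → G.Adj q r →
          ({π a, π b', π c'} : Finset _) = {π p, π q, π r} → ∃ a₁ b₁ c₁, G.Adj a₁ b₁ ∧
          G.Adj a₁ c₁ ∧ G.Adj b₁ c₁ ∧ ({π a, π b', π c'} : Finset _) = {π a₁, π b₁, π c₁} :=
        fun p q r h1 h2 h3 h4 => ⟨p, q, r, h1, h2, h3, h4⟩
      have det : ∀ b c, G.Adj x b → G.Adj b c → G.Adj c z →
          ∃ a₁ b₁ c₁, G.Adj a₁ b₁ ∧ G.Adj a₁ c₁ ∧ G.Adj b₁ c₁ ∧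
          ({π x, π b, π c} : Finset _) = {π a₁, π b₁, π c₁} := by
        intro b c hxb hbc hcz
        by_cases h1 : b = m
        · exact ⟨z, b, c, h1 ▸ amz.symm, hcz.symm, hbc, by rw [hπxz]⟩
        by_cases h2 : b = n
        · exact ⟨z, b, c, h2 ▸ hnz.symm, hcz.symm, hbc, by rw [hπxz]⟩
        by_cases h3 : c = m
        · exact ⟨x, b, c, hxb, h3 ▸ axm, hbc, rfl⟩
        by_cases h4 : c = n
        · exact ⟨x, b, c, hxb, h4 ▸ hnx.symm, hbc, rfl⟩
        exact (hd ⟨b, c, hxb, hbc, hcz, ⟨h1, h2⟩, h3, h4⟩).elim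
      rcases hinj _ _ ha' with h | ⟨h1, h2⟩ | ⟨h1, h2⟩
      · subst h
        exact ⟨a', b', c', hab, hac, hbc, rfl⟩
      · subst h1; subst h2
        obtain ⟨p, q, r, h1, h2, h3, h4⟩ := det c' b' hac hbc.symm hab.symm
        exact ⟨p, q, r, h1, h2, h3, by rw [← h4, ← hπxz, Finset.pair_comm]⟩
      · subst h1; subst h2
        exact det b' c' hab hbc hac.symm
    by_cases h2 : u₂ = π x
    · obtain ⟨a, b, c, h1, h3, h4, h5⟩ := main h12.symm h23 h13 (by rw [← h2]; exact h12.ne)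
        (by rw [← h2]; exact h23.ne')
      exact ⟨a, b, c, h1, h3, h4, by rw [← h5, Finset.insert_comm]⟩
    · by_cases h3 : u₃ = π x
      · obtain ⟨a, b, c, h1, h4, h5, h6⟩ := main h13.symm h23.symm h12
          (by rw [← h3]; exact h13.ne) (by rw [← h3]; exact h23.ne)
        exact ⟨a, b, c, h1, h4, h5, by
          rw [← h6, Finset.insert_comm u₃ u₁, Finset.pair_comm u₃ u₂]⟩
      · exact main h12 h13 h23 h2 h3
  refine (Set.ncard_le_ncard (t := (fun s : Finset V => s.image π) '' {t | G.IsNClique 3 t})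
    (fun t ht => ?_) (Set.toFinite _)).trans (Set.ncard_image_le (Set.toFinite _))
  obtain ⟨s, hs, rfl⟩ := key t ht
  exact ⟨s, hs, rfl⟩

end Quotient

section Separation

variable {V : Type*} {G : SimpleGraph V}

/-- Removing `K` disconnects `G`. -/
def Separates (G : SimpleGraph V) (K : Set V) : Prop :=
  ∃ X : Set V, X.Nonempty ∧ (∀ v ∈ X, v ∉ K) ∧ (∃ v, v ∉ X ∧ v ∉ K) ∧
    ∀ u ∈ X, ∀ v, v ∉ X → v ∉ K → ¬ G.Adj u v

theorem noCutVertex_of_not_separates (h : ∀ v, ¬ Separates G {v}) : NoCutVertex G := by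
  intro v X hv hX ⟨w, hw, hwv⟩
  by_contra hn
  push Not at hn
  exact h v ⟨X, hX, fun u hu huv => hv (huv ▸ hu), ⟨w, hw, hwv⟩,
    fun a ha b hb hbv => hn a ha b hb hbv⟩

variable [Fintype V] {ι : Type} [Finite ι] {φ : V → V → ι}

theorem IsFaceLabelling.face_or_separates (hφ : IsFaceLabelling G φ) (h : NoCutVertex G)
    {C : V → V → ZMod 2} {K : Set V} (hC : IsCircuit G C) (hK : ∀ v, v ∉ K ↔ ∀ w, C v w = 0)
    (hind : ∀ u ∈ K, ∀ v ∈ K, G.Adj u v → C u v ≠ 0) :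
    (∃ i, face G φ i = C) ∨ Separates G K := by
  refine (hφ.exists_face_or_separation h hC fun u v huv h0 => ?_).imp_right ?_
  · rw [← hK, ← hK]
    by_contra hn
    push Not at hn
    exact hind u hn.1 v hn.2 huv h0
  · rintro ⟨X, hX, hXK, ⟨v, hv, hvK⟩, hadj⟩
    refine ⟨X, hX, fun v hv => (hK v).2 (hXK v hv), ⟨v, hv, (hK v).2 hvK⟩,
      fun u hu v hv hvK huv => ?_⟩
    rcases hadj u v hu huv with ⟨w, hw⟩ | h
    · exact hw ((hK v).1 hvK w)
    · exact hv h

theorem IsFaceLabelling.tri_face_or_separates (hφ : IsFaceLabelling G φ) (h : NoCutVertex G)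
    {a b c : V} (hab : G.Adj a b) (hbc : G.Adj b c) (hca : G.Adj c a) :
    (∃ i, face G φ i = tri a b c) ∨ Separates G {a, b, c} := by
  refine hφ.face_or_separates h (isCircuit_tri hab hbc hca) (fun v => ?_) ?_
  · simp only [Set.mem_insert_iff, Set.mem_singleton_iff, tri_eq hab.ne hbc.ne hca.ne]
    constructor
    · intro hv w
      rw [if_neg]
      grind
    · intro hw
      have := hab.ne
      have := hbc.ne
      have h1 := hw a
      have h2 := hw b
      rintro (rfl | rfl | rfl)
      · rw [if_pos (by simp)] at h2; exact one_ne_zero h2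
      · rw [if_pos (by simp)] at h1; exact one_ne_zero h1
      · rw [if_pos (by simp)] at h1; exact one_ne_zero h1
  · intro u hu v hv huv
    rw [tri_eq hab.ne hbc.ne hca.ne, if_pos]
    · exact one_ne_zero
    · have := huv.ne
      simp only [Set.mem_insert_iff, Set.mem_singleton_iff] at hu hv
      grind

theorem IsFaceLabelling.quad_face_or_separates (hφ : IsFaceLabelling G φ) (h : NoCutVertex G)
    {a b c d : V} (hc : IsFourCycle G a b c d) (hac : ¬ G.Adj a c) (hbd : ¬ G.Adj b d) :
    (∃ i, face G φ i = quad a b c d) ∨ Separates G {a, b, c, d} := by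
  have e := quad_eq hc.ab.ne hc.bc.ne hc.cd.ne hc.da.ne hc.ac hc.bd
  refine hφ.face_or_separates h (isCircuit_quad hc.ab hc.bc hc.cd hc.da hc.ac hc.bd)
    (fun v => ?_) ?_
  · simp only [Set.mem_insert_iff, Set.mem_singleton_iff, e]
    constructor
    · intro hv w
      rw [if_neg]
      grind
    · intro hw
      have h1 := hw a
      have h2 := hw b
      have h3 := hw c
      rintro (rfl | rfl | rfl | rfl)
      · rw [if_pos (by simp)] at h2; exact one_ne_zero h2
      · rw [if_pos (by simp)] at h1; exact one_ne_zero h1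
      · rw [if_pos (by simp)] at h2; exact one_ne_zero h2
      · rw [if_pos (by simp)] at h1; exact one_ne_zero h1
  · intro u hu v hv huv
    rw [e, if_pos]
    · exact one_ne_zero
    · have := huv.ne
      have := huv.symm
      simp only [Set.mem_insert_iff, Set.mem_singleton_iff] at hu hv
      grind

end Separation

section Induction

/-- Graphs on `n` vertices with at most three triangles are 3-colorable. -/
def ThreeTriangle (n : ℕ) : Prop :=
  ∀ (V : Type u) [Fintype V] (G : SimpleGraph V), Fintype.card V = n → IsMacLane G →
    triCount G Set.univ ≤ 3 → ColorableOn G Set.univ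

/-- In graphs on `n` vertices with at most one triangle, 4-cycles can be colored freely. -/
def FourCycleFree (n : ℕ) : Prop :=
  ∀ (V : Type u) [Fintype V] (G : SimpleGraph V), Fintype.card V = n → IsMacLane G →
    triCount G Set.univ ≤ 1 → ∀ a b c d, IsFourCycle G a b c d → ∀ p : Prop,
      ∃ f, ProperOn G Set.univ f ∧ f a = f c ∧ (f b = f d ↔ p)

variable {V : Type u} [Fintype V] {G : SimpleGraph V} {A : Set V} {n : ℕ}

theorem exists_extension {a b c d : V} (hc : IsFourCycle G a b c d)
    (ha : a ∈ A) (hb : b ∈ A) (hcA : c ∈ A) (hd : d ∈ A)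
    (h1 : ∀ p : Prop, ∃ f, ProperOn G A f ∧ f a = f c ∧ (f b = f d ↔ p))
    (h2 : ∃ f, ProperOn G A f ∧ f b = f d ∧ (f c = f a ↔ False)) {f : V → Fin 3}
    (hf : ProperOn G {a, b, c, d} f) :
    ∃ g, ProperOn G A g ∧ ∀ v ∈ ({a, b, c, d} : Set V), g v = f v := by
  have fab : f a ≠ f b := hf a (by simp) b (by simp) hc.ab
  have fbc : f b ≠ f c := hf b (by simp) c (by simp) hc.bc
  have fcd : f c ≠ f d := hf c (by simp) d (by simp) hc.cd
  have fda : f d ≠ f a := hf d (by simp) a (by simp) hc.da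
  have inj2 : ∀ {g : V → Fin 3} {x y : V}, g x ≠ g y → Set.InjOn g {x, y} := by
    intro g x y hxy
    rw [Set.injOn_pair]
    exact fun h => absurd h hxy
  have inj3 : ∀ {g : V → Fin 3} {x y z : V}, g x ≠ g y → g x ≠ g z → g y ≠ g z →
      Set.InjOn g {x, y, z} := by
    intro g x y z hxy hxz hyz u hu v hv huv
    simp only [Set.mem_insert_iff, Set.mem_singleton_iff] at hu hv
    grind
  by_cases hfac : f a = f c
  · obtain ⟨g, hg, gac, gbd⟩ := h1 (f b = f d)
    have gab := hg a ha b hb hc.ab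
    have gda := hg d hd a ha hc.da
    by_cases hfbd : f b = f d
    · obtain ⟨σ, hσ⟩ := exists_perm_eqOn _ (inj2 fab) (inj2 gab)
      have h3 := hσ a (by simp)
      have h4 := hσ b (by simp)
      refine ⟨_, hg.comp_perm σ, fun v hv => ?_⟩
      simp only [Set.mem_insert_iff, Set.mem_singleton_iff] at hv
      rcases hv with rfl | rfl | rfl | rfl
      · exact h3.symm
      · exact h4.symm
      · rw [← gac, ← h3, hfac]
      · rw [← gbd.2 hfbd, ← h4, hfbd]
    · obtain ⟨σ, hσ⟩ := exists_perm_eqOn _ (inj3 fab fda.symm hfbd)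
        (inj3 gab gda.symm (fun h => hfbd (gbd.1 h)))
      have h3 := hσ a (by simp)
      refine ⟨_, hg.comp_perm σ, fun v hv => ?_⟩
      simp only [Set.mem_insert_iff, Set.mem_singleton_iff] at hv
      rcases hv with rfl | rfl | rfl | rfl
      · exact h3.symm
      · exact (hσ _ (by simp)).symm
      · rw [← gac, ← h3, hfac]
      · exact (hσ _ (by simp)).symm
  · obtain ⟨g, hg, gbd, gca⟩ := h2
    have hfbd : f b = f d := by
      generalize f a = x, f b = y, f c = z, f d = w at *
      clear * - fab fbc fcd fda hfac
      revert x y z w; decide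
    obtain ⟨σ, hσ⟩ := exists_perm_eqOn _ (inj3 fab hfac fbc)
      (inj3 (hg a ha b hb hc.ab) (fun h => gca.1 h.symm) (hg b hb c hcA hc.bc))
    have h3 := hσ b (by simp)
    refine ⟨_, hg.comp_perm σ, fun v hv => ?_⟩
    simp only [Set.mem_insert_iff, Set.mem_singleton_iff] at hv
    rcases hv with rfl | rfl | rfl | rfl
    · exact (hσ _ (by simp)).symm
    · exact h3.symm
    · exact (hσ _ (by simp)).symm
    · rw [← gbd, ← h3, hfbd]

theorem card_subtype_lt_of_ne_univ (hA : A ≠ Set.univ) :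
    Fintype.card {v // v ∈ A} < Fintype.card V := by
  obtain ⟨x, hx⟩ := (Set.ne_univ_iff_exists_notMem A).1 hA
  exact Fintype.card_subtype_lt hx

theorem exists_properOn_of_subtype (p : ({v // v ∈ A} → Fin 3) → Prop)
    (h : ∃ f, ProperOn (G.comap (Subtype.val : {v // v ∈ A} → V)) Set.univ f ∧ p f) :
    ∃ g, ProperOn G A g ∧ p (fun v => g v) := by
  obtain ⟨f, hf, hp⟩ := h
  have e : (fun v : {v // v ∈ A} => (fun v => if hv : v ∈ A then f ⟨v, hv⟩ else 0) (v : V)) =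
      f := by
    funext v
    exact dif_pos v.2
  refine ⟨fun v => if hv : v ∈ A then f ⟨v, hv⟩ else 0, fun u hu v hv huv => ?_, by rwa [e]⟩
  beta_reduce
  rw [dif_pos hu, dif_pos hv]
  exact hf ⟨u, hu⟩ trivial ⟨v, hv⟩ trivial huv

theorem IsMacLane.comap_val (hM : IsMacLane G) :
    IsMacLane (G.comap (Subtype.val : {v // v ∈ A} → V)) :=
  hM.of_injective Subtype.val Subtype.val_injective fun _ _ h => h

theorem ThreeTriangle.colorableOn (ih : ∀ m < n, ThreeTriangle.{u} m) (hn : Fintype.card V ≤ n)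
    (hM : IsMacLane G) (hA : A ≠ Set.univ) (ht : triCount G A ≤ 3) : ColorableOn G A := by
  obtain ⟨f, hf⟩ := ih _ (lt_of_lt_of_le (card_subtype_lt_of_ne_univ hA) hn) {v // v ∈ A}
    (G.comap Subtype.val) rfl hM.comap_val
    ((triCount_comap _ Subtype.val_injective fun w => w.2).trans ht)
  obtain ⟨g, hg, -⟩ := exists_properOn_of_subtype (fun _ => True) ⟨f, hf, trivial⟩
  exact ⟨g, hg⟩

theorem FourCycleFree.extend (ih : ∀ m < n, FourCycleFree.{u} m) (hn : Fintype.card V ≤ n)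
    (hM : IsMacLane G) (hA : A ≠ Set.univ) (ht : triCount G A ≤ 1) {a b c d : V}
    (hc : IsFourCycle G a b c d) (hsub : ∀ v ∈ ({a, b, c, d} : Set V), v ∈ A) {f : V → Fin 3}
    (hf : ProperOn G {a, b, c, d} f) :
    ∃ g, ProperOn G A g ∧ ∀ v ∈ ({a, b, c, d} : Set V), g v = f v := by
  have ha := hsub a (by simp)
  have hb := hsub b (by simp)
  have hcA := hsub c (by simp)
  have hd := hsub d (by simp)
  have hc' : IsFourCycle (G.comap (Subtype.val : {v // v ∈ A} → V))
      ⟨a, ha⟩ ⟨b, hb⟩ ⟨c, hcA⟩ ⟨d, hd⟩ :=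
    ⟨hc.ab, hc.bc, hc.cd, hc.da, fun h => hc.ac (congrArg Subtype.val h),
      fun h => hc.bd (congrArg Subtype.val h)⟩
  have key := ih _ (lt_of_lt_of_le (card_subtype_lt_of_ne_univ hA) hn) {v // v ∈ A}
    (G.comap Subtype.val) rfl hM.comap_val
    ((triCount_comap _ Subtype.val_injective fun w => w.2).trans ht)
  refine exists_extension hc ha hb hcA hd (fun p => ?_) ?_ hf
  · exact exists_properOn_of_subtype
      (fun f => f ⟨a, ha⟩ = f ⟨c, hcA⟩ ∧ (f ⟨b, hb⟩ = f ⟨d, hd⟩ ↔ p)) (key _ _ _ _ hc' p)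
  · exact exists_properOn_of_subtype
      (fun f => f ⟨b, hb⟩ = f ⟨d, hd⟩ ∧ (f ⟨c, hcA⟩ = f ⟨a, ha⟩ ↔ False))
      (key _ _ _ _ hc'.rotate False)

/-- A proper coloring of a clique extends to every set that can be colored. -/
theorem ColorableOn.extend_clique {K : Set V} (h : ColorableOn G A) (hKA : K ⊆ A)
    (hK : ∀ u ∈ K, ∀ v ∈ K, u ≠ v → G.Adj u v) {f : V → Fin 3} (hf : ProperOn G K f) :
    ∃ g, ProperOn G A g ∧ ∀ v ∈ K, g v = f v := by
  obtain ⟨g, hg⟩ := h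
  obtain ⟨σ, hσ⟩ := exists_perm_eqOn (c := f) (d := g) K
    (fun u hu v hv huv => by_contra fun hne => hf u hu v hv (hK u hu v hv hne) huv)
    (fun u hu v hv huv => by_contra fun hne =>
      hg u (hKA hu) v (hKA hv) (hK u hu v hv hne) huv)
  exact ⟨_, hg.comp_perm σ, fun v hv => (hσ v hv).symm⟩

end Induction

section ThreeTriangles

variable {V : Type u} [Fintype V] {G : SimpleGraph V}

theorem ProperOn.glue_sides {X K : Set V}
    (hadj : ∀ u ∈ X, ∀ v, v ∉ X → v ∉ K → ¬ G.Adj u v) {g h : V → Fin 3}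
    (hg : ProperOn G (X ∪ K) g) (hh : ProperOn G Xᶜ h) (hgh : ∀ v ∈ K, g v = h v) :
    ∃ e, ProperOn G Set.univ e ∧ (∀ v ∈ X ∪ K, e v = g v) ∧ ∀ v ∈ Xᶜ, e v = h v := by
  refine hg.glue hh (fun v hv hvX => ?_) (fun v => ?_) fun u v hu hv huv => ?_
  · rcases hv with hv | hv
    · exact absurd hv hvX
    · exact hgh v hv
  · by_cases hv : v ∈ X
    · exact Or.inl (Or.inl hv)
    · exact Or.inr hv
  · simp only [Set.mem_union, not_or] at hu
    exact hadj v (by simpa using hv) u hu.1 hu.2 huv.symm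

theorem IsCritical.not_separates_clique (h : IsCritical G) {K : Set V}
    (hK : ∀ u ∈ K, ∀ v ∈ K, u ≠ v → G.Adj u v) : ¬ Separates G K := by
  rintro ⟨X, ⟨x, hx⟩, hXK, ⟨y, hyX, hyK⟩, hadj⟩
  obtain ⟨g, hg⟩ := h.colorable_of_notMem (A := X ∪ K) (v := y) (by simp [hyX, hyK])
  obtain ⟨f, hf, hfg⟩ := (h.colorable_of_notMem (A := Xᶜ) (v := x)
    (by simpa using hx)).extend_clique
    (K := K) (fun v hv hvX => hXK v hvX hv) hK (hg.mono Set.subset_union_right)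
  obtain ⟨e, he, -⟩ := hg.glue_sides hadj hf fun v hv => (hfg v hv).symm
  exact h.not_colorable ⟨e, he⟩

/-- A minimal non-3-colorable graph with three triangles. -/
structure ThreeTriangleObstruction (G : SimpleGraph V) : Prop where
  critical : IsCritical G
  macLane : IsMacLane G
  triCount_le : triCount G Set.univ ≤ 3
  extend : ∀ A : Set V, A ≠ Set.univ → triCount G A ≤ 1 → ∀ a b c d, IsFourCycle G a b c d →
    (∀ v ∈ ({a, b, c, d} : Set V), v ∈ A) → ∀ f : V → Fin 3, ProperOn G {a, b, c, d} f →
    ∃ g, ProperOn G A g ∧ ∀ v ∈ ({a, b, c, d} : Set V), g v = f v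
  quotient : ∀ (W : Type u) [Fintype W] (H : SimpleGraph W), Fintype.card W < Fintype.card V →
    IsMacLane H → triCount H Set.univ ≤ 3 → ColorableOn H Set.univ

namespace ThreeTriangleObstruction

theorem not_separates_quad (h : ThreeTriangleObstruction G) {a b c d : V}
    (hc : IsFourCycle G a b c d) (hac : ¬ G.Adj a c) (hbd : ¬ G.Adj b d) :
    ¬ Separates G {a, b, c, d} := by
  rintro ⟨X, ⟨x, hx⟩, hXK, ⟨y, hyX, hyK⟩, hadj⟩
  obtain ⟨K, hK⟩ : ∃ K : Set V, K = {a, b, c, d} := ⟨_, rfl⟩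
  rw [← hK] at hXK hyK hadj
  have hy : y ∉ X ∪ K := by simp [hyX, hyK]
  have hx' : x ∉ Xᶜ := by simpa using hx
  have hKX : K ⊆ Xᶜ := fun v hv hvX => hXK v hvX hv
  have hne1 : X ∪ K ≠ Set.univ := fun he => hy (he ▸ trivial)
  have hne2 : Xᶜ ≠ Set.univ := fun he => hx' (he ▸ trivial)
  have hsum := (triCount_add_le (G := G) (A := X ∪ K) (B := Xᶜ) (by
    intro p q r hp hq hr hpq hqr hpr
    have hmem : ∀ v, v ∈ (X ∪ K) ∩ Xᶜ → v = a ∨ v = b ∨ v = c ∨ v = d := by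
      rintro v ⟨hv | hv, hvX⟩
      · exact absurd hv hvX
      · simpa [hK] using hv
    have h1 := hpq.ne
    have h2 := hqr.ne
    have h3 := hpr.ne
    have h4 : ¬ G.Adj c a := fun h => hac h.symm
    have h5 : ¬ G.Adj d b := fun h => hbd h.symm
    rcases hmem p hp with rfl | rfl | rfl | rfl <;> rcases hmem q hq with rfl | rfl | rfl | rfl <;>
      rcases hmem r hr with rfl | rfl | rfl | rfl <;> contradiction)).trans
    h.triCount_le
  have hext : ∀ A : Set V, A ≠ Set.univ → triCount G A ≤ 1 → K ⊆ A → ∀ f : V → Fin 3,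
      ProperOn G K f → ∃ g, ProperOn G A g ∧ ∀ v ∈ K, g v = f v := by
    intro A hA ht hKA f hf
    subst hK
    exact h.extend A hA ht a b c d hc (fun v hv => hKA hv) f hf
  have h12 : triCount G (X ∪ K) ≤ 1 ∨ triCount G Xᶜ ≤ 1 := by omega
  rcases h12 with ht | ht
  · obtain ⟨f, hf⟩ := h.critical.colorable_of_notMem hx'
    obtain ⟨g, hg, hgf⟩ := hext _ hne1 ht Set.subset_union_right f (hf.mono hKX)
    obtain ⟨e, he, -⟩ := hg.glue_sides hadj hf hgf
    exact h.critical.not_colorable ⟨e, he⟩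
  · obtain ⟨f, hf⟩ := h.critical.colorable_of_notMem hy
    obtain ⟨g, hg, hgf⟩ := hext _ hne2 ht hKX f (hf.mono Set.subset_union_right)
    obtain ⟨e, he, -⟩ := hf.glue_sides hadj hg fun v hv => (hgf v hv).symm
    exact h.critical.not_colorable ⟨e, he⟩

variable {ι : Type} [Finite ι] {φ : V → V → ι}

theorem exists_tri_face (h : ThreeTriangleObstruction G) (hφ : IsFaceLabelling G φ) {a b c : V}
    (hab : G.Adj a b) (hbc : G.Adj b c) (hca : G.Adj c a) : ∃ i, face G φ i = tri a b c := by
  refine (hφ.tri_face_or_separates h.critical.noCutVertex hab hbc hca).resolve_right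
    (h.critical.not_separates_clique fun u hu v hv huv => ?_)
  simp only [Set.mem_insert_iff, Set.mem_singleton_iff] at hu hv
  have := hab.symm
  have := hbc.symm
  have := hca.symm
  rcases hu with rfl | rfl | rfl <;> rcases hv with rfl | rfl | rfl <;>
    first | assumption | exact absurd rfl huv

theorem exists_quad_face (h : ThreeTriangleObstruction G) (hφ : IsFaceLabelling G φ)
    {a b c d : V} (hc : IsFourCycle G a b c d) (hac : ¬ G.Adj a c) (hbd : ¬ G.Adj b d) :
    ∃ i, face G φ i = quad a b c d :=
  (hφ.quad_face_or_separates h.critical.noCutVertex hc hac hbd).resolve_right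
    (h.not_separates_quad hc hac hbd)

theorem not_adj (h : ThreeTriangleObstruction G) (hφ : IsFaceLabelling G φ) {i : ι} {a b c d : V}
    (hc : IsFourCycle G a b c d) (hi : face G φ i = quad a b c d) : ¬ G.Adj a c := by
  intro hac
  obtain ⟨j, hj⟩ := h.exists_tri_face hφ hc.ab hc.bc hac.symm
  have hij : i ≠ j := (hc.corner hi).symm.ne
    (corner_tri hj hc.ab.ne hc.bc.ne hac.ne') hc.bd.symm hc.cd.ne'
  obtain ⟨u, hu, hua, huc⟩ := h.critical.exists_adj b a c
  have := hφ.fan_two h.critical.noCutVertex (hc.corner' hi)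
    (corner_tri (hj.trans (tri_rotate _ _ _)) hc.bc.ne hac.ne' hc.ab.ne).symm hij hu
  exact this.elim hua huc

theorem hasDetour (h : ThreeTriangleObstruction G) (hφ : IsFaceLabelling G φ) {i : ι}
    {a b c d : V} (hc : IsFourCycle G a b c d) (hi : face G φ i = quad a b c d)
    (hac : ¬ G.Adj a c) : HasDetour G a b c d := by
  by_contra hd
  have e := quad_eq hc.ab.ne hc.bc.ne hc.cd.ne hc.da.ne hc.ac hc.bd
  obtain ⟨W, _, H, π, hW, hH, ht, -, -, hadj⟩ := HasFace.exists_quotient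
    (C := quad a b c d) ⟨ι, inferInstance, φ, hφ, i, hi⟩
    (by rw [e, if_pos (by simp)]; exact one_ne_zero)
    (by rw [e, if_pos (by simp)]; exact one_ne_zero) hc.ac hac hc.da hc.cd.symm hd
  obtain ⟨f, hf⟩ := h.quotient W H hW hH (ht.trans h.triCount_le)
  exact h.critical.not_colorable ⟨fun v => f (π v), fun u _ v _ huv =>
    hf _ trivial _ trivial (hadj u v huv)⟩

theorem exists_hub (h : ThreeTriangleObstruction G) (hφ : IsFaceLabelling G φ) {i : ι}
    {a b c d : V} (hc : IsFourCycle G a b c d) (hi : face G φ i = quad a b c d)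
    (hac : ¬ G.Adj a c) (hbd : ¬ G.Adj b d) :
    (∃ u x y, Hub G a b c d u x y) ∨ (∃ u x y, Hub G a d c b u x y) ∨
      (∃ u x y, Hub G c b a d u x y) ∨ ∃ u x y, Hub G c d a b u x y :=
  hφ.exists_hub h.critical.noCutVertex hc hi hac hbd (h.hasDetour hφ hc hi hac) (by
    obtain ⟨p, q, h1, h2, h3, h4, h5⟩ :=
      h.hasDetour hφ hc.rotate (hi.trans (quad_rotate _ _ _ _)) hbd
    exact ⟨p, q, h1, h2, h3, h4.symm, h5.symm⟩)

theorem adj_of_hub (h : ThreeTriangleObstruction G) (hφ : IsFaceLabelling G φ) {i : ι}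
    {a b c d u x y w : V} (hc : IsFourCycle G a b c d) (hi : face G φ i = quad a b c d)
    (hu : Hub G a b c d u x y) (hbx : ¬ G.Adj b x) (hw : G.Adj b w) : w = a ∨ w = u ∨ w = c := by
  obtain ⟨hua, hub, ⟨huc, hud⟩, ⟨hux, hxc, hxa, hxb, hxd⟩, -⟩ := hu
  obtain ⟨j, hj⟩ := h.exists_tri_face hφ hub.symm hua hc.ab
  obtain ⟨k, hk⟩ : ∃ k, Corner G φ k b u c := by
    by_cases huc' : G.Adj u c
    · obtain ⟨k, hk⟩ := h.exists_tri_face hφ hub.symm huc' hc.bc.symm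
      exact ⟨k, corner_tri hk hub.ne' huc'.ne hc.bc.ne'⟩
    · have hc' : IsFourCycle G b u x c := ⟨hub.symm, hux, hxc, hc.bc.symm, hxb.symm, huc⟩
      obtain ⟨k, hk⟩ := h.exists_quad_face hφ hc' hbx huc'
      exact ⟨k, hc'.corner hk⟩
  exact hφ.fan_three h.critical.noCutVertex (corner_tri hj hub.ne' hua.ne hc.ab.ne).symm hk
    (hc.corner' hi).symm hua.ne' huc hc.ac.symm hw

theorem _root_.SimpleGraph.Hub.reflect {a b c d u x y : V} (hu : Hub G a b c d u x y) :
    Hub G b a d c u y x := by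
  obtain ⟨hua, hub, ⟨huc, hud⟩, ⟨hux, hxc, hxa, hxb, hxd⟩, huy, hyd, hya, hyb, hyc⟩ := hu
  exact ⟨hub, hua, ⟨hud, huc⟩, ⟨huy, hyd, hyb, hya, hyc⟩, hux, hxc, hxb, hxa, hxd⟩

theorem _root_.SimpleGraph.IsFourCycle.reflect {a b c d : V} (hc : IsFourCycle G a b c d) :
    IsFourCycle G b a d c :=
  hc.rotate.reverse

theorem _root_.SimpleGraph.quad_reflect (a b c d : V) : quad a b c d = quad b a d c := by
  rw [quad_rotate b, quad_reverse a]

theorem _root_.SimpleGraph.ProperOn.update {A : Set V} {f : V → Fin 3} {v : V}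
    (h : ProperOn G A f) {k : Fin 3} (hk : ∀ u ∈ A, G.Adj v u → f u ≠ k) :
    ProperOn G A (Function.update f v k) := by
  intro a ha b hb hab
  by_cases hav : a = v
  · subst hav
    rw [Function.update_self, Function.update_of_ne hab.ne']
    exact (hk b hb hab).symm
  · by_cases hbv : b = v
    · subst hbv
      rw [Function.update_self, Function.update_of_ne hab.ne]
      exact hk a ha hab.symm
    · rw [Function.update_of_ne hav, Function.update_of_ne hbv]
      exact h a ha b hb hab

theorem adj_or_adj_of_hub (h : ThreeTriangleObstruction G) (hφ : IsFaceLabelling G φ) {i : ι}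
    {a b c d u x y : V} (hc : IsFourCycle G a b c d) (hi : face G φ i = quad a b c d)
    (hu : Hub G a b c d u x y) : G.Adj b x ∨ G.Adj a y := by
  by_contra hn
  rw [not_or] at hn
  have hb : ∀ w, G.Adj b w → w = a ∨ w = u ∨ w = c := fun w =>
    h.adj_of_hub hφ hc hi hu hn.1
  have ha : ∀ w, G.Adj a w → w = b ∨ w = u ∨ w = d := fun w =>
    h.adj_of_hub hφ hc.reflect (hi.trans (quad_reflect _ _ _ _)) hu.reflect hn.2
  obtain ⟨f, hf⟩ := h.critical.colorable a
  have hcd := hf c hc.ac.symm d hc.da.ne hc.cd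
  obtain ⟨k, l, hkl, hku, hkd, hlu, hlc⟩ : ∃ k l : Fin 3, l ≠ k ∧ f u ≠ k ∧ f d ≠ k ∧ f u ≠ l ∧
      f c ≠ l := by
    generalize f u = p, f c = q, f d = r at *
    clear * - hcd
    revert p q r; decide
  refine h.critical.not_colorable ⟨_, (hf.update (v := b) (k := l) ?_).extend (v := a) (k := k) ?_⟩
  · intro w hw hbw
    rcases hb w hbw with rfl | rfl | rfl
    · exact absurd rfl hw
    · exact hlu
    · exact hlc
  · intro w haw
    have hbd := hc.bd
    have hub := hu.2.1.ne
    rcases ha w haw with rfl | rfl | rfl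
    · rwa [Function.update_self]
    · rwa [Function.update_of_ne hub]
    · rwa [Function.update_of_ne hbd.symm]

/-- Three given triangles are all the triangles. -/
theorem eq_of_isNClique (h : ThreeTriangleObstruction G) {s₁ s₂ s₃ t : Finset V}
    (h1 : G.IsNClique 3 s₁) (h2 : G.IsNClique 3 s₂) (h3 : G.IsNClique 3 s₃)
    (h12 : s₁ ≠ s₂) (h13 : s₁ ≠ s₃) (h23 : s₂ ≠ s₃) (ht : G.IsNClique 3 t) :
    t = s₁ ∨ t = s₂ ∨ t = s₃ := by
  by_contra hn
  push Not at hn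
  have hle : ((({t, s₁, s₂, s₃} : Finset (Finset V)) : Set (Finset V))).ncard ≤
      triCount G Set.univ := by
    rw [triCount_univ]
    refine Set.ncard_le_ncard (fun s hs => ?_) (Set.toFinite _)
    simp only [Finset.coe_insert, Finset.coe_singleton, Set.mem_insert_iff,
      Set.mem_singleton_iff] at hs
    rcases hs with rfl | rfl | rfl | rfl <;> assumption
  rw [Set.ncard_coe_finset, Finset.card_insert_of_notMem (by simp [hn]),
    Finset.card_insert_of_notMem (by simp [h12, h13]), Finset.card_pair h23] at hle
  have := h.triCount_le
  omega

theorem not_hub_of_adj (h : ThreeTriangleObstruction G) (hφ : IsFaceLabelling G φ) {i : ι}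
    {a b c d u x y : V} (hc : IsFourCycle G a b c d) (hi : face G φ i = quad a b c d)
    (hu : Hub G a b c d u x y) (hbx : G.Adj b x) : False := by
  obtain ⟨hua, hub, ⟨huc, hud⟩, ⟨hux, hxc, hxa, hxb, hxd⟩, huy, hyd, hya, hyb, hyc⟩ := hu
  have hl : ∀ {p q r : V}, G.Adj p q → G.Adj p r → G.Adj q r →
      ((p = a ∨ p = b ∨ p = u) ∧ (q = a ∨ q = b ∨ q = u) ∧ (r = a ∨ r = b ∨ r = u)) ∨
      ((p = b ∨ p = u ∨ p = x) ∧ (q = b ∨ q = u ∨ q = x) ∧ (r = b ∨ r = u ∨ r = x)) ∨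
      ((p = b ∨ p = x ∨ p = c) ∧ (q = b ∨ q = x ∨ q = c) ∧ (r = b ∨ r = x ∨ r = c)) := by
    intro p q r hpq hpr hqr
    have := h.eq_of_isNClique (isNClique_three hc.ab hua.symm hub.symm)
      (isNClique_three hub.symm hbx hux) (isNClique_three hbx hc.bc hxc)
      (fun he => by
        have : a ∈ ({b, u, x} : Finset V) := he ▸ (by simp)
        simp [hc.ab.ne, hua.ne', hxa.symm] at this)
      (fun he => by
        have : a ∈ ({b, x, c} : Finset V) := he ▸ (by simp)
        simp [hc.ab.ne, hc.ac, hxa.symm] at this)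
      (fun he => by
        have : u ∈ ({b, x, c} : Finset V) := he ▸ (by simp)
        simp [hub.ne, huc, hux.ne] at this)
      (isNClique_three hpq hpr hqr)
    have hp : p ∈ ({p, q, r} : Finset V) := by simp
    have hq : q ∈ ({p, q, r} : Finset V) := by simp
    have hr : r ∈ ({p, q, r} : Finset V) := by simp
    rcases this with he | he | he
    · rw [he] at hp hq hr
      simp only [Finset.mem_insert, Finset.mem_singleton] at hp hq hr
      exact Or.inl ⟨hp, hq, hr⟩
    · rw [he] at hp hq hr
      simp only [Finset.mem_insert, Finset.mem_singleton] at hp hq hr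
      exact Or.inr (Or.inl ⟨hp, hq, hr⟩)
    · rw [he] at hp hq hr
      simp only [Finset.mem_insert, Finset.mem_singleton] at hp hq hr
      exact Or.inr (Or.inr ⟨hp, hq, hr⟩)
  have nab := hc.ab.ne
  have nbc := hc.bc.ne
  have ncd := hc.cd.ne
  have nda := hc.da.ne
  have nac := hc.ac
  have nbd := hc.bd
  have nua := hua.ne
  have nub := hub.ne
  have nuy := huy.ne
  have nyd := hyd.ne
  have nux := hux.ne
  have nxc := hxc.ne
  have hd : ∀ {q r : V}, G.Adj d q → G.Adj d r → ¬ G.Adj q r := by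
    intro q r h1 h2 h3
    have := (hl h1 h2 h3)
    grind
  have nyx : y ≠ x := fun he => hd hc.cd.symm (he ▸ hyd.symm) (he ▸ hxc.symm)
  have hy : ∀ {q r : V}, G.Adj y q → G.Adj y r → ¬ G.Adj q r := by
    intro q r h1 h2 h3
    have := (hl h1 h2 h3)
    grind
  have hay : ¬ G.Adj a y := fun he => hy he.symm huy.symm hua.symm
  have hud' : ¬ G.Adj u d := fun he => hd he.symm hc.da hua
  have hc' : IsFourCycle G a u y d := ⟨hua.symm, huy, hyd, hc.da, hya.symm, hud⟩
  obtain ⟨j, hj⟩ := h.exists_quad_face hφ hc' hay hud'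
  rcases h.exists_hub hφ hc' hj hay hud' with ⟨s, p, q, hs⟩ | ⟨s, p, q, hs⟩ | ⟨s, p, q, hs⟩ |
      ⟨s, p, q, hs⟩
  · obtain ⟨hsa, hsu, ⟨hsy, hsd⟩, ⟨hsp, hpy, hpa, hpu, hpd⟩, -⟩ := hs
    have hsb : s = b := by
      have := hl hua.symm hsa.symm hsu.symm
      have := hsa.ne
      have := hsu.ne
      grind
    subst hsb
    obtain ⟨k₁, hk₁⟩ := h.exists_tri_face hφ hsu hua hc.ab
    obtain ⟨k₂, hk₂⟩ := h.exists_tri_face hφ hsu hux hbx.symm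
    obtain ⟨k₃, hk₃⟩ := h.exists_tri_face hφ hbx hxc hc.bc.symm
    rcases hφ.fan_four h.critical.noCutVertex
      (corner_tri hk₁ hsu.ne hua.ne hc.ab.ne).symm (corner_tri hk₂ hsu.ne hux.ne hbx.ne')
      (corner_tri hk₃ hbx.ne hxc.ne hc.bc.ne') (hc.corner' hi).symm hua.ne' hux.ne hxc.ne
      hc.ac.symm hxa.symm huc hsp with rfl | rfl | rfl | rfl
    · exact hpa rfl
    · exact hpu rfl
    · exact hy huy.symm hpy.symm hux
    · exact hd hyd.symm hc.cd.symm hpy.symm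
  · exact hd hs.2.1.symm hc.da hs.1
  · exact hy hs.1.symm huy.symm hs.2.1
  · exact hd hs.2.1.symm hyd.symm hs.1

theorem not_hub (h : ThreeTriangleObstruction G) (hφ : IsFaceLabelling G φ) {i : ι}
    {a b c d u x y : V} (hc : IsFourCycle G a b c d) (hi : face G φ i = quad a b c d) :
    ¬ Hub G a b c d u x y := by
  intro hu
  rcases h.adj_or_adj_of_hub hφ hc hi hu with h1 | h1
  · exact h.not_hub_of_adj hφ hc hi hu h1
  · exact h.not_hub_of_adj hφ hc.reflect (hi.trans (quad_reflect _ _ _ _)) hu.reflect h1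

theorem face_ne_quad (h : ThreeTriangleObstruction G) (hφ : IsFaceLabelling G φ) {i : ι}
    {a b c d : V} (hc : IsFourCycle G a b c d) : face G φ i ≠ quad a b c d := by
  intro hi
  have hi' := hi.trans (quad_rotate _ _ _ _)
  have hr := hi.trans (quad_reverse _ _ _ _)
  have hac := h.not_adj hφ hc hi
  have hbd := h.not_adj hφ hc.rotate hi'
  have h2 : quad a b c d = quad c d a b := by rw [quad_rotate a, quad_rotate b]
  have h3 : quad a b c d = quad c b a d := by rw [quad_reverse a, quad_rotate a, quad_rotate d]
  rcases h.exists_hub hφ hc hi hac hbd with ⟨s, p, q, hs⟩ | ⟨s, p, q, hs⟩ | ⟨s, p, q, hs⟩ |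
      ⟨s, p, q, hs⟩
  · exact h.not_hub hφ hc hi hs
  · exact h.not_hub hφ hc.reverse hr hs
  · exact h.not_hub hφ hc.reverse.rotate.rotate (hi.trans h3) hs
  · exact h.not_hub hφ hc.rotate.rotate (hi.trans h2) hs

theorem false (h : ThreeTriangleObstruction G) : False := by
  have h1 := h.critical.potential_le (denseBelow _)
  have h2 : 3 < Fintype.card V := by
    by_contra hn
    refine h.critical.not_colorable ?_
    rw [← Finset.coe_univ]
    exact colorableOn_of_card_le (by rw [Finset.card_univ]; omega)
  rw [potential, ← dartCount_eq_cross, Finset.card_univ] at h1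
  obtain ⟨ι, _, φ, S, hφ, hS, -, h3⟩ := h.macLane.exists_quad_faces (by omega)
  have h4 := h.triCount_le
  rw [triCount_univ] at h4
  obtain ⟨i, hi⟩ : S.Nonempty := by
    rw [← Finset.card_pos]; omega
  obtain ⟨a, b, c, d, hab, hbc, hcd, hda, hac, hbd, he⟩ := hS i hi
  exact h.face_ne_quad hφ ⟨hab, hbc, hcd, hda, hac, hbd⟩ he

end ThreeTriangleObstruction

theorem threeTriangle_of_lt {n : ℕ} (hP : ∀ m < n, ThreeTriangle.{u} m)
    (hQ : ∀ m < n, FourCycleFree.{u} m) : ThreeTriangle.{u} n := by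
  intro V _ G hn hM ht
  by_contra hcol
  refine ThreeTriangleObstruction.false (G := G)
    ⟨⟨hcol, fun v => ThreeTriangle.colorableOn hP hn.le hM (by simp)
      ((triCount_mono (Set.subset_univ _)).trans ht)⟩,
      hM, ht, ?_, fun W _ H hW hH hHt => hP _ (hn ▸ hW) W H rfl hH hHt⟩
  intro A hA htA a b c d hc hsub f hf
  exact FourCycleFree.extend hQ hn.le hM hA htA hc hsub hf

end ThreeTriangles

section FourCycles

variable {V : Type u} [Fintype V] {G : SimpleGraph V}

/-- A minimal graph with a coloring of a 4-cycle that does not extend. -/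
structure FourCycleObstruction (G : SimpleGraph V) (a b c d : V) (f : V → Fin 3) : Prop where
  macLane : IsMacLane G
  triCount_le : triCount G Set.univ ≤ 1
  cycle : IsFourCycle G a b c d
  proper : ProperOn G {a, b, c, d} f
  colorable : ∀ A : Set V, A ≠ Set.univ → ColorableOn G A
  extend : ∀ A : Set V, A ≠ Set.univ → ∀ a' b' c' d', IsFourCycle G a' b' c' d' →
    (∀ v ∈ ({a', b', c', d'} : Set V), v ∈ A) → ∀ f' : V → Fin 3,
    ProperOn G {a', b', c', d'} f' →
    ∃ g, ProperOn G A g ∧ ∀ v ∈ ({a', b', c', d'} : Set V), g v = f' v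
  not_extend : ¬ ∃ g, ProperOn G Set.univ g ∧ ∀ v ∈ ({a, b, c, d} : Set V), g v = f v

namespace FourCycleObstruction

variable {a b c d : V} {f : V → Fin 3}

theorem rotate (h : FourCycleObstruction G a b c d f) : FourCycleObstruction G b c d a f := by
  have e : ({b, c, d, a} : Set V) = {a, b, c, d} := by ext; simp; tauto
  exact ⟨h.macLane, h.triCount_le, h.cycle.rotate, e ▸ h.proper, h.colorable, h.extend,
    e ▸ h.not_extend⟩

theorem not_separates (h : FourCycleObstruction G a b c d f) {K : Set V}
    (hK : ∀ B : Set V, B ≠ Set.univ → K ⊆ B → ∀ g : V → Fin 3, ProperOn G K g →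
      ∃ g', ProperOn G B g' ∧ ∀ v ∈ K, g' v = g v)
    (h1 : a ∈ K → c ∈ K → b ∈ K ∨ d ∈ K) (h2 : b ∈ K → d ∈ K → a ∈ K ∨ c ∈ K) :
    ¬ Separates G K := by
  rintro ⟨X, ⟨x, hx⟩, hXK, ⟨y, hyX, hyK⟩, hadj⟩
  have hy : y ∉ X ∪ K := by simp [hyX, hyK]
  have hx' : x ∉ Xᶜ := by simpa using hx
  have hKX : K ⊆ Xᶜ := fun v hv hvX => hXK v hvX hv
  have hne1 : X ∪ K ≠ Set.univ := fun he => hy (he ▸ trivial)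
  have hne2 : Xᶜ ≠ Set.univ := fun he => hx' (he ▸ trivial)
  have hside : (∀ v ∈ ({a, b, c, d} : Set V), v ∈ X ∪ K) ∨
      ∀ v ∈ ({a, b, c, d} : Set V), v ∈ Xᶜ := by
    have e : ∀ u v, G.Adj u v → (u ∈ X → v ∈ X ∨ v ∈ K) ∧ (v ∈ X → u ∈ X ∨ u ∈ K) := by
      intro u v huv
      constructor
      · intro hu; by_contra hn; rw [not_or] at hn; exact hadj u hu v hn.1 hn.2 huv
      · intro hu; by_contra hn; rw [not_or] at hn; exact hadj v hu u hn.1 hn.2 huv.symm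
    have e1 := e a b h.cycle.ab
    have e2 := e b c h.cycle.bc
    have e3 := e c d h.cycle.cd
    have e4 := e d a h.cycle.da
    have k1 := hXK a
    have k2 := hXK b
    have k3 := hXK c
    have k4 := hXK d
    simp only [Set.mem_insert_iff, Set.mem_singleton_iff, forall_eq_or_imp, forall_eq,
      Set.mem_union, Set.mem_compl_iff]
    clear * - e1 e2 e3 e4 h1 h2 k1 k2 k3 k4
    grind
  rcases hside with hs | hs
  · obtain ⟨g, hg, hgf⟩ := h.extend _ hne1 a b c d h.cycle hs f h.proper
    obtain ⟨g', hg', hgg⟩ := hK _ hne2 hKX g (hg.mono Set.subset_union_right)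
    obtain ⟨e, he, hes, -⟩ := hg.glue_sides hadj hg' fun v hv => (hgg v hv).symm
    exact h.not_extend ⟨e, he, fun v hv => (hes v (hs v hv)).trans (hgf v hv)⟩
  · obtain ⟨g, hg, hgf⟩ := h.extend _ hne2 a b c d h.cycle hs f h.proper
    obtain ⟨g', hg', hgg⟩ := hK _ hne1 Set.subset_union_right g (hg.mono hKX)
    obtain ⟨e, he, -, hes⟩ := hg'.glue_sides hadj hg hgg
    exact h.not_extend ⟨e, he, fun v hv => (hes v (hs v hv)).trans (hgf v hv)⟩

theorem not_adj (h : FourCycleObstruction G a b c d f) {p q r s : V}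
    (hc : IsFourCycle G p q r s) : ¬ G.Adj p r :=
  hc.not_adj h.triCount_le

theorem not_separates_clique (h : FourCycleObstruction G a b c d f) {K : Set V}
    (hK : ∀ u ∈ K, ∀ v ∈ K, u ≠ v → G.Adj u v) : ¬ Separates G K :=
  h.not_separates (fun B hB hKB _ hg => (h.colorable B hB).extend_clique hKB hK hg)
    (fun ha hc => absurd (hK a ha c hc h.cycle.ac) (h.not_adj h.cycle))
    (fun hb hd => absurd (hK b hb d hd h.cycle.bd) (h.not_adj h.cycle.rotate))

theorem noCutVertex (h : FourCycleObstruction G a b c d f) : NoCutVertex G :=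
  noCutVertex_of_not_separates fun _ => h.not_separates_clique fun _ hu _ hw huw =>
    absurd (hu.trans hw.symm) huw

variable {ι : Type} [Finite ι] {φ : V → V → ι}

theorem exists_tri_face (h : FourCycleObstruction G a b c d f) (hφ : IsFaceLabelling G φ)
    {p q r : V} (hpq : G.Adj p q) (hqr : G.Adj q r) (hrp : G.Adj r p) :
    ∃ i, face G φ i = tri p q r := by
  refine (hφ.tri_face_or_separates h.noCutVertex hpq hqr hrp).resolve_right
    (h.not_separates_clique fun u hu v hv huv => ?_)
  simp only [Set.mem_insert_iff, Set.mem_singleton_iff] at hu hv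
  have := hpq.symm
  have := hqr.symm
  have := hrp.symm
  rcases hu with rfl | rfl | rfl <;> rcases hv with rfl | rfl | rfl <;>
    first | assumption | exact absurd rfl huv

theorem exists_quad_face_of_not_split (h : FourCycleObstruction G a b c d f)
    (hφ : IsFaceLabelling G φ) {p q r s : V} (hc : IsFourCycle G p q r s)
    (h1 : a ∈ ({p, q, r, s} : Set V) → c ∈ ({p, q, r, s} : Set V) →
      b ∈ ({p, q, r, s} : Set V) ∨ d ∈ ({p, q, r, s} : Set V))
    (h2 : b ∈ ({p, q, r, s} : Set V) → d ∈ ({p, q, r, s} : Set V) →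
      a ∈ ({p, q, r, s} : Set V) ∨ c ∈ ({p, q, r, s} : Set V)) :
    ∃ i, face G φ i = quad p q r s :=
  (hφ.quad_face_or_separates h.noCutVertex hc (h.not_adj hc) (h.not_adj hc.rotate)).resolve_right
    (h.not_separates (fun B hB hKB g hg => h.extend B hB p q r s hc hKB g hg) h1 h2)

theorem eq_or_eq_of_adj (h : FourCycleObstruction G a b c d f) {p : V} (hbp : G.Adj b p)
    (hdp : G.Adj d p) : p = a ∨ p = c := by
  by_contra hn
  push Not at hn
  obtain ⟨hpa, hpc⟩ := hn
  obtain ⟨ι, _, φ, hφ⟩ := h.macLane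
  have hc1 : IsFourCycle G a b p d := ⟨h.cycle.ab, hbp, hdp.symm, h.cycle.da, hpa.symm, h.cycle.bd⟩
  have hc2 : IsFourCycle G c b p d :=
    ⟨h.cycle.bc.symm, hbp, hdp.symm, h.cycle.cd.symm, hpc.symm, h.cycle.bd⟩
  obtain ⟨i, hi⟩ := h.exists_quad_face_of_not_split hφ hc1 (by simp) (by simp)
  obtain ⟨j, hj⟩ := h.exists_quad_face_of_not_split hφ hc2 (by simp) (by simp)
  have hij : i ≠ j := (hc1.corner' hi).ne (hc2.corner' hj) h.cycle.ac hpa.symm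
  have hnb : ∀ w, G.Adj p w → w = b ∨ w = d := fun w hw =>
    hφ.fan_two h.noCutVertex (hc1.rotate.corner' (hi.trans (quad_rotate _ _ _ _)))
      (hc2.rotate.corner' (hj.trans (quad_rotate _ _ _ _))) hij hw
  obtain ⟨g, hg, hgf⟩ := h.extend {p}ᶜ (by simp) a b c d h.cycle (by
    have := hbp.ne
    have := hdp.ne
    intro v hv
    simp only [Set.mem_insert_iff, Set.mem_singleton_iff, Set.mem_compl_iff] at hv ⊢
    grind) f h.proper
  obtain ⟨k, hk1, hk2⟩ := exists_color_ne (g b) (g d)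
  refine h.not_extend ⟨_, hg.extend (k := k) fun u hu => ?_, fun v hv => ?_⟩
  · rcases hnb u hu with rfl | rfl
    · exact hk1
    · exact hk2
  · rw [Function.update_of_ne, hgf v hv]
    have := hbp.ne
    have := hdp.ne
    simp only [Set.mem_insert_iff, Set.mem_singleton_iff] at hv
    grind

theorem quad_eq_of_diagonal (h : FourCycleObstruction G a b c d f) {q s : V}
    (hc : IsFourCycle G b q d s) : quad b q d s = quad a b c d := by
  rcases h.eq_or_eq_of_adj hc.ab hc.bc.symm with rfl | rfl
  · rcases h.eq_or_eq_of_adj hc.da.symm hc.cd with rfl | rfl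
    · exact absurd rfl hc.bd
    · rw [quad_rotate q, quad_reverse b]
  · rcases h.eq_or_eq_of_adj hc.da.symm hc.cd with rfl | rfl
    · rw [quad_rotate s]
    · exact absurd rfl hc.bd

/-- The two vertices are opposite on the 4-cycle. -/
def Opposite (a b c d x z : V) : Prop :=
  (x = a ∧ z = c) ∨ (x = c ∧ z = a) ∨ (x = b ∧ z = d) ∨ (x = d ∧ z = b)

theorem quad_eq_of_opposite (h : FourCycleObstruction G a b c d f) {p q r s : V}
    (hc : IsFourCycle G p q r s) (ho : Opposite a b c d p r) : quad p q r s = quad a b c d := by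
  have e1 : quad b c d a = quad a b c d := (quad_rotate _ _ _ _).symm
  have e2 : quad c d a b = quad a b c d := by rw [quad_rotate a, quad_rotate b]
  have e3 : quad d a b c = quad a b c d := by rw [quad_rotate d]
  rcases ho with ⟨rfl, rfl⟩ | ⟨rfl, rfl⟩ | ⟨rfl, rfl⟩ | ⟨rfl, rfl⟩
  · exact (h.rotate.rotate.rotate.quad_eq_of_diagonal hc).trans e3
  · exact (h.rotate.quad_eq_of_diagonal hc).trans e1
  · exact h.quad_eq_of_diagonal hc
  · exact (h.rotate.rotate.quad_eq_of_diagonal hc).trans e2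

theorem exists_quad_face (h : FourCycleObstruction G a b c d f) (hφ : IsFaceLabelling G φ)
    {p q r s : V} (hc : IsFourCycle G p q r s) : ∃ i, face G φ i = quad p q r s := by
  have hac := h.not_adj h.cycle
  have hbd := h.not_adj h.cycle.rotate
  refine h.exists_quad_face_of_not_split hφ hc (fun h1 h2 => ?_) fun h1 h2 => ?_
  · have hx : (G.Adj q a ∧ G.Adj q c) ∨ (G.Adj p a ∧ G.Adj p c) := by
      have := h.cycle.ac
      have := hc.ab; have := hc.bc; have := hc.cd; have := hc.da
      have := hc.ab.symm; have := hc.bc.symm; have := hc.cd.symm; have := hc.da.symm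
      have : ¬ G.Adj c a := fun h => hac h.symm
      simp only [Set.mem_insert_iff, Set.mem_singleton_iff] at h1 h2
      rcases h1 with rfl | rfl | rfl | rfl <;> rcases h2 with rfl | rfl | rfl | rfl <;>
        first | contradiction | tauto
    rcases hx with hx | hx
    · rcases h.rotate.eq_or_eq_of_adj hx.2.symm hx.1.symm with rfl | rfl <;> simp
    · rcases h.rotate.eq_or_eq_of_adj hx.2.symm hx.1.symm with rfl | rfl <;> simp
  · have hx : (G.Adj q b ∧ G.Adj q d) ∨ (G.Adj p b ∧ G.Adj p d) := by
      have := h.cycle.bd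
      have := hc.ab; have := hc.bc; have := hc.cd; have := hc.da
      have := hc.ab.symm; have := hc.bc.symm; have := hc.cd.symm; have := hc.da.symm
      have : ¬ G.Adj d b := fun h => hbd h.symm
      simp only [Set.mem_insert_iff, Set.mem_singleton_iff] at h1 h2
      rcases h1 with rfl | rfl | rfl | rfl <;> rcases h2 with rfl | rfl | rfl | rfl <;>
        first | contradiction | tauto
    rcases hx with hx | hx
    · rcases h.eq_or_eq_of_adj hx.1.symm hx.2.symm with rfl | rfl <;> simp
    · rcases h.eq_or_eq_of_adj hx.1.symm hx.2.symm with rfl | rfl <;> simp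

theorem triCount_addEdge_le (h : FourCycleObstruction G a b c d f) :
    triCount (addEdge G b d) Set.univ ≤ 3 := by
  have h1 := h.triCount_le
  rw [triCount_univ] at h1 ⊢
  have hsub : {t : Finset V | (addEdge G b d).IsNClique 3 t} ⊆
      {t | G.IsNClique 3 t} ∪ {{b, d, a}, {b, d, c}} := by
    intro t ht
    by_cases hbd : b ∈ t ∧ d ∈ t
    · right
      have hcard : ((t.erase b).erase d).card = 1 := by
        rw [Finset.card_erase_of_mem (Finset.mem_erase.2 ⟨h.cycle.bd.symm, hbd.2⟩),
          Finset.card_erase_of_mem hbd.1, ht.card_eq]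
      obtain ⟨r, hr⟩ := Finset.card_eq_one.1 hcard
      have hrt : r ∈ (t.erase b).erase d := hr ▸ Finset.mem_singleton_self r
      rw [Finset.mem_erase, Finset.mem_erase] at hrt
      have ht' : t = {b, d, r} := by
        rw [← Finset.insert_erase hbd.1,
          ← Finset.insert_erase (Finset.mem_erase.2 ⟨h.cycle.bd.symm, hbd.2⟩), hr]
      have hb := ht.isClique hbd.1 hrt.2.2 hrt.2.1.symm
      have hd := ht.isClique hbd.2 hrt.2.2 hrt.1.symm
      rw [addEdge_adj] at hb hd
      have hb' : G.Adj b r := by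
        rcases hb with hb | ⟨⟨-, hb⟩ | ⟨hb, -⟩, -⟩
        · exact hb
        · exact absurd hb.symm hrt.1
        · exact absurd hb.symm hrt.2.1
      have hd' : G.Adj d r := by
        rcases hd with hd | ⟨⟨-, hd⟩ | ⟨hd, -⟩, -⟩
        · exact hd
        · exact absurd hd.symm hrt.1
        · exact absurd hd.symm hrt.2.1
      rcases h.eq_or_eq_of_adj hb' hd' with rfl | rfl
      · exact Or.inl ht'
      · exact Or.inr ht'
    · left
      refine ⟨fun u hu v hv huv => ?_, ht.card_eq⟩
      have := ht.isClique hu hv huv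
      rw [addEdge_adj] at this
      rcases this with h | ⟨⟨rfl, rfl⟩ | ⟨rfl, rfl⟩, -⟩
      · exact h
      · exact absurd ⟨hu, hv⟩ hbd
      · exact absurd ⟨hv, hu⟩ hbd
  have h2 := Set.ncard_le_ncard hsub (Set.toFinite _)
  have h3 := Set.ncard_union_le {t : Finset V | G.IsNClique 3 t} {{b, d, a}, {b, d, c}}
  have h4 := Set.ncard_insert_le ({b, d, a} : Finset V) {{b, d, c}}
  rw [Set.ncard_singleton] at h4
  omega

theorem exists_coloring (h : FourCycleObstruction G a b c d f)
    (hP : ∀ H : SimpleGraph V, IsMacLane H → triCount H Set.univ ≤ 3 → ColorableOn H Set.univ) :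
    ∃ g, ProperOn G Set.univ g ∧ g a = g c ∧ g b ≠ g d := by
  obtain ⟨ι, _, φ, hφ⟩ := h.macLane
  obtain ⟨i, hi⟩ := h.exists_quad_face hφ h.cycle
  have e := quad_eq h.cycle.ab.ne h.cycle.bc.ne h.cycle.cd.ne h.cycle.da.ne h.cycle.ac h.cycle.bd
  have hM := (HasFace.corner (a := b) (b := c) (c := d) (C := quad a b c d)
    ⟨ι, inferInstance, φ, hφ, i, hi⟩ (by rw [e, if_pos (by simp)]; exact one_ne_zero)
    (by rw [e, if_pos (by simp)]; exact one_ne_zero) h.cycle.bd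
    (h.not_adj h.cycle.rotate)).isMacLane
  obtain ⟨g, hg⟩ := hP _ hM h.triCount_addEdge_le
  have hg' : ProperOn G Set.univ g := fun u hu v hv huv => hg u hu v hv (Or.inl huv)
  have hbd := hg b trivial d trivial (addEdge_adj.2 (Or.inr ⟨Or.inl ⟨rfl, rfl⟩, h.cycle.bd⟩))
  refine ⟨g, hg', ?_, hbd⟩
  have h1 := hg' a trivial b trivial h.cycle.ab
  have h2 := hg' b trivial c trivial h.cycle.bc
  have h3 := hg' c trivial d trivial h.cycle.cd
  have h4 := hg' d trivial a trivial h.cycle.da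
  generalize g a = x, g b = y, g c = z, g d = w at *
  clear * - h1 h2 h3 h4 hbd
  revert x y z w; decide

end FourCycleObstruction

end FourCycles

section Counting

variable {V : Type u} [Fintype V] {G : SimpleGraph V}

theorem quad_ne_tri {p q r s x y z : V} (hc : IsFourCycle G p q r s) (hxy : G.Adj x y)
    (hyz : G.Adj y z) (hzx : G.Adj z x) : quad p q r s ≠ tri x y z := by
  intro he
  have e := quad_eq hc.ab.ne hc.bc.ne hc.cd.ne hc.da.ne hc.ac hc.bd
  have e' := tri_eq hxy.ne hyz.ne hzx.ne
  have h1 : tri x y z p q ≠ 0 := by rw [← he, e, if_pos (by simp)]; exact one_ne_zero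
  have h2 : tri x y z q r ≠ 0 := by rw [← he, e, if_pos (by simp)]; exact one_ne_zero
  have h3 : tri x y z r s ≠ 0 := by rw [← he, e, if_pos (by simp)]; exact one_ne_zero
  rw [e', ite_ne_right_iff] at h1 h2 h3
  have := hc.ab.ne
  have := hc.bc.ne
  have := hc.cd.ne
  have := hc.da.ne
  have := hc.ac
  have := hc.bd
  replace h1 := h1.1
  replace h2 := h2.1
  replace h3 := h3.1
  clear he e e'
  grind

theorem face_eq_of_ne {ι : Type} [Finite ι] {φ : V → V → ι} {p q : V} {t j : ι}
    (ht : face G φ t p q ≠ 0) (hj : face G φ j p q ≠ 0) (hjt : j ≠ t) :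
    j = if φ p q = t then φ q p else φ p q := by
  have hadj : G.Adj p q := by
    by_contra hn
    exact ht (by simp [face, cob, hn])
  rw [face, cob_apply _ hadj, Pi.single_apply, Pi.single_apply] at ht hj
  grind -ring -linarith

namespace FourCycleObstruction

variable {a b c d : V} {f : V → Fin 3} {ι : Type} [Finite ι] {φ : V → V → ι}

theorem hasDetour (h : FourCycleObstruction G a b c d f)
    (hQ : ∀ (W : Type u) [Fintype W] (H : SimpleGraph W), Fintype.card W < Fintype.card V →
      IsMacLane H → triCount H Set.univ ≤ 1 → ∀ a b c d, IsFourCycle H a b c d →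
      ∃ g, ProperOn H Set.univ g ∧ g a = g c ∧ g b = g d)
    (hno : ¬ ∃ g, ProperOn G Set.univ g ∧ g a = g c ∧ g b = g d) {p q r s : V}
    (hc : IsFourCycle G p q r s) (hne : quad p q r s ≠ quad a b c d) : HasDetour G p q r s := by
  by_contra hd
  obtain ⟨ι, _, φ, hφ⟩ := h.macLane
  obtain ⟨i, hi⟩ := h.exists_quad_face hφ hc
  have e := quad_eq hc.ab.ne hc.bc.ne hc.cd.ne hc.da.ne hc.ac hc.bd
  obtain ⟨W, _, H, π, hW, hH, ht, -, hinj, hadj⟩ := HasFace.exists_quotient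
    (C := quad p q r s) ⟨ι, inferInstance, φ, hφ, i, hi⟩
    (by rw [e, if_pos (by simp)]; exact one_ne_zero)
    (by rw [e, if_pos (by simp)]; exact one_ne_zero) hc.ac (h.not_adj hc) hc.da hc.cd.symm hd
  have ho : ¬ Opposite a b c d p r := fun ho => hne (h.quad_eq_of_opposite hc ho)
  have hcH : IsFourCycle H (π a) (π b) (π c) (π d) := by
    refine ⟨hadj _ _ h.cycle.ab, hadj _ _ h.cycle.bc, hadj _ _ h.cycle.cd, hadj _ _ h.cycle.da,
      fun he => ho ?_, fun he => ho ?_⟩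
    · have := hinj _ _ he
      have := h.cycle.ac
      unfold Opposite
      grind
    · have := hinj _ _ he
      have := h.cycle.bd
      unfold Opposite
      grind
  obtain ⟨g, hg, h1, h2⟩ := hQ W H hW hH (ht.trans h.triCount_le) _ _ _ _ hcH
  exact hno ⟨fun v => g (π v), fun u _ v _ huv => hg _ trivial _ trivial (hadj u v huv), h1, h2⟩

theorem exists_triangle (h : FourCycleObstruction G a b c d f)
    (hQ : ∀ (W : Type u) [Fintype W] (H : SimpleGraph W), Fintype.card W < Fintype.card V →
      IsMacLane H → triCount H Set.univ ≤ 1 → ∀ a b c d, IsFourCycle H a b c d →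
      ∃ g, ProperOn H Set.univ g ∧ g a = g c ∧ g b = g d)
    (hno : ¬ ∃ g, ProperOn G Set.univ g ∧ g a = g c ∧ g b = g d) {p q r s : V}
    (hc : IsFourCycle G p q r s) (hne : quad p q r s ≠ quad a b c d) :
    ∃ x y z, G.Adj x y ∧ G.Adj y z ∧ G.Adj z x ∧ quad p q r s x y ≠ 0 := by
  obtain ⟨ι, _, φ, hφ⟩ := h.macLane
  obtain ⟨i, hi⟩ := h.exists_quad_face hφ hc
  have hd1 := h.hasDetour hQ hno hc hne
  have hd2 : HasDetour G q p s r := by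
    obtain ⟨p', q', h1, h2, h3, h4, h5⟩ :=
      h.hasDetour hQ hno hc.rotate (by rwa [← quad_rotate])
    exact ⟨p', q', h1, h2, h3, h4.symm, h5.symm⟩
  have e := quad_eq hc.ab.ne hc.bc.ne hc.cd.ne hc.da.ne hc.ac hc.bd
  rcases hφ.exists_hub h.noCutVertex hc hi (h.not_adj hc) (h.not_adj hc.rotate) hd1 hd2 with
    ⟨u, x, y, hu⟩ | ⟨u, x, y, hu⟩ | ⟨u, x, y, hu⟩ | ⟨u, x, y, hu⟩
  · exact ⟨p, q, u, hc.ab, hu.2.1.symm, hu.1, by rw [e, if_pos (by simp)]; exact one_ne_zero⟩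
  · exact ⟨p, s, u, hc.da.symm, hu.2.1.symm, hu.1,
      by rw [e, if_pos (by simp)]; exact one_ne_zero⟩
  · exact ⟨r, q, u, hc.bc.symm, hu.2.1.symm, hu.1,
      by rw [e, if_pos (by simp)]; exact one_ne_zero⟩
  · exact ⟨r, s, u, hc.cd, hu.2.1.symm, hu.1, by rw [e, if_pos (by simp)]; exact one_ne_zero⟩

theorem card_quads_le (h : FourCycleObstruction G a b c d f)
    (hQ : ∀ (W : Type u) [Fintype W] (H : SimpleGraph W), Fintype.card W < Fintype.card V →
      IsMacLane H → triCount H Set.univ ≤ 1 → ∀ a b c d, IsFourCycle H a b c d →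
      ∃ g, ProperOn H Set.univ g ∧ g a = g c ∧ g b = g d)
    (hno : ¬ ∃ g, ProperOn G Set.univ g ∧ g a = g c ∧ g b = g d) (S : Finset (V → V → ZMod 2))
    (hS : ∀ C ∈ S, ∃ p q r s, IsFourCycle G p q r s ∧ C = quad p q r s) : S.card ≤ 4 := by
  obtain ⟨ι, _, φ, hφ⟩ := h.macLane
  have hle := Finset.pred_card_le_card_erase (s := S) (a := quad a b c d)
  suffices (S.erase (quad a b c d)).card ≤ 3 by omega
  rcases (S.erase (quad a b c d)).eq_empty_or_nonempty with h0 | ⟨C, hC⟩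
  · rw [h0]; simp
  have htri : ∀ C ∈ S.erase (quad a b c d), ∃ x y z, G.Adj x y ∧ G.Adj y z ∧ G.Adj z x ∧
      C x y ≠ 0 ∧ (∀ u v, C u v = C v u) ∧ ∃ i, face G φ i = C ∧ ∀ x y z, G.Adj x y →
      G.Adj y z → G.Adj z x → face G φ i ≠ tri x y z := by
    intro C hC
    rw [Finset.mem_erase] at hC
    obtain ⟨p, q, r, s, hc, rfl⟩ := hS C hC.2
    obtain ⟨x, y, z, h1, h2, h3, h4⟩ := h.exists_triangle hQ hno hc hC.1
    obtain ⟨i, hi⟩ := h.exists_quad_face hφ hc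
    exact ⟨x, y, z, h1, h2, h3, h4, (isEven_quad hc.ab hc.bc hc.cd hc.da).symm, i, hi,
      fun x y z hx hy hz => hi ▸ quad_ne_tri hc hx hy hz⟩
  obtain ⟨x, y, z, hxy, hyz, hzx, -⟩ := htri C hC
  obtain ⟨t, ht⟩ := h.exists_tri_face hφ hxy hyz hzx
  obtain ⟨j, hj⟩ : ∃ j : V → V → ι, ∀ p q, j p q = if φ p q = t then φ q p else φ p q :=
    ⟨_, fun _ _ => rfl⟩
  have e := tri_eq hxy.ne hyz.ne hzx.ne
  have hsub : S.erase (quad a b c d) ⊆ {face G φ (j x y), face G φ (j y z), face G φ (j z x)} := by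
    intro D hD
    obtain ⟨x', y', z', h1, h2, h3, h4, hsymm, i, rfl, hi⟩ := htri D hD
    have hit : i ≠ t := fun hit => hi x y z hxy hyz hzx (hit ▸ ht)
    have heq : ({x', y', z'} : Finset V) = {x, y, z} := by
      have hle := h.triCount_le
      rw [triCount_univ, Set.ncard_le_one] at hle
      exact hle _ (isNClique_three h1 h3.symm h2) _ (isNClique_three hxy hzx.symm hyz)
    have hx : x' = x ∨ x' = y ∨ x' = z := by
      have : x' ∈ ({x, y, z} : Finset V) := heq ▸ by simp
      simpa using this
    have hy : y' = x ∨ y' = y ∨ y' = z := by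
      have : y' ∈ ({x, y, z} : Finset V) := heq ▸ by simp
      simpa using this
    have key : ∀ p q, face G φ t p q ≠ 0 → face G φ i p q ≠ 0 →
        face G φ i = face G φ (j p q) := fun p q h1 h2 => by
      rw [hj, ← face_eq_of_ne h1 h2 hit]
    have k1 := key x y (by rw [ht, e, if_pos (by simp)]; exact one_ne_zero)
    have k2 := key y z (by rw [ht, e, if_pos (by simp)]; exact one_ne_zero)
    have k3 := key z x (by rw [ht, e, if_pos (by simp)]; exact one_ne_zero)
    have h4' := h4
    rw [hsymm] at h4'
    have := h1.ne
    simp only [Finset.mem_insert, Finset.mem_singleton]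
    rcases hx with rfl | rfl | rfl <;> rcases hy with rfl | rfl | rfl <;>
      first
      | contradiction
      | exact Or.inl (k1 (by assumption))
      | exact Or.inr (Or.inl (k2 (by assumption)))
      | exact Or.inr (Or.inr (k3 (by assumption)))
  exact (Finset.card_le_card hsub).trans Finset.card_le_three

end FourCycleObstruction

end Counting

section DenseSubgraph

variable {V : Type u} {G : SimpleGraph V}

theorem cross_deleteEdges {a b : V} {R : Finset V} (h : G.Adj a b) (ha : a ∈ R) (hb : b ∈ R) :
    cross (G.deleteEdges {s(a, b)}) R R + 2 ≤ cross G R R := by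
  obtain ⟨H, hH⟩ : ∃ H, H = G.deleteEdges {s(a, b)} := ⟨_, rfl⟩
  rw [← hH]
  have hab := h.ne
  have hp : ∀ u v, (if H.Adj u v then 1 else 0) +
      ((if u = a then (if v = b then 1 else 0) else 0) +
        (if u = b then (if v = a then 1 else 0) else 0)) ≤ (if G.Adj u v then 1 else 0) := by
    intro u v
    have := h.symm
    simp only [hH, deleteEdges_adj, Set.mem_singleton_iff, Sym2.eq_iff]
    grind
  refine le_trans (le_of_eq ?_) (Finset.sum_le_sum fun u _ => Finset.sum_le_sum fun v _ => hp u v)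
  simp only [Finset.sum_add_distrib, cross]
  have key : ∀ x ∈ R, ∀ y ∈ R,
      ∑ u ∈ R, ∑ v ∈ R, (if u = x then (if v = y then 1 else 0) else 0) = 1 := by
    intro x hx y hy
    have : ∀ u ∈ R, ∑ v ∈ R, (if u = x then (if v = y then 1 else 0) else 0) =
        if u = x then 1 else 0 := by
      intro u _
      split_ifs
      · rw [Finset.sum_ite_eq', if_pos hy]
      · simp
    rw [Finset.sum_congr rfl this, Finset.sum_ite_eq', if_pos hx]
  rw [key a ha b hb, key b hb a ha]

/-- The graph in which opposite corners of a 4-cycle are identified, on the remaining vertices. -/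
noncomputable def fold (G : SimpleGraph V) (a b c d : V) : SimpleGraph V :=
  image (Function.update id d b) (image (Function.update id c a)
    (((G.deleteEdges {s(b, c)}).deleteEdges {s(c, d)}).deleteEdges {s(d, a)}))

theorem potential_le_fold {a b c d : V} (hc : IsFourCycle G a b c d) {W : Finset V}
    (ha : a ∈ W) (hb : b ∈ W) (hcW : c ∉ W) (hd : d ∉ W) :
    potential G (insert c (insert d W)) ≤ potential (fold G a b c d) W + 2 := by
  have hcd : c ∉ insert d W := by simp [hcW, hc.cd.ne]
  have h1 := cross_image_le (G := image (Function.update id c a)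
    (((G.deleteEdges {s(b, c)}).deleteEdges {s(c, d)}).deleteEdges {s(d, a)})) hb hd hc.bd
  have h2 := cross_image_le
    (G := ((G.deleteEdges {s(b, c)}).deleteEdges {s(c, d)}).deleteEdges {s(d, a)})
    (Finset.mem_insert_of_mem (b := d) ha) hcd hc.ac
  obtain ⟨R, hR⟩ : ∃ R, R = insert c (insert d W) := ⟨_, rfl⟩
  have haR : a ∈ R := by simp [hR, ha]
  have hbR : b ∈ R := by simp [hR, hb]
  have hcR : c ∈ R := by simp [hR]
  have hdR : d ∈ R := by simp [hR]
  have hcard : R.card = W.card + 2 := by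
    rw [hR, Finset.card_insert_of_notMem hcd, Finset.card_insert_of_notMem hd]
  rw [← hR] at h2 ⊢
  have := hc.ac
  have := hc.bd
  have h3 := cross_deleteEdges (R := R) hc.bc hbR hcR
  have h4 := cross_deleteEdges (G := G.deleteEdges {s(b, c)}) (R := R) (a := c) (b := d)
    (by simp [deleteEdges_adj, hc.cd, hc.bd.symm, hc.cd.ne']) hcR hdR
  have h5 := cross_deleteEdges (G := (G.deleteEdges {s(b, c)}).deleteEdges {s(c, d)}) (R := R)
    (a := d) (b := a)
    (by simp [deleteEdges_adj, hc.da, hc.bd.symm, hc.cd.ne', hc.ac]) hdR haR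
  unfold potential fold
  omega

theorem fold_adj {a b c d : V} {u v : V} (h : (fold G a b c d).Adj u v) :
    ∃ x y, Function.update id d b (Function.update id c a x) = u ∧
      Function.update id d b (Function.update id c a y) = v ∧ G.Adj x y := by
  obtain ⟨-, x, y, rfl, rfl, -, x, y, rfl, rfl, h⟩ := h
  refine ⟨x, y, rfl, rfl, ?_⟩
  simp only [deleteEdges_adj] at h
  exact h.1.1.1

theorem ProperOn.of_fold {a b c d : V} (hc : IsFourCycle G a b c d) (hac : ¬ G.Adj a c)
    (hbd : ¬ G.Adj b d) {S : Set V} (hS : ∀ v, v ∈ S ↔ v ≠ c ∧ v ≠ d) {f : V → Fin 3}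
    (hf : ProperOn (fold G a b c d) S f) :
    ∃ g, ProperOn G Set.univ g ∧ g a = g c ∧ g b = g d := by
  have hab := hc.ab.ne
  have hbc := hc.bc.ne
  have hcd := hc.cd.ne
  have hda := hc.da.ne
  have hac' := hc.ac
  have hbd' := hc.bd
  obtain ⟨π, hπ⟩ : ∃ π : V → V, ∀ v, π v = if v = c then a else if v = d then b else v :=
    ⟨_, fun _ => rfl⟩
  have hfab : f a ≠ f b := by
    refine hf a ((hS a).2 ⟨hac', hda.symm⟩) b ((hS b).2 ⟨hbc, hbd'⟩) ⟨hab, a, b, ?_, ?_, hab,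
      a, b, ?_, ?_, ?_⟩
    · simp [Function.update_of_ne hda.symm]
    · simp [Function.update_of_ne hbd']
    · simp [Function.update_of_ne hac']
    · simp [Function.update_of_ne hbc]
    · simp [deleteEdges_adj, hc.ab, hab, hbc, hac', hbd', hda.symm]
  have key : ∀ u v, u ≠ c → v ≠ c → G.Adj u v → f (π u) ≠ f (π v) := by
    intro u v hu hv huv
    have hne : π u ≠ π v := by
      have := huv.ne
      have := fun h : G.Adj d b => hbd h.symm
      rw [hπ, hπ]
      grind
    by_cases hx : s(u, v) = s(d, a)
    · rw [Sym2.eq_iff] at hx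
      rcases hx with ⟨rfl, rfl⟩ | ⟨rfl, rfl⟩
      · rw [hπ, hπ, if_neg hu, if_pos rfl, if_neg hv, if_neg hda.symm]; exact hfab.symm
      · rw [hπ, hπ, if_neg hu, if_neg hda.symm, if_neg hv, if_pos rfl]; exact hfab
    have e : ∀ w, w ≠ c → Function.update id d b w = π w := by
      intro w hw
      rw [hπ, if_neg hw, Function.update_apply]; rfl
    have eS : ∀ w, π w ∈ S := by
      intro w
      rw [hS, hπ]
      grind
    refine hf _ (eS u) _ (eS v) ⟨hne, u, v, e u hu, e v hv, huv.ne, u, v,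
      by simp [Function.update_of_ne hu], by simp [Function.update_of_ne hv], ?_⟩
    simp only [deleteEdges_adj, Set.mem_singleton_iff]
    refine ⟨⟨⟨huv, ?_⟩, ?_⟩, hx⟩ <;> rw [Sym2.eq_iff] <;> grind
  have keyc : ∀ v, G.Adj c v → f (π c) ≠ f (π v) := by
    intro v hv
    have hvc := hv.ne'
    have hva : v ≠ a := fun h => hac (h ▸ hv.symm)
    by_cases hvb : v = b
    · subst hvb
      rw [hπ, hπ, if_pos rfl, if_neg hvc, if_neg hbd']; exact hfab
    by_cases hvd : v = d
    · subst hvd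
      rw [hπ, hπ, if_pos rfl, if_neg hvc, if_pos rfl]; exact hfab
    rw [hπ, hπ, if_pos rfl, if_neg hvc, if_neg hvd]
    refine hf a ((hS a).2 ⟨hac', hda.symm⟩) v ((hS v).2 ⟨hvc, hvd⟩) ⟨hva.symm, a, v, ?_, ?_,
      hva.symm, c, v, ?_, ?_, ?_⟩
    · simp [Function.update_of_ne hda.symm]
    · simp [Function.update_of_ne hvd]
    · simp
    · simp [Function.update_of_ne hvc]
    · simp only [deleteEdges_adj, Set.mem_singleton_iff, Sym2.eq_iff]
      grind
  refine ⟨fun v => f (π v), fun u _ v _ huv => ?_, ?_, ?_⟩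
  · by_cases hu : u = c
    · subst hu; exact keyc v huv
    by_cases hv : v = c
    · subst hv; exact (keyc u huv.symm).symm
    exact key u v hu hv huv
  · simp [hπ, hac', hda.symm]
  · simp [hπ, hbd', hbc, hcd.symm]

variable [Fintype V]

/-- A graph that cannot be folded along a 4-cycle contains a dense subgraph. -/
theorem exists_potential_le {a b c d : V} (hc : IsFourCycle G a b c d) (hac : ¬ G.Adj a c)
    (hbd : ¬ G.Adj b d) (h1 : ∃ g, ProperOn G Set.univ g ∧ g a = g c)
    (h2 : ∃ g, ProperOn G Set.univ g ∧ g b = g d)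
    (hno : ¬ ∃ g, ProperOn G Set.univ g ∧ g a = g c ∧ g b = g d) :
    ∃ R : Finset V, 4 ≤ R.card ∧ potential G R ≤ 6 := by
  have hcol : ¬ ColorableOn (fold G a b c d) ((Finset.univ \ {c, d} : Finset V) : Set V) :=
    fun ⟨f, hf⟩ => hno (hf.of_fold hc hac hbd (by simp))
  obtain ⟨W, hWS, hWc, hW⟩ := exists_dense hcol
  have hcW : c ∉ W := fun h => by simpa using hWS h
  have hdW : d ∉ W := fun h => by simpa using hWS h
  have hπ : ∀ v, v ≠ c → v ≠ d → Function.update id d b (Function.update id c a v) = v := by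
    intro v hv hv'
    simp [Function.update_of_ne hv, Function.update_of_ne hv']
  have haW : a ∈ W := by
    by_contra haW
    obtain ⟨g, hg, hgbd⟩ := h2
    refine hWc ⟨g, fun u hu v hv huv => ?_⟩
    obtain ⟨x, y, rfl, rfl, hxy⟩ := fold_adj huv
    have key : ∀ x, Function.update id d b (Function.update id c a x) ∈ W →
        g (Function.update id d b (Function.update id c a x)) = g x := by
      intro x hx
      by_cases hxc : x = c
      · subst hxc
        simp [Function.update_of_ne hc.da.ne', haW] at hx
      · rw [Function.update_of_ne hxc]
        by_cases hxd : x = d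
        · subst hxd; simpa using hgbd
        · simp [Function.update_of_ne hxd]
    rw [key x hu, key y hv]
    exact hg x trivial y trivial hxy
  have hbW : b ∈ W := by
    by_contra hbW
    obtain ⟨g, hg, hgac⟩ := h1
    refine hWc ⟨g, fun u hu v hv huv => ?_⟩
    obtain ⟨x, y, rfl, rfl, hxy⟩ := fold_adj huv
    have key : ∀ x, Function.update id d b (Function.update id c a x) ∈ W →
        g (Function.update id d b (Function.update id c a x)) = g x := by
      intro x hx
      by_cases hxc : x = c
      · subst hxc
        simpa [Function.update_of_ne hc.da.ne'] using hgac
      · rw [Function.update_of_ne hxc] at hx ⊢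
        by_cases hxd : x = d
        · subst hxd; simp [hbW] at hx
        · simp [Function.update_of_ne hxd]
    rw [key x hu, key y hv]
    exact hg x trivial y trivial hxy
  have hp := potential_le_fold hc haW hbW hcW hdW
  refine ⟨_, ?_, hp.trans (by omega)⟩
  rw [Finset.card_insert_of_notMem (by simp [hcW, hc.cd.ne]), Finset.card_insert_of_notMem hdW]
  have : ({a, b} : Finset V).card ≤ W.card := Finset.card_le_card (by
    intro v; simp only [Finset.mem_insert, Finset.mem_singleton]; rintro (rfl | rfl) <;> assumption)
  rw [Finset.card_pair hc.ab.ne] at this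
  omega

theorem exists_five_quads (hM : IsMacLane G) (ht : triCount G Set.univ ≤ 1) {R : Finset V}
    (hR : 4 ≤ R.card) (hp : potential G R ≤ 6) :
    ∃ S : Finset (V → V → ZMod 2), 5 ≤ S.card ∧
      ∀ C ∈ S, ∃ p q r s, IsFourCycle G p q r s ∧ C = quad p q r s := by
  obtain ⟨H, hH⟩ : ∃ H, H = G.comap (Subtype.val : {v // v ∈ R} → V) := ⟨_, rfl⟩
  have hHM : IsMacLane H := by
    rw [hH]
    exact hM.of_injective Subtype.val Subtype.val_injective fun _ _ h => h
  have hd : dartCount H = cross G R R := by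
    rw [dartCount_eq_cross, hH, cross, cross, ← Finset.sum_coe_sort R]
    refine Finset.sum_congr rfl fun a _ => ?_
    rw [← Finset.sum_coe_sort R]
    refine Finset.sum_congr rfl fun b _ => ?_
    simp only [comap_adj]
  have hcard : Fintype.card {v // v ∈ R} = R.card := Fintype.card_coe R
  have hHt : {t : Finset {v // v ∈ R} | H.IsNClique 3 t}.ncard ≤ 1 := by
    rw [← triCount_univ, hH]
    exact (triCount_comap _ Subtype.val_injective fun _ => Set.mem_univ _).trans ht
  unfold potential at hp
  obtain ⟨ι, _, φ, S, hφ, hS, hinj, hle⟩ := hHM.exists_quad_faces (by omega)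
  have hS' : ∀ i, ∃ Z : V → V → ZMod 2, i ∈ S →
      (∃ p q r s, IsFourCycle G p q r s ∧ Z = quad p q r s) ∧
      ∀ u v : {v // v ∈ R}, Z u v = face H φ i u v := by
    intro i
    by_cases hi : i ∈ S
    · obtain ⟨p, q, r, s, h1, h2, h3, h4, h5, h6, h7⟩ := hS i hi
      have h5' : (p : V) ≠ r := fun h => h5 (Subtype.ext h)
      have h6' : (q : V) ≠ s := fun h => h6 (Subtype.ext h)
      have e := quad_eq h1.ne h2.ne h3.ne h4.ne h5 h6
      rw [hH] at h1 h2 h3 h4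
      have hc : IsFourCycle G (p : V) q r s := ⟨h1, h2, h3, h4, h5', h6'⟩
      refine ⟨quad (p : V) q r s, fun _ => ⟨⟨p, q, r, s, hc, rfl⟩, fun u v => ?_⟩⟩
      rw [h7, e, quad_eq hc.ab.ne hc.bc.ne hc.cd.ne hc.da.ne hc.ac hc.bd]
      simp only [Subtype.ext_iff]
    · exact ⟨0, fun h => absurd h hi⟩
  choose Z hZ using hS'
  refine ⟨S.image Z, ?_, ?_⟩
  · rw [Finset.card_image_of_injOn]
    · omega
    · intro i hi j hj hij
      refine hinj (funext fun u => funext fun v => ?_)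
      rw [← (hZ i hi).2, ← (hZ j hj).2, hij]
  · intro C hC
    obtain ⟨i, hi, rfl⟩ := Finset.mem_image.1 hC
    exact (hZ i hi).1

theorem FourCycleFree.obstruction {n : ℕ} (hP : ∀ m < n, ThreeTriangle.{u} m)
    (hQ : ∀ m < n, FourCycleFree.{u} m) (hn : Fintype.card V = n) (hM : IsMacLane G)
    (ht : triCount G Set.univ ≤ 1) {a b c d : V} (hc : IsFourCycle G a b c d) {f : V → Fin 3}
    (hf : ProperOn G {a, b, c, d} f)
    (hno : ¬ ∃ g, ProperOn G Set.univ g ∧ ∀ v ∈ ({a, b, c, d} : Set V), g v = f v) :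
    FourCycleObstruction G a b c d f where
  macLane := hM
  triCount_le := ht
  cycle := hc
  proper := hf
  colorable A hA := ThreeTriangle.colorableOn hP hn.le hM hA
    ((triCount_mono (Set.subset_univ _)).trans (ht.trans (by norm_num)))
  extend A hA a' b' c' d' hc' hsub f' hf' := FourCycleFree.extend hQ hn.le hM hA
    ((triCount_mono (Set.subset_univ _)).trans ht) hc' hsub hf'
  not_extend := hno

theorem fourCycleFree_of_lt {n : ℕ} (hP : ∀ m ≤ n, ThreeTriangle.{u} m)
    (hQ : ∀ m < n, FourCycleFree.{u} m) : FourCycleFree.{u} n := by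
  intro V _ G hn hM ht
  have hP' : ∀ m < n, ThreeTriangle.{u} m := fun m hm => hP m hm.le
  have type1 : ∀ a b c d, IsFourCycle G a b c d →
      ∃ g, ProperOn G Set.univ g ∧ g a = g c ∧ g b ≠ g d := by
    intro a b c d hc
    by_contra hno
    have hab := hc.ab.ne
    have hbc := hc.bc.ne
    have hcd := hc.cd.ne
    have hda := hc.da.ne
    have hac := hc.not_adj ht
    have hca := fun h : G.Adj c a => hac h.symm
    have hbd := hc.bd
    have obs := FourCycleFree.obstruction
      (f := fun v => if v = b then 1 else if v = d then 2 else 0)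
      hP' hQ hn hM ht hc ?_ ?_
    · exact hno (obs.exists_coloring fun H hH hHt => hP n le_rfl V H hn hH hHt)
    · intro u hu v hv huv
      have := huv.ne
      simp only [Set.mem_insert_iff, Set.mem_singleton_iff] at hu hv
      beta_reduce
      rcases hu with rfl | rfl | rfl | rfl <;> rcases hv with rfl | rfl | rfl | rfl <;> grind
    · rintro ⟨g, hg, hgf⟩
      have h1 := hgf a (by simp)
      have h2 := hgf b (by simp)
      have h3 := hgf c (by simp)
      have h4 := hgf d (by simp)
      rw [if_neg hab, if_neg hda.symm] at h1
      rw [if_pos rfl] at h2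
      rw [if_neg hbc.symm, if_neg hcd] at h3
      rw [if_neg hbd.symm, if_pos rfl] at h4
      exact hno ⟨g, hg, h1.trans h3.symm, by rw [h2, h4]; decide⟩
  intro a b c d hc p
  by_cases hp : p
  · suffices ∃ g, ProperOn G Set.univ g ∧ g a = g c ∧ g b = g d by simpa [hp] using this
    by_contra hno
    have hab := hc.ab.ne
    have hbc := hc.bc.ne
    have hcd := hc.cd.ne
    have hda := hc.da.ne
    have hac := hc.not_adj ht
    have hbd := hc.rotate.not_adj ht
    have obs := FourCycleFree.obstruction (f := fun v => if v = b ∨ v = d then 1 else 0)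
      hP' hQ hn hM ht hc ?_ ?_
    · obtain ⟨g, hg, h1, -⟩ := type1 a b c d hc
      obtain ⟨g', hg', h2, -⟩ := type1 b c d a hc.rotate
      obtain ⟨R, hR, hRp⟩ := exists_potential_le hc hac hbd ⟨g, hg, h1⟩ ⟨g', hg', h2⟩ hno
      obtain ⟨S, hS, hSq⟩ := exists_five_quads hM ht hR hRp
      have := obs.card_quads_le (fun W _ H hW hHM hHt a b c d hc => by
        obtain ⟨f, hf, h1, h2⟩ := hQ _ (hn ▸ hW) W H rfl hHM hHt a b c d hc True
        exact ⟨f, hf, h1, h2.2 trivial⟩) hno S hSq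
      omega
    · intro u hu v hv huv
      have := huv.ne
      have := hc.ac
      have := hc.bd
      have hca := fun h : G.Adj c a => hac h.symm
      have hdb := fun h : G.Adj d b => hbd h.symm
      simp only [Set.mem_insert_iff, Set.mem_singleton_iff] at hu hv
      beta_reduce
      rcases hu with rfl | rfl | rfl | rfl <;> rcases hv with rfl | rfl | rfl | rfl <;> grind
    · rintro ⟨g, hg, hgf⟩
      have h1 := hgf a (by simp)
      have h2 := hgf b (by simp)
      have h3 := hgf c (by simp)
      have h4 := hgf d (by simp)
      rw [if_neg (by simp [hab, hda.symm])] at h1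
      rw [if_pos (by simp)] at h2
      rw [if_neg (by simp [hbc.symm, hcd])] at h3
      rw [if_pos (by simp)] at h4
      exact hno ⟨g, hg, h1.trans h3.symm, h2.trans h4.symm⟩
  · obtain ⟨g, hg, h1, h2⟩ := type1 a b c d hc
    exact ⟨g, hg, h1, by simp [hp, h2]⟩

theorem threeTriangle_and_fourCycleFree (n : ℕ) : ThreeTriangle.{u} n ∧ FourCycleFree.{u} n := by
  induction n using Nat.strong_induction_on with
  | _ n ih =>
    have h := threeTriangle_of_lt (fun m hm => (ih m hm).1) fun m hm => (ih m hm).2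
    refine ⟨h, fourCycleFree_of_lt (fun m hm => ?_) fun m hm => (ih m hm).2⟩
    rcases hm.lt_or_eq with hm | rfl
    · exact (ih m hm).1
    · exact h

theorem IsMacLane.colorable (hM : IsMacLane G)
    (ht : {t : Finset V | G.IsNClique 3 t}.ncard ≤ 3) : G.Colorable 3 :=
  colorableOn_univ.1 ((threeTriangle_and_fourCycleFree _).1 V G rfl hM (triCount_univ.trans_le ht))

end DenseSubgraph

section Minors

variable {V W U : Type*} {G : SimpleGraph V} {H : SimpleGraph W} {K : SimpleGraph U} {S T : Set V}

/-- A nonempty vertex set that cannot be split without cutting an edge. -/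
def Linked (G : SimpleGraph V) (S : Set V) : Prop :=
  S.Nonempty ∧ ∀ T ⊆ S, T.Nonempty → T ≠ S → ∃ a ∈ T, ∃ b ∈ S, b ∉ T ∧ G.Adj a b

theorem linked_iff_connected : Linked G S ↔ (G.induce S).Connected := by
  constructor
  · rintro ⟨⟨a, ha⟩, h⟩
    have : Nonempty S := ⟨⟨a, ha⟩⟩
    have key : ∀ v : S, (G.induce S).Reachable ⟨a, ha⟩ v := by
      by_contra hn
      push Not at hn
      obtain ⟨v, hv⟩ := hn
      obtain ⟨b, ⟨hb, hbr⟩, c, hc, hcT, hbc⟩ := h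
        {w | ∃ hw : w ∈ S, (G.induce S).Reachable ⟨a, ha⟩ ⟨w, hw⟩} (fun w hw => hw.1)
        ⟨a, ha, .refl _⟩ (fun he => hv (he.ge v.2).2)
      have had : (G.induce S).Adj ⟨b, hb⟩ ⟨c, hc⟩ := hbc
      exact hcT ⟨hc, hbr.trans had.reachable⟩
    exact ⟨fun u v => (key u).symm.trans (key v)⟩
  · intro h
    obtain ⟨s⟩ := h.nonempty
    refine ⟨⟨s, s.2⟩, fun T hTS ⟨a, ha⟩ hne => ?_⟩
    by_contra hn
    push Not at hn
    have key : ∀ v : S, (v : V) ∈ T := by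
      intro v
      have := h.preconnected ⟨a, hTS ha⟩ v
      rw [reachable_iff_reflTransGen] at this
      induction this with
      | refl => exact ha
      | tail _ hbc ih =>
        by_contra hc
        exact hn _ ih _ (Subtype.property _) hc hbc
    exact hne (hTS.antisymm fun v hv => key ⟨v, hv⟩)

theorem linked_singleton (a : V) : Linked G {a} :=
  ⟨Set.singleton_nonempty a, fun _ hT hT' hne =>
    absurd ((Set.subset_singleton_iff_eq.1 hT).resolve_left hT'.ne_empty) hne⟩

theorem Linked.insert {a b : V} (h : Linked G S) (hb : b ∈ S) (hab : G.Adj a b) :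
    Linked G (insert a S) := by
  refine ⟨⟨a, by simp⟩, fun T hT hT' hne => ?_⟩
  by_cases haT : a ∈ T
  · by_cases hbT : b ∈ T
    · have hST : T ∩ S ≠ S := fun he => hne (hT.antisymm (by
        rintro v (rfl | hv)
        · exact haT
        · exact (he.ge hv).1))
      obtain ⟨c, hc, d, hd, hdT, hcd⟩ := h.2 (T ∩ S) Set.inter_subset_right ⟨b, hbT, hb⟩ hST
      exact ⟨c, hc.1, d, Or.inr hd, fun h => hdT ⟨h, hd⟩, hcd⟩
    · exact ⟨a, haT, b, Or.inr hb, hbT, hab⟩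
  · have hTS : T ⊆ S := fun v hv => (hT hv).resolve_left fun h => haT (h ▸ hv)
    by_cases he : T = S
    · exact ⟨b, he ▸ hb, a, by simp, haT, hab.symm⟩
    · obtain ⟨c, hc, d, hd, hdT, hcd⟩ := h.2 T hTS hT' he
      exact ⟨c, hc, d, Or.inr hd, hdT, hcd⟩

/-- Minors in terms of linked branch sets. -/
theorem hasMinor_iff : G.HasMinor H ↔ ∃ f : W → Set V, (∀ w, Linked G (f w)) ∧
    (∀ w₁ w₂ v, v ∈ f w₁ → v ∈ f w₂ → w₁ = w₂) ∧
    ∀ ⦃w₁ w₂⦄, H.Adj w₁ w₂ → ∃ a ∈ f w₁, ∃ b ∈ f w₂, G.Adj a b := by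
  refine exists_congr fun f => and_congr (forall_congr' fun w => linked_iff_connected.symm)
    (and_congr ⟨fun h w₁ w₂ v h₁ h₂ => ?_, fun h w₁ w₂ hne => ?_⟩ Iff.rfl)
  · by_contra hne
    exact Set.disjoint_left.1 (h hne) h₁ h₂
  · exact Set.disjoint_left.2 fun v h₁ h₂ => hne (h _ _ v h₁ h₂)

theorem HasMinor.trans (h₁ : G.HasMinor H) (h₂ : H.HasMinor K) : G.HasMinor K := by
  rw [hasMinor_iff] at *
  obtain ⟨f, hf, hfd, hfe⟩ := h₁
  obtain ⟨g, hg, hgd, hge⟩ := h₂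
  refine ⟨fun u => {v | ∃ w ∈ g u, v ∈ f w}, fun u => ?_, ?_, ?_⟩
  · obtain ⟨⟨w, hw⟩, hgu⟩ := hg u
    obtain ⟨v, hv⟩ := (hf w).1
    refine ⟨⟨v, w, hw, hv⟩, fun T hT ⟨t, ht⟩ hne => ?_⟩
    by_contra hn
    push Not at hn
    have hsplit : ∀ w ∈ g u, ∀ a ∈ f w, a ∈ T → f w ⊆ T := by
      intro w hw a ha haT
      by_contra hsub
      obtain ⟨b, hb, c, hc, hcT, hbc⟩ := (hf w).2 (f w ∩ T) Set.inter_subset_left ⟨a, ha, haT⟩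
        fun he => hsub fun x hx => (he.ge hx).2
      exact hn b hb.2 c ⟨w, hw, hc⟩ (fun h => hcT ⟨hc, h⟩) hbc
    obtain ⟨w₀, hw₀, ht₀⟩ := hT ht
    have hall : ∀ w ∈ g u, f w ⊆ T := by
      by_contra hna
      push Not at hna
      obtain ⟨w₁, hw₁, hwT⟩ := hna
      obtain ⟨w₂, ⟨hw₂, hw₂T⟩, w₃, hw₃, hw₃T, hadj⟩ := hgu {w ∈ g u | f w ⊆ T} (fun _ h => h.1)
        ⟨w₀, hw₀, hsplit w₀ hw₀ t ht₀ ht⟩ fun he => hwT (he.ge hw₁).2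
      obtain ⟨a, ha, b, hb, hab⟩ := hfe hadj
      exact hn a (hw₂T ha) b ⟨w₃, hw₃, hb⟩ (fun hbT => hw₃T ⟨hw₃, hsplit w₃ hw₃ b hb hbT⟩) hab
    exact hne (hT.antisymm fun v ⟨w, hw, hv⟩ => hall w hw hv)
  · rintro u₁ u₂ v ⟨w₁, hw₁, hv₁⟩ ⟨w₂, hw₂, hv₂⟩
    obtain rfl := hfd _ _ _ hv₁ hv₂
    exact hgd _ _ _ hw₁ hw₂
  · intro u₁ u₂ hu
    obtain ⟨w₁, hw₁, w₂, hw₂, hadj⟩ := hge hu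
    obtain ⟨a, ha, b, hb, hab⟩ := hfe hadj
    exact ⟨a, ⟨w₁, hw₁, ha⟩, b, ⟨w₂, hw₂, hb⟩, hab⟩

theorem IsPlanar.of_hasMinor (hG : G.IsPlanar) (h : G.HasMinor H) : H.IsPlanar :=
  ⟨fun hK => hG.1 (h.trans hK), fun hK => hG.2 (h.trans hK)⟩

/-- A minor with a single branch set that may be larger than one vertex. -/
theorem hasMinor_of_injective {f : W → V} (hf : Function.Injective f) {w₀ : W} {Q : Set V}
    (hQ : Linked G Q) (h₀ : f w₀ ∈ Q) (hfQ : ∀ w, f w ∈ Q → w = w₀)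
    (hadj : ∀ w₁ w₂, H.Adj w₁ w₂ → G.Adj (f w₁) (f w₂) ∨
      (w₁ = w₀ ∧ ∃ a ∈ Q, G.Adj a (f w₂)) ∨ (w₂ = w₀ ∧ ∃ a ∈ Q, G.Adj a (f w₁))) :
    G.HasMinor H := by
  rw [hasMinor_iff]
  refine ⟨fun w => if w = w₀ then Q else {f w}, fun w => ?_, fun w₁ w₂ v h₁ h₂ => ?_,
    fun w₁ w₂ h => ?_⟩
  · beta_reduce
    split_ifs
    · exact hQ
    · exact linked_singleton _
  · beta_reduce at h₁ h₂
    split_ifs at h₁ h₂ with e₁ e₂ e₂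
    · rw [e₁, e₂]
    · rw [Set.mem_singleton_iff] at h₂
      exact e₁.trans (hfQ w₂ (h₂ ▸ h₁)).symm
    · rw [Set.mem_singleton_iff] at h₁
      exact (hfQ w₁ (h₁ ▸ h₂)).trans e₂.symm
    · rw [Set.mem_singleton_iff] at h₁ h₂
      exact hf (h₁.symm.trans h₂)
  · have hmem : ∀ w, f w ∈ (if w = w₀ then Q else {f w} : Set V) := by
      intro w
      split_ifs with e
      · exact e ▸ h₀
      · exact rfl
    rcases hadj w₁ w₂ h with h | ⟨rfl, a, ha, h⟩ | ⟨rfl, a, ha, h⟩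
    · exact ⟨_, hmem w₁, _, hmem w₂, h⟩
    · exact ⟨a, by simpa using ha, _, hmem w₂, h⟩
    · exact ⟨_, hmem w₁, a, by simpa using ha, h.symm⟩

/-- A vertex set without edges leaving it except to `K` contains a linked such set. -/
theorem exists_linked_subset [Finite V] {K Y : Set V} (hY : Y.Nonempty)
    (hcl : ∀ u ∈ Y, ∀ v, G.Adj u v → v ∈ Y ∨ v ∈ K) :
    ∃ Q ⊆ Y, Linked G Q ∧ ∀ u ∈ Q, ∀ v, G.Adj u v → v ∈ Q ∨ v ∈ K := by
  obtain ⟨Q, ⟨hQY, hQn, hQcl⟩, hmin⟩ :=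
    (Set.toFinite {Q : Set V | Q ⊆ Y ∧ Q.Nonempty ∧
      ∀ u ∈ Q, ∀ v, G.Adj u v → v ∈ Q ∨ v ∈ K}).exists_minimal ⟨Y, subset_rfl, hY, hcl⟩
  refine ⟨Q, hQY, ⟨hQn, fun T hT hTn hne => ?_⟩, hQcl⟩
  by_contra hn
  push Not at hn
  refine hne (hT.antisymm (hmin ⟨hT.trans hQY, hTn, fun u hu v huv => ?_⟩ hT))
  rcases hQcl u (hT hu) v huv with h | h
  · by_contra hv
    rw [not_or] at hv
    exact hn u hu v h hv.1 huv
  · exact Or.inr h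

end Minors

section Extension

variable {V : Type*} [Fintype V] {W : Type*} [Fintype W] {G : SimpleGraph V} {f : W → V}
  {ι : Type*} {φ : W → W → ι}

theorem bdry_comp (hf : Function.Injective f) {D : V → V → ZMod 2}
    (hD : ∀ u v, D u v ≠ 0 → ∃ b, f b = v) (a : W) :
    bdry (fun a b => D (f a) (f b)) a = bdry D (f a) := by
  rw [bdry, bdry, ← Finset.sum_image (f := fun v => D (f a) v) (fun x _ y _ hxy => hf hxy)]
  refine Finset.sum_subset (Finset.subset_univ _) fun v _ hv => ?_
  by_contra hn
  obtain ⟨b, hb⟩ := hD _ _ hn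
  exact hv (Finset.mem_image.2 ⟨b, Finset.mem_univ _, hb⟩)

/-- Adding isolated vertices to a graph with a face labelling. -/
theorem IsFaceLabelling.exists_of_comap (hf : Function.Injective f)
    (hG : ∀ u v, G.Adj u v → ∃ a, f a = u) (hφ : IsFaceLabelling (G.comap f) φ) :
    ∃ ψ : V → V → Option ι, IsFaceLabelling G ψ ∧
      ∀ s a b, cob G ψ s (f a) (f b) = cob (G.comap f) φ (s ∘ some) a b := by
  obtain ⟨ψ, hψ⟩ : ∃ ψ : V → V → Option ι, ∀ a b, ψ (f a) (f b) = some (φ a b) := by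
    refine ⟨fun u v => if h : ∃ a b, f a = u ∧ f b = v then
      some (φ h.choose h.choose_spec.choose) else none, fun a b => ?_⟩
    have h : ∃ a' b', f a' = f a ∧ f b' = f b := ⟨a, b, rfl, rfl⟩
    beta_reduce
    rw [dif_pos h]
    exact congrArg some (congrArg₂ φ (hf h.choose_spec.choose_spec.1)
      (hf h.choose_spec.choose_spec.2))
  have hcob : ∀ s a b, cob G ψ s (f a) (f b) = cob (G.comap f) φ (s ∘ some) a b := by
    intro s a b
    simp only [cob, comap_adj, hψ, Function.comp]
  have hsupp : ∀ s u v, cob G ψ s u v ≠ 0 → G.Adj u v := by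
    intro s u v h
    by_contra hn
    exact h (by simp [cob, hn])
  refine ⟨ψ, ⟨fun s => ⟨⟨fun u v => ?_, hsupp s⟩, fun u => ?_⟩, fun Z hZ => ?_⟩, hcob⟩
  · simp only [cob, G.adj_comm u v, add_comm]
  · by_cases hu : ∃ a, f a = u
    · obtain ⟨a, rfl⟩ := hu
      rw [← bdry_comp hf fun u v huv => hG _ _ (hsupp s u v huv).symm]
      simp only [hcob]
      exact (hφ.isEven _).bdry_eq a
    · rw [bdry]
      refine Finset.sum_eq_zero fun v _ => ?_
      by_contra hn
      exact hu (hG _ _ (hsupp s _ _ hn))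
  · have hZ' : IsEven (G.comap f) fun a b => Z (f a) (f b) :=
      ⟨⟨fun a b => hZ.symm _ _, fun a b h => hZ.supp _ _ h⟩, fun a => by
        rw [bdry_comp hf fun u v huv => hG _ _ (hZ.supp u v huv).symm]
        exact hZ.bdry_eq _⟩
    obtain ⟨s, hs⟩ := hφ.span _ hZ'
    refine ⟨fun o => o.elim 0 s, ?_⟩
    funext u v
    by_cases huv : G.Adj u v
    · obtain ⟨a, rfl⟩ := hG _ _ huv
      obtain ⟨b, rfl⟩ := hG _ _ huv.symm
      rw [hcob]
      exact congrFun (congrFun hs a) b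
    · rw [hZ.eq_zero huv]
      simp [cob, huv]

theorem IsMacLane.of_comap (hf : Function.Injective f) (hG : ∀ u v, G.Adj u v → ∃ a, f a = u)
    (h : IsMacLane (G.comap f)) : IsMacLane G := by
  obtain ⟨ι, hι, φ, hφ⟩ := h
  obtain ⟨ψ, hψ, -⟩ := hφ.exists_of_comap hf hG
  exact ⟨Option ι, inferInstance, ψ, hψ⟩

theorem HasFace.of_comap (hf : Function.Injective f) (hG : ∀ u v, G.Adj u v → ∃ a, f a = u)
    {C : V → V → ZMod 2} (hC : IsEdgeChain G C)
    (h : HasFace (G.comap f) fun a b => C (f a) (f b)) : HasFace G C := by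
  obtain ⟨ι, hι, φ, hφ, i, hi⟩ := h
  obtain ⟨ψ, hψ, hcob⟩ := hφ.exists_of_comap hf hG
  refine ⟨Option ι, inferInstance, ψ, hψ, some i, ?_⟩
  funext u v
  by_cases huv : G.Adj u v
  · obtain ⟨a, rfl⟩ := hG _ _ huv
    obtain ⟨b, rfl⟩ := hG _ _ huv.symm
    rw [face, hcob, ← congrFun (congrFun hi a) b, face]
    congr 1
    funext j
    simp [Pi.single_apply]
  · rw [hC.eq_zero huv]
    simp [face, cob, huv]

end Extension

section Glue

variable {V : Type*} [Fintype V] {G G₁ G₂ : SimpleGraph V} {u v : V}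

theorem cob_const {ι : Type*} {φ : V → V → ι} (c : ZMod 2) : cob G φ (fun _ => c) = 0 := by
  funext a b
  simp [cob, zmod_two_add_self]

theorem sum_bdry_eq_zero {Z : V → V → ZMod 2} (h : IsEdgeChain G Z) : ∑ w, bdry Z w = 0 :=
  IsEven.sum_sum_comm_eq_zero h.symm (fun _ => h.eq_zero (G.irrefl)) Finset.univ

theorem IsEven.exists_split
    (hsep : ∀ w a b, G₁.Adj w a → G₂.Adj w b → w = u ∨ w = v)
    (huv : u = v ∨ G₁.Adj u v ∧ G₂.Adj u v) {Z : V → V → ZMod 2} (hZ : IsEven (G₁ ⊔ G₂) Z) :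
    ∃ Z₁ Z₂, IsEven G₁ Z₁ ∧ IsEven G₂ Z₂ ∧ Z₁ + Z₂ = Z := by
  suffices h : ∃ Z₁, IsEven G₁ Z₁ ∧ ∀ a b, G₁.Adj a b → ¬ G₂.Adj a b → Z₁ a b = Z a b by
    obtain ⟨Z₁, h₁, he⟩ := h
    have hev := hZ.add (h₁.mono le_sup_left)
    refine ⟨Z₁, Z + Z₁, h₁, ⟨⟨hev.symm, fun a b hab => ?_⟩, hev.bdry_eq⟩, ?_⟩
    · by_contra hn
      by_cases h1 : G₁.Adj a b
      · exact hab (by rw [Pi.add_apply, Pi.add_apply, he a b h1 hn, zmod_two_add_self])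
      · rcases hev.supp a b hab with h | h
        · exact h1 h
        · exact hn h
    · rw [add_left_comm]
      funext a b
      simp [zmod_two_add_self]
  let Z' : V → V → ZMod 2 := fun a b => if G₁.Adj a b then Z a b else 0
  have hZ' : IsEdgeChain G₁ Z' := ⟨fun a b => by simp only [Z', G₁.adj_comm a b, hZ.symm a b],
    fun a b h => by
      by_contra hn
      exact h (if_neg hn)⟩
  have hb : ∀ w, w ≠ u → w ≠ v → bdry Z' w = 0 := by
    intro w hu hv
    by_cases hw : ∃ a, G₁.Adj w a
    · obtain ⟨a, ha⟩ := hw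
      rw [← hZ.bdry_eq w, bdry, bdry]
      refine Finset.sum_congr rfl fun b _ => ?_
      by_cases hb : G₁.Adj w b
      · exact if_pos hb
      · refine (if_neg hb).trans (hZ.eq_zero ?_).symm
        rintro (h | h)
        · exact hb h
        · exact (hsep w a b ha h).elim hu hv
    · rw [bdry]
      exact Finset.sum_eq_zero fun b _ => if_neg fun h => hw ⟨b, h⟩
  rcases huv with rfl | ⟨huv, huv₂⟩
  · refine ⟨Z', ⟨hZ', fun w => ?_⟩, fun a b h _ => if_pos h⟩
    have := sum_bdry_eq_zero hZ'
    rw [Finset.sum_eq_single u (fun w _ hw => hb w hw hw) (by simp)] at this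
    by_cases hw : w = u
    · exact hw ▸ this
    · exact hb w hw hw
  · have hs := sum_bdry_eq_zero hZ'
    rw [Finset.sum_eq_add u v huv.ne (fun w _ hw => hb w hw.1 hw.2) (by simp) (by simp),
      zmod_two_add_eq_zero] at hs
    refine ⟨Z' + bdry Z' u • single u v, ⟨hZ'.add ((isEdgeChain_single huv).smul _),
      fun w => ?_⟩, fun a b h h₂ => ?_⟩
    · have hne := huv.ne
      rw [bdry_add, bdry_smul, bdry_single hne]
      by_cases hwu : w = u
      · subst hwu
        simp [hne, zmod_two_add_self]
      · by_cases hwv : w = v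
        · subst hwv
          simp [hwu, hs, zmod_two_add_self]
        · simp [hwu, hwv, hb w hwu hwv]
    · have h0 : single u v a b = 0 := by
        by_contra h0
        rcases single_ne_zero_iff.1 h0 with ⟨rfl, rfl⟩ | ⟨rfl, rfl⟩
        · exact h₂ huv₂
        · exact h₂ huv₂.symm
      simp [Z', h, h0]

/-- Gluing MacLane graphs along a vertex or an edge. -/
theorem IsMacLane.sup (h₁ : IsMacLane G₁) (h₂ : IsMacLane G₂)
    (hsep : ∀ w a b, G₁.Adj w a → G₂.Adj w b → w = u ∨ w = v)
    (huv : u = v ∨ G₁.Adj u v ∧ G₂.Adj u v) : IsMacLane (G₁ ⊔ G₂) := by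
  obtain ⟨ι₁, _, φ₁, hφ₁⟩ := h₁
  obtain ⟨ι₂, _, φ₂, hφ₂⟩ := h₂
  have hcom : ∀ a b, G₁.Adj a b → G₂.Adj a b → (a = u ∧ b = v) ∨ (a = v ∧ b = u) := by
    intro a b ha hb
    have := hsep a b b ha hb
    have := hsep b a a ha.symm hb.symm
    have := ha.ne
    grind
  let r : ι₂ → ι₁ ⊕ ι₂ := fun i => if G₁.Adj u v ∧ i = φ₂ u v then .inl (φ₁ v u) else .inr i
  let φ : V → V → ι₁ ⊕ ι₂ := fun a b =>
    if G₁.Adj a b ∧ ¬ (a = v ∧ b = u ∧ G₂.Adj a b) then .inl (φ₁ a b) else r (φ₂ a b)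
  have hr : G₁.Adj u v → r (φ₂ u v) = .inl (φ₁ v u) := fun h => if_pos ⟨h, rfl⟩
  have hcob : ∀ s, cob (G₁ ⊔ G₂) φ s = cob G₁ φ₁ (s ∘ Sum.inl) + cob G₂ φ₂ (s ∘ r) := by
    intro s
    funext a b
    simp only [Pi.add_apply]
    by_cases ha : G₁.Adj a b
    · rw [cob_apply _ (Or.inl ha), cob_apply _ ha]
      by_cases hb : G₂.Adj a b
      · rw [cob_apply _ hb]
        have hne := ha.ne
        rcases hcom a b ha hb with ⟨rfl, rfl⟩ | ⟨rfl, rfl⟩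
        · simp only [φ, ha, hne, ha.symm, hb.symm, Function.comp, hr ha]
          simp only [true_and, false_and, and_self, not_true_eq_false, not_false_eq_true,
            if_true, if_false]
          generalize s (Sum.inl _) = x, s (Sum.inl _) = y, s (r _) = z
          revert x y z; decide
        · simp only [φ, ha, hb, hne.symm, ha.symm, hb.symm, Function.comp, hr ha.symm]
          simp only [true_and, false_and, and_self, not_true_eq_false, not_false_eq_true,
            if_true, if_false]
          generalize s (Sum.inl _) = x, s (Sum.inl _) = y, s (r _) = z
          revert x y z; decide
      · have hb' : ¬ G₂.Adj b a := fun h => hb h.symm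
        simp [φ, cob, ha, ha.symm, hb, hb']
    · have ha' : ¬ G₁.Adj b a := fun h => ha h.symm
      by_cases hb : G₂.Adj a b
      · simp [φ, cob, ha, ha', hb]
      · simp [cob, ha, hb]
  refine ⟨ι₁ ⊕ ι₂, inferInstance, φ, ⟨fun s => ?_, fun Z hZ => ?_⟩⟩
  · rw [hcob]
    exact ((hφ₁.isEven _).mono le_sup_left).add ((hφ₂.isEven _).mono le_sup_right)
  · obtain ⟨Z₁, Z₂, hZ₁, hZ₂, rfl⟩ := hZ.exists_split hsep huv
    obtain ⟨s₁, rfl⟩ := hφ₁.span _ hZ₁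
    obtain ⟨s₂, rfl⟩ := hφ₂.span _ hZ₂
    let s₂' : ι₂ → ZMod 2 := s₂ + fun _ => s₁ (φ₁ v u) + s₂ (φ₂ u v)
    refine ⟨Sum.elim s₁ s₂', ?_⟩
    have h₁ : Sum.elim s₁ s₂' ∘ Sum.inl = s₁ := rfl
    have h₂ : Sum.elim s₁ s₂' ∘ r = s₂' := by
      funext i
      simp only [Function.comp, r]
      split_ifs with h
      · simp only [h.2, s₂', Pi.add_apply, Sum.elim_inl]
        generalize s₁ _ = x, s₂ _ = y
        revert x y; decide
      · rfl
    rw [hcob, h₁, h₂, cob_add, cob_const, add_zero]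

end Glue

section SmallSeparations

variable {V : Type*} {W : Type*} {G : SimpleGraph V}

theorem IsPlanar.comap {f : W → V} (hG : G.IsPlanar) (hf : Function.Injective f) :
    (G.comap f).IsPlanar := by
  refine hG.of_hasMinor (hasMinor_iff.2 ⟨fun w => {f w}, fun w => linked_singleton _,
    fun w₁ w₂ v h₁ h₂ => ?_, fun w₁ w₂ h => ⟨_, rfl, _, rfl, h⟩⟩)
  rw [Set.mem_singleton_iff] at h₁ h₂
  exact hf (h₁.symm.trans h₂)

/-- The subgraph of all edges with both ends in `A`. -/
def within (G : SimpleGraph V) (A : Set V) : SimpleGraph V where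
  Adj a b := G.Adj a b ∧ a ∈ A ∧ b ∈ A
  symm := ⟨fun _ _ h => ⟨h.1.symm, h.2.2, h.2.1⟩⟩
  loopless := ⟨fun _ h => G.irrefl h.1⟩

theorem comap_within {A : Set V} :
    (G.within A).comap (Subtype.val : A → V) = G.comap Subtype.val := by
  ext a b
  exact ⟨fun h => h.1, fun h => ⟨h, a.2, b.2⟩⟩

variable [Fintype V]

theorem isMacLane_top_fin_four : IsMacLane (⊤ : SimpleGraph (Fin 4)) := by
  let φ : Fin 4 → Fin 4 → Fin 4 := fun a b =>
    (![![0, 2, 1, 1], ![3, 0, 0, 0], ![3, 3, 0, 0], ![2, 2, 1, 0]] : Fin 4 → Fin 4 → Fin 4) a b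
  refine ⟨Fin 4, inferInstance, φ, fun s => ⟨⟨fun a b => ?_, fun a b h => ?_⟩, fun a => ?_⟩,
    fun Z hZ => ⟨![Z 1 2, Z 0 2, Z 0 1, 0], ?_⟩⟩
  · simp only [cob, adj_comm _ a b, add_comm]
  · by_contra hn
    exact h (if_neg hn)
  · simp only [bdry, cob, top_adj, Fin.sum_univ_four]
    fin_cases a <;> simp [φ] <;> generalize s 0 = x, s 1 = y, s 2 = z, s 3 = w <;>
      revert x y z w <;> decide
  · have hd : ∀ a, Z a a = 0 := fun a => hZ.eq_zero (by simp)
    have hb : ∀ a, Z a 0 + Z a 1 + Z a 2 + Z a 3 = 0 := fun a => by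
      rw [← hZ.bdry_eq a, bdry, Fin.sum_univ_four]
    have b0 := hb 0
    have b1 := hb 1
    have b2 := hb 2
    have b3 := hb 3
    rw [hd] at b0 b1 b2 b3
    rw [hZ.symm 1 0] at b1
    rw [hZ.symm 2 0, hZ.symm 2 1] at b2
    rw [hZ.symm 3 0, hZ.symm 3 1, hZ.symm 3 2] at b3
    funext a b
    fin_cases a <;> fin_cases b <;> simp [φ, cob, hd, hZ.symm 1 0, hZ.symm 2 0, hZ.symm 2 1,
      hZ.symm 3 0, hZ.symm 3 1, hZ.symm 3 2] <;> clear hb hd hZ <;>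
      generalize Z 0 1 = p, Z 0 2 = q, Z 0 3 = r, Z 1 2 = s, Z 1 3 = t, Z 2 3 = u at * <;>
      clear * - b0 b1 b2 b3 <;> revert p q r s t u <;> decide

theorem isMacLane_of_card_le_four (h : Fintype.card V ≤ 4) : IsMacLane G := by
  obtain ⟨f⟩ := Function.Embedding.nonempty_of_card_le (α := V) (β := Fin 4) (by simpa using h)
  exact isMacLane_top_fin_four.of_injective f f.injective fun a b hab =>
    fun he => hab.ne (f.injective he)

theorem isMacLane_of_not_noCutVertex (hG : G.IsPlanar)
    (hI : ∀ A : Set V, A ≠ Set.univ → ∀ G' : SimpleGraph V, (∀ a b, G'.Adj a b → a ∈ A) →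
      (G'.comap (Subtype.val : A → V)).IsPlanar → IsMacLane G')
    (hcut : ¬ NoCutVertex G) : IsMacLane G := by
  unfold NoCutVertex at hcut
  push Not at hcut
  obtain ⟨v, X, hvX, ⟨x, hx⟩, ⟨y, hy, hyv⟩, hX⟩ := hcut
  have key : ∀ A : Set V, A ≠ Set.univ → IsMacLane (G.within A) := fun A hA =>
    hI A hA _ (fun a b h => h.2.1) (by
      rw [comap_within]
      exact hG.comap Subtype.val_injective)
  refine IsMacLane.mono ((key (insert v X) fun he => (he.ge (Set.mem_univ y)).elim hyv hy).sup
    (u := v) (v := v) (key Xᶜ fun he => he.ge (Set.mem_univ x) hx) ?_ (Or.inl rfl)) ?_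
  · intro w a b ha hb
    exact Or.inl (ha.2.1.resolve_right hb.2.1)
  · have h : ∀ a b, G.Adj a b → a ∈ X → b ∈ insert v X := by
      intro a b hab ha
      by_contra hn
      rw [Set.mem_insert_iff, not_or] at hn
      exact hX a ha b hn.2 hn.1 hab
    intro a b hab
    by_cases ha : a ∈ X
    · exact Or.inl ⟨hab, Or.inr ha, h a b hab ha⟩
    · by_cases hb : b ∈ X
      · exact Or.inl ⟨hab, h b a hab.symm hb, Or.inr hb⟩
      · exact Or.inr ⟨hab, ha, hb⟩

/-- One side of a 2-separation, with the virtual edge, is a minor. -/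
theorem IsPlanar.comap_side (hG : G.IsPlanar) (h : NoCutVertex G) {u v : V} (huv : u ≠ v)
    {Y : Set V} (hY : Y.Nonempty) (hu : u ∉ Y) (hv : v ∉ Y)
    (hcl : ∀ a ∈ Y, ∀ b, G.Adj a b → b ∈ Y ∨ b ∈ ({u, v} : Set V)) :
    ((addEdge (G.within Yᶜ) u v).comap (Subtype.val : (Yᶜ : Set V) → V)).IsPlanar := by
  obtain ⟨Q, hQY, hQ, hQcl⟩ := exists_linked_subset hY hcl
  obtain ⟨a, ha, u', hu', huv', hau⟩ := h v Q (fun h => hv (hQY h)) hQ.1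
    ⟨u, fun h => hu (hQY h), huv⟩
  obtain rfl : u' = u := ((hQcl a ha u' hau).resolve_left hu').resolve_right huv'
  obtain ⟨b, hb, v', hv', hvu', hbv⟩ := h u' Q hu' hQ.1
    ⟨v, fun h => hv (hQY h), huv.symm⟩
  obtain rfl : v' = v := ((hQcl b hb v' hbv).resolve_left hv').resolve_left hvu'
  refine hG.of_hasMinor (hasMinor_of_injective (f := Subtype.val) Subtype.val_injective
    (w₀ := ⟨u', hu⟩) (hQ.insert ha hau.symm) (by simp) ?_ ?_)
  · rintro ⟨w, hw⟩ (rfl | h)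
    · rfl
    · exact absurd (hQY h) hw
  · rintro ⟨w₁, h₁⟩ ⟨w₂, h₂⟩ hw
    rw [comap_adj, addEdge_adj] at hw
    rcases hw with hw | ⟨⟨rfl, rfl⟩ | ⟨rfl, rfl⟩, -⟩
    · exact Or.inl hw.1
    · exact Or.inr (Or.inl ⟨rfl, b, Or.inr hb, hbv⟩)
    · exact Or.inr (Or.inr ⟨rfl, b, Or.inr hb, hbv⟩)

theorem isMacLane_of_separates_pair (hG : G.IsPlanar)
    (hI : ∀ A : Set V, A ≠ Set.univ → ∀ G' : SimpleGraph V, (∀ a b, G'.Adj a b → a ∈ A) →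
      (G'.comap (Subtype.val : A → V)).IsPlanar → IsMacLane G')
    (h : NoCutVertex G) {u v : V} (huv : u ≠ v) (hs : Separates G {u, v}) : IsMacLane G := by
  obtain ⟨X, ⟨x, hx⟩, hXK, ⟨y, hyX, hyK⟩, hadj⟩ := hs
  have hu : u ∉ X := fun h => hXK u h (by simp)
  have hv : v ∉ X := fun h => hXK v h (by simp)
  let Y : Set V := {w | w ∉ X ∧ w ∉ ({u, v} : Set V)}
  have key : ∀ Y : Set V, Y.Nonempty → u ∉ Y → v ∉ Y →
      (∀ a ∈ Y, ∀ b, G.Adj a b → b ∈ Y ∨ b ∈ ({u, v} : Set V)) →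
      IsMacLane (addEdge (G.within Yᶜ) u v) := by
    intro Y hY hu hv hcl
    refine hI Yᶜ (fun he => ?_) _ (fun a b hab => ?_) (hG.comap_side h huv hY hu hv hcl)
    · obtain ⟨y, hy⟩ := hY
      exact he.ge (Set.mem_univ y) hy
    · rcases addEdge_adj.1 hab with h | ⟨⟨rfl, rfl⟩ | ⟨rfl, rfl⟩, -⟩
      · exact h.2.1
      · exact hu
      · exact hv
  have hXcl : ∀ a ∈ X, ∀ b, G.Adj a b → b ∈ X ∨ b ∈ ({u, v} : Set V) := by
    intro a ha b hab
    by_contra hn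
    rw [not_or] at hn
    exact hadj a ha b hn.1 hn.2 hab
  have hYcl : ∀ a ∈ Y, ∀ b, G.Adj a b → b ∈ Y ∨ b ∈ ({u, v} : Set V) := by
    intro a ha b hab
    by_cases hb : b ∈ X
    · exact (hXcl b hb a hab.symm).elim (fun h => absurd h ha.1) (fun h => absurd h ha.2)
    · exact or_iff_not_imp_right.2 fun h => ⟨hb, h⟩
  have huY : u ∉ Y := fun h => h.2 (by simp)
  have hvY : v ∉ Y := fun h => h.2 (by simp)
  have hsep : ∀ Y : Set V, u ∉ Y → v ∉ Y → ∀ a b, (addEdge (G.within Yᶜ) u v).Adj a b → a ∉ Y := by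
    intro Y hu hv a b hab
    rcases addEdge_adj.1 hab with h | ⟨⟨rfl, rfl⟩ | ⟨rfl, rfl⟩, -⟩
    · exact h.2.1
    · exact hu
    · exact hv
  have hE : ∀ Y : Set V, (addEdge (G.within Yᶜ) u v).Adj u v :=
    fun Y => addEdge_adj.2 (Or.inr ⟨Or.inl ⟨rfl, rfl⟩, huv⟩)
  refine IsMacLane.mono ((key X ⟨x, hx⟩ hu hv hXcl).sup (u := u) (v := v)
    (key Y ⟨y, hyX, hyK⟩ huY hvY hYcl) ?_ (Or.inr ⟨hE X, hE Y⟩)) ?_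
  · intro w a b ha hb
    have h₁ := hsep X hu hv w a ha
    by_contra hn
    exact hsep Y huY hvY w b hb ⟨h₁, hn⟩
  · intro a b hab
    have hXa := hXcl a
    have hXb := hXcl b
    by_cases ha : a ∈ X
    · exact Or.inr (addEdge_adj.2 (Or.inl ⟨hab, fun h => h.1 ha, fun h =>
        (hXcl a ha b hab).elim h.1 h.2⟩))
    · by_cases hb : b ∈ X
      · exact Or.inr (addEdge_adj.2 (Or.inl ⟨hab, fun h =>
          (hXcl b hb a hab.symm).elim h.1 h.2, fun h => h.1 hb⟩))
      · exact Or.inl (addEdge_adj.2 (Or.inl ⟨hab, ha, hb⟩))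

end SmallSeparations

section Contractible

variable {V : Type*} [Fintype V] {G : SimpleGraph V} {K X : Set V}

/-- `X` is a union of components of the complement of `K`, neither empty nor everything. -/
def Splits (G : SimpleGraph V) (K X : Set V) : Prop :=
  X.Nonempty ∧ (∀ v ∈ X, v ∉ K) ∧ (∃ v, v ∉ X ∧ v ∉ K) ∧
    ∀ u ∈ X, ∀ v, v ∉ X → v ∉ K → ¬ G.Adj u v

theorem Splits.compl (h : Splits G K X) : Splits G K {v | v ∉ X ∧ v ∉ K} := by
  obtain ⟨⟨x, hx⟩, hXK, ⟨y, hy, hyK⟩, hadj⟩ := h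
  refine ⟨⟨y, hy, hyK⟩, fun v hv => hv.2, ⟨x, fun h => h.1 hx, hXK x hx⟩,
    fun u hu v hv hvK huv => ?_⟩
  have hvX : v ∈ X := by
    by_contra hn
    exact hv ⟨hn, hvK⟩
  exact hadj v hvX u hu.1 hu.2 huv.symm

/-- Every sufficiently large graph without 2-separations has an edge that is in no 3-separation. -/
theorem exists_contractible (hG : ∃ a b, G.Adj a b) (hsep : ∀ a b, ¬ Separates G {a, b}) :
    ∃ x y, G.Adj x y ∧ ∀ z, ¬ Separates G {x, y, z} := by
  by_contra hn
  push Not at hn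
  have hex : ∀ x y, G.Adj x y → ∃ z, z ≠ x ∧ z ≠ y ∧ Separates G {x, y, z} := by
    intro x y hxy
    obtain ⟨z, hz⟩ := hn x y hxy
    refine ⟨z, ?_, ?_, hz⟩
    · rintro rfl
      refine hsep z y ?_
      have : ({z, y, z} : Set V) = {z, y} := by grind
      rwa [this] at hz
    · rintro rfl
      refine hsep x z ?_
      have : ({x, z, z} : Set V) = {x, z} := by grind
      rwa [this] at hz
  have key : ∀ n, ∀ x y z Y, G.Adj x y → z ≠ x → z ≠ y → Splits G {x, y, z} Y →
      Y.ncard = n → False := by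
    intro n
    induction n using Nat.strong_induction_on with
    | _ n ih =>
    intro x y z Y hxy hzx hzy hY hn
    obtain ⟨hYn, hYK, ⟨o, hoY, hoK⟩, hYadj⟩ := id hY
    obtain ⟨u, hu, huz⟩ : ∃ u ∈ Y, G.Adj u z := by
      by_contra hno
      push Not at hno
      refine hsep x y ⟨Y, hYn, fun v hv h => hYK v hv (by grind), ⟨o, hoY, by grind⟩,
        fun u hu v hv hvK huv => ?_⟩
      by_cases hvz : v = z
      · exact hno u hu (hvz ▸ huv)
      · exact hYadj u hu v hv (by grind) huv
    obtain ⟨w, hwz, hwu, R, hR⟩ := hex z u huz.symm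
    have hux := hYK u hu
    obtain ⟨Q, hQ, hxQ, hyQ⟩ : ∃ Q, Splits G {z, u, w} Q ∧ x ∉ Q ∧ y ∉ Q := by
      by_cases hxR : x ∈ R
      · refine ⟨_, Splits.compl hR, fun h => h.1 hxR, fun h => ?_⟩
        exact hR.2.2.2 x hxR y h.1 h.2 hxy
      · by_cases hyR : y ∈ R
        · refine ⟨_, Splits.compl hR, fun h => ?_, fun h => h.1 hyR⟩
          exact hR.2.2.2 y hyR x h.1 h.2 hxy.symm
        · exact ⟨R, hR, hxR, hyR⟩
    obtain ⟨⟨q, hq⟩, hQK, ⟨o', hoQ, hoK'⟩, hQadj⟩ := hQ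
    have huQ : u ∉ Q := fun h => hQK u h (by simp)
    by_cases hne : (Q ∩ Y).Nonempty
    · refine ih (Q ∩ Y).ncard ?_ z u w (Q ∩ Y) huz.symm hwz hwu
        ⟨hne, fun v hv => hQK v hv.1, ⟨o', fun h => hoQ h.1, hoK'⟩, ?_⟩ rfl
      · rw [← hn]
        exact Set.ncard_lt_ncard
          ⟨Set.inter_subset_right, fun h => huQ (h hu).1⟩ (Set.toFinite Y)
      · intro a ha b hb hbK hab
        by_cases hbQ : b ∈ Q
        · refine hYadj a ha.2 b (fun h => hb ⟨hbQ, h⟩) (fun h => ?_) hab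
          have := hQK b hbQ
          grind
        · exact hQadj a ha.1 b hbQ hbK hab
    · refine hsep z w ⟨Q, ⟨q, hq⟩, fun v hv h => hQK v hv (by grind), ⟨u, huQ, ?_⟩,
        fun a ha b hb hbK hab => ?_⟩
      · have := huz.ne
        grind
      · by_cases hbu : b = u
        · subst hbu
          refine hYadj b hu a (fun h => hne ⟨a, ha, h⟩) ?_ hab.symm
          have := hQK a ha
          grind
        · exact hQadj a ha b hb (by grind) hab
  obtain ⟨a, b, hab⟩ := hG
  obtain ⟨z, hzx, hzy, Y, hY⟩ := hex a b hab
  exact key _ a b z Y hab hzx hzy hY rfl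

end Contractible

section Hub

variable {U : Type*} [Fintype U] {H : SimpleGraph U} {N : Set U}

/-- Adding a new vertex adjacent to the vertices in `N`. -/
def hub (H : SimpleGraph U) (N : Set U) : SimpleGraph (Option U) where
  Adj
  | some a, some b => H.Adj a b
  | some a, none => a ∈ N
  | none, some b => b ∈ N
  | none, none => False
  symm := ⟨fun a b h => by
    cases a <;> cases b
    · exact h
    · exact h
    · exact h
    · exact H.adj_symm h⟩
  loopless := ⟨fun a h => by
    cases a
    · exact h
    · exact H.irrefl h⟩

@[simp] theorem hub_adj_some_some {a b : U} : (hub H N).Adj (some a) (some b) ↔ H.Adj a b := Iff.rfl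

theorem NoCutVertex.exists_adj_ne (h : NoCutVertex H) (hU : 2 < Fintype.card U) (a b : U) :
    ∃ c, c ≠ b ∧ H.Adj a c := by
  have h1 : ∀ b, b ≠ a → ∃ c, c ≠ b ∧ H.Adj a c := by
    intro b hba
    obtain ⟨⟨d, hda⟩, hdb⟩ := Fintype.exists_ne_of_one_lt_card
      (α := {d // d ≠ a}) (by rw [Fintype.card_subtype_compl]; simp; omega) ⟨b, hba⟩
    obtain ⟨a', ha', c, -, hcb, hadj⟩ := h b {a} (fun h => hba h) ⟨a, rfl⟩
      ⟨d, hda, fun h => hdb (Subtype.ext h)⟩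
    obtain rfl : a' = a := ha'
    exact ⟨c, hcb, hadj⟩
  by_cases hba : b = a
  · obtain ⟨d, hd⟩ := Fintype.exists_ne_of_one_lt_card (by omega) a
    obtain ⟨c, -, hc⟩ := h1 d hd
    exact ⟨c, hba ▸ hc.ne', hc⟩
  · exact h1 b hba

theorem NoCutVertex.hub (h : NoCutVertex H) (hU : 2 < Fintype.card U)
    (hN : ∃ a ∈ N, ∃ b ∈ N, a ≠ b) : NoCutVertex (hub H N) := by
  obtain ⟨a, ha, b, hb, hab⟩ := hN
  have hpick : ∀ v, ∃ c ∈ N, c ≠ v := by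
    intro v
    by_cases hav : a = v
    · exact ⟨b, hb, hav ▸ hab.symm⟩
    · exact ⟨a, ha, hav⟩
  rintro (_ | v) X hv ⟨x, hx⟩ ⟨w, hw, hwv⟩
  · obtain ⟨x, rfl⟩ := Option.ne_none_iff_exists'.1 fun he => hv (he ▸ hx)
    obtain ⟨w, rfl⟩ := Option.ne_none_iff_exists'.1 hwv
    have hxw : x ≠ w := by
      rintro rfl
      exact hw hx
    obtain ⟨z, hzx, hzw⟩ : ∃ z, z ≠ x ∧ z ≠ w := by
      obtain ⟨⟨d, hd⟩, hdw⟩ := Fintype.exists_ne_of_one_lt_card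
        (α := {d // d ≠ x}) (by rw [Fintype.card_subtype_compl]; simp; omega) ⟨w, hxw.symm⟩
      exact ⟨d, hd, fun h => hdw (Subtype.ext h)⟩
    obtain ⟨p, hp, q, hq, hqz, hpq⟩ := h z {y | some y ∈ X ∧ y ≠ z} (fun h => h.2 rfl)
      ⟨x, hx, hzx.symm⟩ ⟨w, fun h => hw h.1, hzw.symm⟩
    exact ⟨some p, hp.1, some q, fun h => hq ⟨h, hqz⟩, by simp, hpq⟩
  · have hsome : (∃ y, some y ∈ X) → (∃ w, some w ∉ X ∧ w ≠ v) →
        ∃ p ∈ X, ∃ q, q ∉ X ∧ q ≠ some v ∧ (SimpleGraph.hub H N).Adj p q := by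
      intro hy ⟨w, hw, hwv⟩
      obtain ⟨p, hp, q, hq, hqv, hpq⟩ := h v {y | some y ∈ X} hv hy ⟨w, hw, hwv⟩
      exact ⟨some p, hp, some q, hq, fun h => hqv (Option.some_injective _ h), hpq⟩
    obtain ⟨c, hc, hcv⟩ := hpick v
    by_cases hnX : none ∈ X
    · obtain ⟨w, rfl⟩ := Option.ne_none_iff_exists'.1 fun he : w = none => hw (he ▸ hnX)
      by_cases hy : ∃ y, some y ∈ X
      · exact hsome hy ⟨w, hw, fun h => hwv (congrArg some h)⟩
      · exact ⟨none, hnX, some c, fun h => hy ⟨c, h⟩, fun h => hcv (Option.some_injective _ h), hc⟩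
    · obtain ⟨x, rfl⟩ := Option.ne_none_iff_exists'.1 fun he => hnX (he ▸ hx)
      by_cases hw' : ∃ w, some w ∉ X ∧ w ≠ v
      · exact hsome ⟨x, hx⟩ hw'
      · push Not at hw'
        refine ⟨some c, ?_, none, hnX, by simp, hc⟩
        by_contra hcX
        exact hcv (hw' c hcX)

/-- Deleting the hub produces a face whose boundary contains all neighbours of the hub. -/
theorem IsMacLane.exists_hub_face (hM : IsMacLane (hub H N)) (h : NoCutVertex H)
    (hU : 2 < Fintype.card U) (hN : ∃ a ∈ N, ∃ b ∈ N, a ≠ b) :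
    ∃ C, HasFace H C ∧ ∀ a ∈ N, ∃ b, C a b ≠ 0 := by
  have hM' := h.hub hU hN
  obtain ⟨a₀, ha₀, -⟩ := hN
  obtain ⟨ι, _, φ, hφ⟩ := hM
  let S : Set ι := {i | ∃ a ∈ N, φ none (some a) = i ∨ φ (some a) none = i}
  let r : ι → ι := fun i => if i ∈ S then φ none (some a₀) else i
  have hr : ∀ i ∈ S, r i = φ none (some a₀) := fun i hi => if_pos hi
  have hS₁ : ∀ a ∈ N, φ none (some a) ∈ S := fun a ha => ⟨a, ha, Or.inl rfl⟩
  have hS₂ : ∀ a ∈ N, φ (some a) none ∈ S := fun a ha => ⟨a, ha, Or.inr rfl⟩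
  let ψ : U → U → ι := fun a b => r (φ (some a) (some b))
  have hcob : ∀ s a b, cob H ψ s a b = cob (hub H N) φ (s ∘ r) (some a) (some b) :=
    fun s a b => by simp only [cob, hub_adj_some_some, Function.comp, ψ]
  have hsymm : ∀ s p q, cob (hub H N) φ s p q = cob (hub H N) φ s q p :=
    fun s => (hφ.isEven s).symm
  have hnone : ∀ s p, cob (hub H N) φ (s ∘ r) p none = 0 := by
    rintro s (_ | a)
    · exact (hφ.isEven _).eq_zero ((hub H N).irrefl)
    · rw [cob]
      split_ifs with ha
      · rw [Function.comp, Function.comp, hr _ (hS₁ a ha), hr _ (hS₂ a ha), zmod_two_add_self]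
      · rfl
  have hψ : IsFaceLabelling H ψ := by
    refine ⟨fun s => ⟨⟨fun a b => by rw [hcob, hcob, hsymm], fun a b hab => ?_⟩, fun a => ?_⟩,
      fun Z hZ => ?_⟩
    · by_contra hn
      exact hab (if_neg hn)
    · have := bdry_comp (Option.some_injective U) (D := cob (hub H N) φ (s ∘ r))
        (fun p q hpq => by
          cases q with
          | none => exact absurd (hnone s p) hpq
          | some b => exact ⟨b, rfl⟩) a
      simp only [← hcob] at this
      rw [(hφ.isEven _).bdry_eq] at this
      exact this
    · let Z' : Option U → Option U → ZMod 2
        | some a, some b => Z a b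
        | _, _ => 0
      have hZ' : IsEven (hub H N) Z' := by
        refine ⟨⟨?_, ?_⟩, ?_⟩
        · rintro (_ | a) (_ | b)
          · rfl
          · rfl
          · rfl
          · exact hZ.symm a b
        · rintro (_ | a) (_ | b) hab
          · exact absurd rfl hab
          · exact absurd rfl hab
          · exact absurd rfl hab
          · exact hZ.supp a b hab
        · rintro (_ | a)
          · exact Finset.sum_eq_zero fun q _ => rfl
          · rw [← bdry_comp (Option.some_injective U) (D := Z')]
            · exact hZ.bdry_eq a
            · rintro (_ | a) (_ | b) hab
              · exact absurd rfl hab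
              · exact ⟨b, rfl⟩
              · exact absurd rfl hab
              · exact ⟨b, rfl⟩
      obtain ⟨t, ht⟩ := hφ.span Z' hZ'
      have ht0 : ∀ q, cob (hub H N) φ t none q = 0 := fun q => by rw [ht]
      have hconst : ∀ i ∈ S, t i = t (φ none (some a₀)) := by
        rintro i ⟨a, ha, rfl | rfl⟩
        · exact hφ.eq_at_vertex hM' ht0 ha ha₀
        · rw [← hφ.eq_at_vertex hM' ht0 (a := some a) (b := some a₀) ha ha₀]
          have h0 := ht0 (some a)
          rw [cob_apply _ (show (hub H N).Adj none (some a) from ha)] at h0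
          exact (zmod_two_add_eq_zero.1 h0).symm
      have htr : t ∘ r = t := by
        funext i
        simp only [Function.comp, r]
        split_ifs with hi
        · exact (hconst i hi).symm
        · rfl
      refine ⟨t, ?_⟩
      funext a b
      rw [hcob, htr, ht]
  refine ⟨_, ⟨ι, inferInstance, ψ, hψ, φ none (some a₀), rfl⟩, fun a ha => ?_⟩
  by_contra hn
  push Not at hn
  have hvS : ∀ i, (Pi.single (φ none (some a₀)) (1 : ZMod 2) ∘ r) i = 1 ↔ i ∈ S := by
    intro i
    simp only [Function.comp, r, Pi.single_apply]
    by_cases hi : i ∈ S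
    · simp [hi]
    · have : i ≠ φ none (some a₀) := fun he => hi (he ▸ hS₁ a₀ ha₀)
      simp [hi, this]
  have hv : ∀ q, cob (hub H N) φ (Pi.single (φ none (some a₀)) 1 ∘ r) (some a) q = 0 := by
    rintro (_ | b)
    · exact hnone _ _
    · rw [← hcob]
      exact hn b
  obtain ⟨b, -, hb⟩ := h.exists_adj_ne hU a a
  obtain ⟨c, hcb, hc⟩ := h.exists_adj_ne hU a b
  refine hψ.ne_of_adj h hb hc hcb.symm ?_
  have e₁ := hφ.eq_at_vertex hM' hv (a := none) (b := some b) ha hb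
  have e₂ := hv (some b)
  rw [cob_apply _ (show (hub H N).Adj (some a) (some b) from hb), zmod_two_add_eq_zero] at e₂
  have h₁ := (hvS _).2 (hS₂ a ha)
  rw [e₁] at h₁
  have h₂ := h₁
  rw [e₂] at h₂
  exact (hr _ ((hvS _).1 h₁)).trans (hr _ ((hvS _).1 h₂)).symm

end Hub

section Cycles

variable {V : Type*} {G : SimpleGraph V} {C : V → V → ZMod 2} {m : ℕ} {c : ℕ → V}

/-- `c` runs periodically around a cycle of length `m` whose edges form the chain `C`. -/
structure IsCyclic (C : V → V → ZMod 2) (m : ℕ) (c : ℕ → V) : Prop where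
  three_le : 3 ≤ m
  periodic : ∀ k, c (k + m) = c k
  inj : ∀ i j, c i = c j → i ≡ j [MOD m]
  sum_eq : ∑ k ∈ Finset.range m, single (c k) (c (k + 1)) = C

theorem IsCyclic.shift (h : IsCyclic C m c) (r : ℕ) : IsCyclic C m fun k => c (k + r) := by
  induction r with
  | zero => exact h
  | succ r ih =>
    refine ⟨ih.three_le, fun k => ?_, fun i j hij => ?_, ?_⟩
    · have := ih.periodic (k + 1)
      convert this using 2 <;> omega
    · refine Nat.ModEq.add_right_cancel' 1 (ih.inj (i + 1) (j + 1) ?_)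
      convert hij using 2 <;> omega
    · refine Eq.trans ?_ ih.sum_eq
      have h₁ := Finset.sum_range_succ' (fun k => single (c (k + r)) (c (k + 1 + r))) m
      rw [Finset.sum_range_succ] at h₁
      have h₂ : single (c (m + r)) (c (m + 1 + r)) = single (c (0 + r)) (c (0 + 1 + r)) := by
        have e₁ := ih.periodic 0
        have e₂ := ih.periodic 1
        beta_reduce at e₁ e₂
        rw [zero_add m] at e₁
        rw [e₁, ← e₂, add_comm 1 m]
      rw [h₂] at h₁
      rw [add_right_cancel h₁]
      refine Finset.sum_congr rfl fun k _ => ?_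
      rw [add_right_comm k 1 r, add_assoc k r 1, add_right_comm (k + 1) 1 r, add_assoc (k + 1) r 1]

variable [Fintype V]

theorem IsEven.exists_next (hC : IsEven G C) {u v : V} (huv : C u v ≠ 0) :
    ∃ w, w ≠ u ∧ C v w ≠ 0 := by
  by_contra hn
  push Not at hn
  have := hC.bdry_eq v
  rw [bdry, Finset.sum_eq_single u (fun w _ hw => hn w hw) (by simp), hC.symm] at this
  exact huv this

theorem HasFace.exists_isCyclic (hC : HasFace G C) (h : NoCutVertex G) (h0 : C ≠ 0) :
    ∃ m c, IsCyclic C m c := by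
  obtain ⟨ι, _, φ, hφ, i, hi⟩ := hC
  have hev : IsEven G C := hi ▸ hφ.isEven _
  obtain ⟨a, b, hab⟩ : ∃ a b, C a b ≠ 0 := by
    by_contra hn
    push Not at hn
    exact h0 (funext fun a => funext fun b => hn a b)
  have hnext : ∀ p : {p : V × V // C p.1 p.2 ≠ 0}, ∃ w, w ≠ p.1.1 ∧ C p.1.2 w ≠ 0 :=
    fun p => hev.exists_next p.2
  choose nx hnx hnxC using hnext
  let st : ℕ → {p : V × V // C p.1 p.2 ≠ 0} := fun n =>
    n.rec ⟨(a, b), hab⟩ fun _ p => ⟨(p.1.2, nx p), hnxC p⟩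
  obtain ⟨d, hd⟩ : ∃ d : ℕ → V, d = fun n => (st n).1.1 := ⟨_, rfl⟩
  have hdC : ∀ n, C (d n) (d (n + 1)) ≠ 0 := fun n => hd ▸ (st n).2
  have hd2 : ∀ n, d (n + 2) ≠ d n := fun n => hd ▸ hnx (st n)
  clear_value st
  clear hd hab
  have hrep : ∃ p, 0 < p ∧ ∃ i, d i = d (i + p) := by
    obtain ⟨i, j, hij, he⟩ := Finite.exists_ne_map_eq_of_infinite d
    rcases lt_or_gt_of_ne hij with h | h
    · exact ⟨j - i, by omega, i, by rw [he]; congr 1; omega⟩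
    · exact ⟨i - j, by omega, j, by rw [← he]; congr 1; omega⟩
  let m := Nat.find hrep
  obtain ⟨hm0, i₀, hi₀⟩ := Nat.find_spec hrep
  have hmin : ∀ p, 0 < p → p < m → ∀ i, d i ≠ d (i + p) := by
    intro p hp hpm i he
    exact Nat.find_min hrep hpm ⟨hp, i, he⟩
  change 0 < m at hm0
  change d i₀ = d (i₀ + m) at hi₀
  clear_value m
  have hm3 : 3 ≤ m := by
    by_contra hlt
    have : m = 1 ∨ m = 2 := by omega
    rcases this with rfl | rfl
    · have h1 := hdC i₀
      rw [← hi₀] at h1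
      exact G.irrefl (hev.supp _ _ h1)
    · exact hd2 i₀ hi₀.symm
  let c : ℕ → V := fun k => d (i₀ + k % m)
  have hck : ∀ k ≤ m, c k = d (i₀ + k) := by
    intro k hk
    rcases hk.lt_or_eq with hk | rfl
    · simp only [c, Nat.mod_eq_of_lt hk]
    · simp only [c, Nat.mod_self, add_zero, hi₀]
  have hinj : ∀ i j, c i = c j → i ≡ j [MOD m] := by
    have key : ∀ i j, i < j → j < m → d (i₀ + i) ≠ d (i₀ + j) := by
      intro i j hij hj he
      refine hmin (j - i) (by omega) (by omega) (i₀ + i) (he.trans ?_)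
      congr 1
      omega
    intro i j hij
    by_contra hn
    rcases lt_or_gt_of_ne hn with hlt | hlt
    · exact key _ _ hlt (Nat.mod_lt _ hm0) hij
    · exact key _ _ hlt (Nat.mod_lt _ hm0) hij.symm
  have hcC : ∀ k < m, C (c k) (c (k + 1)) ≠ 0 := by
    intro k hk
    rw [hck k hk.le, hck (k + 1) hk]
    exact hdC (i₀ + k)
  refine ⟨m, c, hm3, fun k => by simp [c], hinj, ?_⟩
  have hchain : ∀ n ≤ m, IsEdgeChain G (∑ k ∈ Finset.range n, single (c k) (c (k + 1))) ∧
      ∀ v, bdry (∑ k ∈ Finset.range n, single (c k) (c (k + 1))) v =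
        (if v = c 0 then 1 else 0) + if v = c n then 1 else 0 := by
    intro n hn
    induction n with
    | zero =>
      refine ⟨by simpa using IsEdgeChain.zero, fun v => ?_⟩
      simp [zmod_two_add_self]
    | succ n ih =>
      obtain ⟨ih₁, ih₂⟩ := ih (by omega)
      have hadj := hev.supp _ _ (hcC n (by omega))
      rw [Finset.sum_range_succ]
      refine ⟨ih₁.add (isEdgeChain_single hadj), fun v => ?_⟩
      rw [bdry_add, ih₂, bdry_single hadj.ne, add_assoc, ← add_assoc (ite (v = c n) 1 0),
        zmod_two_add_self, zero_add]
  obtain ⟨h₁, h₂⟩ := hchain m le_rfl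
  have hcm : c m = c 0 := by simp [c]
  rw [← hi]
  refine hφ.eq_face_of_le h ⟨h₁, fun v => by rw [h₂, hcm, zmod_two_add_self]⟩ (fun hz => ?_) ?_
  · have := congrFun (congrFun hz (c 0)) (c 1)
    rw [Finset.sum_apply, Finset.sum_apply, Finset.sum_eq_single 0] at this
    · rw [Pi.zero_apply, Pi.zero_apply] at this
      exact (single_ne_zero_iff.2 (Or.inl ⟨rfl, rfl⟩)) this
    · intro k hk hk0
      by_contra hs
      rw [Finset.mem_range] at hk
      rcases single_ne_zero_iff.1 hs with ⟨e, -⟩ | ⟨e, e'⟩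
      · have := hinj _ _ e
        rw [Nat.ModEq, Nat.zero_mod, Nat.mod_eq_of_lt hk] at this
        omega
      · have e1 := hinj _ _ e
        have e2 := hinj _ _ e'
        rw [Nat.ModEq, Nat.mod_eq_of_lt hk, Nat.mod_eq_of_lt (by omega)] at e2
        subst e2
        rw [Nat.ModEq, Nat.zero_mod, Nat.mod_eq_of_lt (by omega)] at e1
        omega
    · intro h
      exact absurd (Finset.mem_range.2 hm0) h
  · intro u v huv
    rw [Finset.sum_apply, Finset.sum_apply] at huv
    obtain ⟨k, hk, hs⟩ := Finset.exists_ne_zero_of_sum_ne_zero huv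
    rw [Finset.mem_range] at hk
    rw [hi]
    rcases single_ne_zero_iff.1 hs with ⟨rfl, rfl⟩ | ⟨rfl, rfl⟩
    · exact hcC k hk
    · rw [hev.symm]
      exact hcC k hk

end Cycles

section Fan

variable {V : Type*} [Fintype V] {G : SimpleGraph V}

theorem single_eq_one {a b u v : V} (h : (u = a ∧ v = b) ∨ (u = b ∧ v = a)) :
    single a b u v = 1 := if_pos h

theorem single_eq_zero {a b u v : V} (h : ¬ ((u = a ∧ v = b) ∨ (u = b ∧ v = a))) :
    single a b u v = 0 := if_neg h

/-- Drawing a new vertex inside a face and joining it to all vertices of a path on the boundary. -/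
theorem HasFace.exists_fan {c : ℕ → V} {x : V} {a b : ℕ} (hab : a < b) :
    ∀ {D : V → V → ZMod 2},
    HasFace G (D + ∑ j ∈ Finset.Ico a b, single (c j) (c (j + 1))) →
    (∀ v, ¬ G.Adj x v) → (∀ i j, a ≤ i → i < j → j ≤ b → c i ≠ c j) →
    (∀ j, a ≤ j → j ≤ b → c j ≠ x) → (∀ v, D x v = 0) →
    (∀ j, a ≤ j → j < b → D (c j) (c (j + 1)) = 0) →
    ∃ G' : SimpleGraph V, G ≤ G' ∧ (∀ v, G'.Adj x v ↔ ∃ j, a ≤ j ∧ j ≤ b ∧ v = c j) ∧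
      (∀ u v, u ≠ x → v ≠ x → G'.Adj u v → G.Adj u v) ∧
      HasFace G' (D + single x (c a) + single x (c b)) := by
  induction b, hab using Nat.le_induction with
  | base =>
    intro D hF hx hinj hcx hDx hD
    rw [Nat.succ_eq_add_one, Nat.Ico_succ_singleton, Finset.sum_singleton] at hF
    have hxa := (hcx a le_rfl (by omega)).symm
    have hxb := (hcx (a + 1) (by omega) le_rfl).symm
    have hE := hF.ear (x := x) (a := c a) (b := c (a + 1)) (by
      rw [Pi.add_apply, Pi.add_apply, hD a le_rfl (by omega), single_eq_one (by simp)]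
      decide) hx
    refine ⟨addEdge (addEdge G x (c a)) x (c (a + 1)), le_sup_left.trans le_sup_left,
      fun v => ?_, fun u v hu hv huv => ?_, ?_⟩
    · rw [addEdge_adj, addEdge_adj]
      constructor
      · rintro ((h | h) | h)
        · exact absurd h (hx v)
        · exact ⟨a, le_rfl, by omega, by grind⟩
        · exact ⟨a + 1, by omega, le_rfl, by grind⟩
      · rintro ⟨j, h₁, h₂, rfl⟩
        have : j = a ∨ j = a + 1 := by omega
        rcases this with rfl | rfl
        · exact Or.inl (Or.inr (by grind -ring -linarith))
        · exact Or.inr (by grind -ring -linarith)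
    · rw [addEdge_adj, addEdge_adj] at huv
      grind -ring -linarith
    · convert hE using 1
      funext u v
      simp only [tri, Pi.add_apply, single_comm (c (a + 1)) x, Nat.succ_eq_add_one]
      generalize D u v = p, single x (c a) u v = q, single x (c (a + 1)) u v = r,
        single (c a) (c (a + 1)) u v = s
      revert p q r s; decide
  | succ b hab ih =>
    have hab : a < b := hab
    intro D hF hx hinj hcx hDx hD
    rw [Finset.sum_Ico_succ_top (by omega), ← add_assoc, add_right_comm] at hF
    have hxa := (hcx a le_rfl (by omega)).symm
    have hxb := (hcx b (by omega) (by omega)).symm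
    have hxb' := (hcx (b + 1) (by omega) (by omega)).symm
    have hbb := hinj b (b + 1) (by omega) (by omega) le_rfl
    have hab' := hinj a b le_rfl (by omega) (by omega)
    obtain ⟨G', hle, hadj, hadj', hF'⟩ := ih hF hx (fun i j h₁ h₂ h₃ => hinj i j h₁ h₂ (by omega))
      (fun j h₁ h₂ => hcx j h₁ (by omega))
      (fun v => by
        rw [Pi.add_apply, Pi.add_apply, hDx, single_eq_zero (by grind -ring -linarith), add_zero])
      (fun j h₁ h₂ => by
        have := hinj j b h₁ h₂ (by omega)
        have := hinj j (b + 1) h₁ (by omega) le_rfl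
        rw [Pi.add_apply, Pi.add_apply, hD j h₁ (by omega),
          single_eq_zero (by grind -ring -linarith), add_zero])
    have hE := hF'.corner (a := x) (b := c b) (c := c (b + 1)) (by
        simp only [Pi.add_apply]
        rw [hDx, single_eq_zero (by grind -ring -linarith),
          single_eq_zero (by grind -ring -linarith), single_eq_one (by grind -ring -linarith)]
        simp) (by
        simp only [Pi.add_apply]
        rw [hD b (by omega) (by omega), single_eq_one (by grind -ring -linarith),
          single_eq_zero (by grind -ring -linarith),
          single_eq_zero (by grind -ring -linarith)]
        simp) hxb' (by
        rw [hadj]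
        rintro ⟨j, h₁, h₂, h₃⟩
        exact hinj j (b + 1) h₁ (by omega) le_rfl h₃.symm)
    refine ⟨addEdge G' x (c (b + 1)), hle.trans le_sup_left, fun v => ?_,
      fun u v hu hv huv => ?_, ?_⟩
    · rw [addEdge_adj, hadj]
      constructor
      · rintro (⟨j, h₁, h₂, rfl⟩ | h)
        · exact ⟨j, h₁, by omega, rfl⟩
        · exact ⟨b + 1, by omega, le_rfl, by grind⟩
      · rintro ⟨j, h₁, h₂, rfl⟩
        by_cases hj : j = b + 1
        · subst hj
          exact Or.inr (by grind -ring -linarith)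
        · exact Or.inl ⟨j, h₁, by omega, rfl⟩
    · refine hadj' u v hu hv ?_
      rw [addEdge_adj] at huv
      grind -ring -linarith
    · convert hE using 1
      funext u v
      simp only [tri, Pi.add_apply, single_comm (c (b + 1)) x]
      generalize D u v = p, single x (c a) u v = q, single x (c b) u v = r,
        single (c b) (c (b + 1)) u v = s, single x (c (b + 1)) u v = t
      linear_combination -zmod_two_add_self r - zmod_two_add_self s

end Fan

section CyclicPositions

variable {V : Type*} [Fintype V] {G : SimpleGraph V} {C : V → V → ZMod 2} {m : ℕ} {c : ℕ → V}

theorem IsCyclic.apply_eq (h : IsCyclic C m c) {i j : ℕ} (hij : i ≡ j [MOD m]) : c i = c j := by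
  have hp : Function.Periodic c m := h.periodic
  rw [← hp.map_mod_nat i, ← hp.map_mod_nat j, hij]

theorem IsCyclic.exists_mem_window (h : IsCyclic C m c) (i s : ℕ) :
    ∃ k, s ≤ k ∧ k < s + m ∧ c k = c i := by
  have hm := h.three_le
  have hlt := Nat.mod_lt (i + (m - 1) * s) (show 0 < m by omega)
  refine ⟨s + (i + (m - 1) * s) % m, by omega, by omega, h.apply_eq ?_⟩
  calc s + (i + (m - 1) * s) % m ≡ s + (i + (m - 1) * s) [MOD m] :=
        Nat.ModEq.add_left _ (Nat.mod_modEq _ _)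
    _ = i + m * s := by
        obtain ⟨n, rfl⟩ : ∃ n, m = n + 1 := ⟨m - 1, by omega⟩
        simp only [Nat.add_sub_cancel]; ring
    _ ≡ i [MOD m] := by simp [Nat.ModEq]

theorem IsCyclic.eq_of_window (h : IsCyclic C m c) {i k l : ℕ} (hik : i ≤ k) (hkm : k < i + m)
    (hil : i ≤ l) (hlm : l < i + m) (hkl : c k = c l) : k = l := by
  have h₁ := h.inj k l hkl
  rcases le_total k l with hle | hle
  · have := (Nat.modEq_iff_dvd' hle).1 h₁
    have := Nat.eq_zero_of_dvd_of_lt this (by omega)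
    omega
  · have := (Nat.modEq_iff_dvd' hle).1 h₁.symm
    have := Nat.eq_zero_of_dvd_of_lt this (by omega)
    omega

theorem IsCyclic.apply_ne_zero (h : IsCyclic C m c) (k : ℕ) : C (c k) (c (k + 1)) ≠ 0 := by
  have hm := h.three_le
  rw [← (h.shift k).sum_eq, Finset.sum_apply, Finset.sum_apply,
    Finset.sum_eq_single_of_mem 0 (Finset.mem_range.2 (by omega))]
  · rw [single_ne_zero_iff]
    exact Or.inl ⟨by simp, by rw [show 0 + 1 + k = k + 1 by omega]⟩
  · intro j hj hj0
    rw [Finset.mem_range] at hj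
    refine single_eq_zero ?_
    rintro (⟨h₁, -⟩ | ⟨h₁, h₂⟩)
    · have := h.eq_of_window (i := k) (by omega) (by omega) (by omega) (by omega) h₁
      omega
    · have := h.eq_of_window (i := k) (by omega) (by omega) (by omega) (by omega) h₂
      obtain rfl : j = 1 := by omega
      have := h.eq_of_window (i := k) (by omega) (by omega) (by omega) (by omega) h₁
      omega

theorem IsCyclic.exists_apply_eq (h : IsCyclic C m c) {a b : V} (hab : C a b ≠ 0) :
    ∃ k, c k = a := by
  rw [← h.sum_eq, Finset.sum_apply, Finset.sum_apply] at hab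
  obtain ⟨k, -, hk⟩ := Finset.exists_ne_zero_of_sum_ne_zero hab
  rcases single_ne_zero_iff.1 hk with ⟨h₁, -⟩ | ⟨h₁, -⟩
  · exact ⟨k, h₁.symm⟩
  · exact ⟨k + 1, h₁.symm⟩

/-- The vertices of `c` at the positions from `a` up to, but not including, `b`. -/
def arc (c : ℕ → V) (a b : ℕ) : Set V := {v | ∃ k, a ≤ k ∧ k < b ∧ c k = v}

theorem linked_arc (hc : ∀ k, G.Adj (c k) (c (k + 1))) {a b : ℕ} (hab : a < b) :
    Linked G (arc c a b) := by
  induction b, hab using Nat.le_induction with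
  | base =>
    convert linked_singleton (c a)
    ext v
    constructor
    · rintro ⟨k, h₁, h₂, rfl⟩
      rw [show k = a by omega]; rfl
    · rintro rfl
      exact ⟨a, le_rfl, by omega, rfl⟩
  | succ b hab ih =>
    have hb : c (b - 1) ∈ arc c a b := ⟨b - 1, by omega, by omega, rfl⟩
    have hadj := (hc (b - 1))
    rw [show b - 1 + 1 = b by omega] at hadj
    convert ih.insert hb hadj.symm using 1
    ext v
    constructor
    · rintro ⟨k, h₁, h₂, rfl⟩
      by_cases hk : k = b
      · exact Or.inl (by rw [hk])
      · exact Or.inr ⟨k, h₁, by omega, rfl⟩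
    · rintro (rfl | ⟨k, h₁, h₂, rfl⟩)
      · exact ⟨b, by omega, by omega, rfl⟩
      · exact ⟨k, h₁, by omega, rfl⟩

theorem left_mem_arc {a b : ℕ} (h : a < b) : c a ∈ arc c a b := ⟨a, le_rfl, h, rfl⟩

theorem last_mem_arc {a b : ℕ} (h : a < b) : c (b - 1) ∈ arc c a b :=
  ⟨b - 1, by omega, by omega, rfl⟩

theorem exists_adj_arc (hc : ∀ k, G.Adj (c k) (c (k + 1))) {a b d : ℕ} (hab : a < b)
    (hbd : b < d) : ∃ u ∈ arc c a b, ∃ v ∈ arc c b d, G.Adj u v := by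
  refine ⟨_, last_mem_arc hab, _, left_mem_arc hbd, ?_⟩
  have := hc (b - 1)
  rwa [show b - 1 + 1 = b by omega] at this

theorem IsCyclic.exists_adj_arc (h : IsCyclic C m c) (hc : ∀ k, G.Adj (c k) (c (k + 1)))
    {a b d : ℕ} (hab : a < b) (hdm : d < a + m) : ∃ u ∈ arc c a b, ∃ v ∈ arc c d (a + m),
      G.Adj u v := by
  refine ⟨_, left_mem_arc hab, _, last_mem_arc hdm, ?_⟩
  have := hc (a + m - 1)
  rw [show a + m - 1 + 1 = a + m by have := h.three_le; omega, h.periodic] at this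
  exact this.symm

theorem IsCyclic.eq_of_mem_arc (h : IsCyclic C m c) {i a b a' b' : ℕ} {v : V} (ha : i ≤ a)
    (hb : b ≤ a') (hb' : b' ≤ i + m) (hv : v ∈ arc c a b)
    (hv' : v ∈ arc c a' b') : False := by
  obtain ⟨k, h₁, h₂, rfl⟩ := hv
  obtain ⟨l, h₃, h₄, hl⟩ := hv'
  have := h.eq_of_window (i := i) (by omega) (by omega) (by omega) (by omega) hl
  omega

theorem IsCyclic.not_alternating (h : IsCyclic C m c) (hG : G.IsPlanar) {x y : V}
    (hc : ∀ k, G.Adj (c k) (c (k + 1))) (hxy : G.Adj x y) (hx : ∀ k, c k ≠ x)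
    (hy : ∀ k, c k ≠ y) {i j k l : ℕ} (hij : i < j) (hjk : j < k) (hkl : k < l) (hlm : l < i + m)
    (hi : G.Adj x (c i)) (hj : G.Adj y (c j)) (hk : G.Adj x (c k)) : ¬ G.Adj y (c l) := by
  intro hl
  have hxa : ∀ a b, x ∉ arc c a b := fun a b ⟨k, _, _, hk⟩ => hx k hk
  have hya : ∀ a b, y ∉ arc c a b := fun a b ⟨k, _, _, hk⟩ => hy k hk
  have hd : ∀ a b a' b', i ≤ a → b ≤ a' → a < b → a' < b' → b' ≤ i + m → ∀ v, v ∈ arc c a b →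
    v ∉ arc c a' b' := fun _ _ _ _ h₁ h₂ _ _ h₅ v hv hv' =>
      h.eq_of_mem_arc h₁ h₂ h₅ hv hv'
  have d₁ := hd i j j k le_rfl le_rfl hij hjk (by omega)
  have d₂ := hd i j k l le_rfl (by omega) hij hkl (by omega)
  have d₃ := hd i j l (i + m) le_rfl (by omega) hij hlm (by omega)
  have d₄ := hd j k k l (by omega) (by omega) hjk hkl (by omega)
  have d₅ := hd j k l (i + m) (by omega) (by omega) hjk hlm (by omega)
  have d₆ := hd k l l (i + m) (by omega) (by omega) hkl hlm (by omega)
  have hne := hxy.ne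
  refine hG.2 (hasMinor_iff.2 ⟨Sum.elim ![{x}, arc c j k, arc c l (i + m)]
    ![{y}, arc c i j, arc c k l], ?_, ?_, ?_⟩)
  · rintro (w | w) <;> fin_cases w
    · exact linked_singleton x
    · exact linked_arc hc hjk
    · exact linked_arc hc hlm
    · exact linked_singleton y
    · exact linked_arc hc hij
    · exact linked_arc hc hkl
  · rintro (w | w) (w' | w') v <;> fin_cases w <;> fin_cases w' <;>
      simp only [Sum.elim_inl, Sum.elim_inr, Fin.zero_eta, Fin.mk_one, Fin.reduceFinMk,
        Matrix.cons_val, Set.mem_singleton_iff] <;> grind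
  · have key : ∀ p q : Fin 3, ∃ a ∈ (![{x}, arc c j k, arc c l (i + m)] : Fin 3 → Set V) p,
        ∃ b ∈ (![{y}, arc c i j, arc c k l] : Fin 3 → Set V) q, G.Adj a b := by
      intro p q
      have sw : ∀ {S T : Set V}, (∃ a ∈ T, ∃ b ∈ S, G.Adj a b) → ∃ a ∈ S, ∃ b ∈ T, G.Adj a b :=
        fun ⟨a, ha, b, hb, hab⟩ => ⟨b, hb, a, ha, hab.symm⟩
      fin_cases p <;> fin_cases q
      · exact ⟨x, rfl, y, rfl, hxy⟩
      · exact ⟨x, rfl, _, left_mem_arc hij, hi⟩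
      · exact ⟨x, rfl, _, left_mem_arc hkl, hk⟩
      · exact ⟨_, left_mem_arc hjk, y, rfl, hj.symm⟩
      · exact sw (SimpleGraph.exists_adj_arc hc hij hjk)
      · exact SimpleGraph.exists_adj_arc hc hjk hkl
      · exact ⟨_, left_mem_arc hlm, y, rfl, hl.symm⟩
      · exact sw (h.exists_adj_arc hc hij hlm)
      · exact sw (SimpleGraph.exists_adj_arc hc hkl hlm)
    rintro (p | p) (q | q) hpq
    · simp [completeBipartiteGraph] at hpq
    · exact key p q
    · obtain ⟨a, ha, b, hb, hab⟩ := key q p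
      exact ⟨b, hb, a, ha, hab.symm⟩
    · simp [completeBipartiteGraph] at hpq

theorem IsCyclic.not_three_common (h : IsCyclic C m c) (hG : G.IsPlanar) {x y : V}
    (hc : ∀ k, G.Adj (c k) (c (k + 1))) (hxy : G.Adj x y) (hx : ∀ k, c k ≠ x)
    (hy : ∀ k, c k ≠ y) {i j k : ℕ} (hij : i < j) (hjk : j < k) (hkm : k < i + m)
    (hxi : G.Adj x (c i)) (hxj : G.Adj x (c j)) (hxk : G.Adj x (c k))
    (hyi : G.Adj y (c i)) (hyj : G.Adj y (c j)) : ¬ G.Adj y (c k) := by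
  intro hyk
  have hxa : ∀ a b, x ∉ arc c a b := fun a b ⟨k, _, _, hk⟩ => hx k hk
  have hya : ∀ a b, y ∉ arc c a b := fun a b ⟨k, _, _, hk⟩ => hy k hk
  have d₁ : ∀ v, v ∈ arc c i j → v ∉ arc c j k := fun v hv hv' =>
    h.eq_of_mem_arc le_rfl le_rfl (by omega) hv hv'
  have d₂ : ∀ v, v ∈ arc c i j → v ∉ arc c k (i + m) := fun v hv hv' =>
    h.eq_of_mem_arc le_rfl (by omega) le_rfl hv hv'
  have d₃ : ∀ v, v ∈ arc c j k → v ∉ arc c k (i + m) := fun v hv hv' =>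
    h.eq_of_mem_arc (i := i) (by omega) le_rfl le_rfl hv hv'
  have hne := hxy.ne
  have key : ∀ p q : Fin 5, p < q →
      ∃ a ∈ (![{x}, {y}, arc c i j, arc c j k, arc c k (i + m)] : Fin 5 → Set V) p,
      ∃ b ∈ (![{x}, {y}, arc c i j, arc c j k, arc c k (i + m)] : Fin 5 → Set V) q,
        G.Adj a b := by
    intro p q hpq
    fin_cases p <;> fin_cases q <;> try exact absurd hpq (by decide)
    · exact ⟨x, rfl, y, rfl, hxy⟩
    · exact ⟨x, rfl, _, left_mem_arc hij, hxi⟩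
    · exact ⟨x, rfl, _, left_mem_arc hjk, hxj⟩
    · exact ⟨x, rfl, _, left_mem_arc hkm, hxk⟩
    · exact ⟨y, rfl, _, left_mem_arc hij, hyi⟩
    · exact ⟨y, rfl, _, left_mem_arc hjk, hyj⟩
    · exact ⟨y, rfl, _, left_mem_arc hkm, hyk⟩
    · exact SimpleGraph.exists_adj_arc hc hij hjk
    · exact h.exists_adj_arc hc hij hkm
    · exact SimpleGraph.exists_adj_arc hc hjk hkm
  refine hG.1 (hasMinor_iff.2
    ⟨![{x}, {y}, arc c i j, arc c j k, arc c k (i + m)], ?_, ?_, ?_⟩)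
  · intro w
    fin_cases w
    · exact linked_singleton x
    · exact linked_singleton y
    · exact linked_arc hc hij
    · exact linked_arc hc hjk
    · exact linked_arc hc hkm
  · intro w w' v
    fin_cases w <;> fin_cases w' <;>
      simp only [Fin.zero_eta, Fin.mk_one, Fin.reduceFinMk, Matrix.cons_val,
        Set.mem_singleton_iff] <;> grind
  · intro p q hpq
    rcases lt_or_gt_of_ne hpq.ne with hlt | hlt
    · exact key p q hlt
    · obtain ⟨a, ha, b, hb, hab⟩ := key q p hlt
      exact ⟨b, hb, a, ha, hab.symm⟩

theorem IsCyclic.exists_split_of_not_adj (h : IsCyclic C m c) (hG : G.IsPlanar) {x y : V}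
    (hc : ∀ k, G.Adj (c k) (c (k + 1))) (hxy : G.Adj x y) (hx : ∀ k, c k ≠ x)
    (hy : ∀ k, c k ≠ y) (hX : ∃ i j, c i ≠ c j ∧ G.Adj x (c i) ∧ G.Adj x (c j)) {s : ℕ}
    (hys : G.Adj y (c s)) (hxs : ¬ G.Adj x (c s)) :
    ∃ r p, 0 < p ∧ p < m ∧ (∀ k < m, G.Adj x (c (k + r)) → k ≤ p) ∧
      ∀ k < m, G.Adj y (c (k + r)) → k = 0 ∨ p ≤ k := by
  obtain ⟨i, j, hij, hi, hj⟩ := hX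
  obtain ⟨i', hi₁, hi₂, hi'⟩ := h.exists_mem_window i s
  obtain ⟨j', hj₁, hj₂, hj'⟩ := h.exists_mem_window j s
  have hij' : i' ≠ j' := fun he => hij (by rw [← hi', ← hj', he])
  rw [← hi'] at hi
  rw [← hj'] at hj
  let S := (Finset.Ico s (s + m)).filter fun k => G.Adj x (c k)
  have hS : ∀ k, k ∈ S ↔ (s ≤ k ∧ k < s + m) ∧ G.Adj x (c k) := by simp [S]
  have hne : S.Nonempty := ⟨i', (hS _).2 ⟨⟨hi₁, hi₂⟩, hi⟩⟩
  obtain ⟨⟨hα₁, hα₂⟩, hα⟩ := (hS _).1 (S.min'_mem hne)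
  obtain ⟨⟨hβ₁, hβ₂⟩, hβ⟩ := (hS _).1 (S.max'_mem hne)
  have hmin : ∀ k, s ≤ k → k < s + m → G.Adj x (c k) → S.min' hne ≤ k ∧ k ≤ S.max' hne :=
    fun k h₁ h₂ h₃ => have hk := (hS k).2 ⟨⟨h₁, h₂⟩, h₃⟩
      ⟨S.min'_le _ hk, S.le_max' _ hk⟩
  generalize S.min' hne = α at *
  generalize S.max' hne = β at *
  have h₁ := hmin i' hi₁ hi₂ hi
  have h₂ := hmin j' hj₁ hj₂ hj
  have hsα : s < α := lt_of_le_of_ne hα₁ (by rintro rfl; exact hxs hα)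
  have hYt : ∀ t, α < t → t < β → ¬ G.Adj y (c t) := fun t h₁ h₂ ht =>
    h.not_alternating hG hc hxy hx hy h₁ h₂ hβ₂ (by omega) hα ht hβ
      (by rw [h.periodic]; exact hys)
  refine ⟨α, β - α, by omega, by omega, fun k hk hxk => ?_, fun k hk hyk => ?_⟩
  · by_contra hlt
    rcases lt_trichotomy (k + α) (s + m) with hs | hs | hs
    · have := hmin _ (by omega) hs hxk
      omega
    · rw [hs, h.periodic] at hxk
      exact hxs hxk
    · rw [show k + α = k + α - m + m by omega, h.periodic] at hxk
      have := hmin _ (by omega) (by omega) hxk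
      omega
  · by_contra! hlt
    exact hYt _ (by omega) (by omega) hyk

theorem IsCyclic.exists_split (h : IsCyclic C m c) (hG : G.IsPlanar) {x y : V}
    (hc : ∀ k, G.Adj (c k) (c (k + 1))) (hxy : G.Adj x y) (hx : ∀ k, c k ≠ x)
    (hy : ∀ k, c k ≠ y) (hX : ∃ i j, c i ≠ c j ∧ G.Adj x (c i) ∧ G.Adj x (c j))
    (hY : ∃ i j, c i ≠ c j ∧ G.Adj y (c i) ∧ G.Adj y (c j)) :
    ∃ r p, 0 < p ∧ p < m ∧ (∀ k < m, G.Adj x (c (k + r)) → k ≤ p) ∧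
      ∀ k < m, G.Adj y (c (k + r)) → k = 0 ∨ p ≤ k := by
  by_cases h₁ : ∃ s, G.Adj y (c s) ∧ ¬ G.Adj x (c s)
  · obtain ⟨s, hys, hxs⟩ := h₁
    exact h.exists_split_of_not_adj hG hc hxy hx hy hX hys hxs
  by_cases h₂ : ∃ s, G.Adj x (c s) ∧ ¬ G.Adj y (c s)
  · obtain ⟨s, hxs, hys⟩ := h₂
    obtain ⟨r, p, hp, hpm, hr₁, hr₂⟩ :=
      h.exists_split_of_not_adj hG hc hxy.symm hy hx hY hxs hys
    have hper : ∀ k, m ≤ k + p → c (k + (r + p)) = c (k + p - m + r) := fun k hk => by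
      rw [← h.periodic (k + p - m + r)]
      congr 1
      omega
    refine ⟨r + p, m - p, by omega, by omega, fun k hk hxk => ?_, fun k hk hyk => ?_⟩
    · by_cases hkp : m ≤ k + p
      · rw [hper k hkp] at hxk
        have := hr₂ _ (by omega) hxk
        omega
      · omega
    · by_cases hkp : m ≤ k + p
      · omega
      · rw [show k + (r + p) = k + p + r by omega] at hyk
        have := hr₁ _ (by omega) hyk
        omega
  push Not at h₁ h₂
  obtain ⟨i, j, hij, hi, hj⟩ := hX
  obtain ⟨j', hj₁, hj₂, hj'⟩ := h.exists_mem_window j i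
  rw [← hj'] at hj
  have hne : i ≠ j' := fun he => hij (by rw [he, hj'])
  have key : ∀ k < m, G.Adj x (c (k + i)) → k = 0 ∨ k = j' - i := by
    intro k hk hxk
    by_contra! hkj
    rcases lt_or_gt_of_ne hkj.2 with hlt | hlt
    · exact h.not_three_common hG hc hxy hx hy (show i < k + i by omega)
        (show k + i < j' by omega) hj₂ hi hxk hj (h₂ _ hi) (h₂ _ hxk) (h₂ _ hj)
    · exact h.not_three_common hG hc hxy hx hy (show i < j' by omega)
        (show j' < k + i by omega) (by omega) hi hj hxk (h₂ _ hi) (h₂ _ hj) (h₂ _ hxk)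
  refine ⟨i, j' - i, by omega, by omega, fun k hk hxk => ?_, fun k hk hyk => ?_⟩
  · have := key k hk hxk
    omega
  · have := key k hk (h₁ _ hyk)
    omega

end CyclicPositions

section Split

variable {V : Type*} [Fintype V] {G B : SimpleGraph V} {C : V → V → ZMod 2} {m p : ℕ} {c : ℕ → V}
  {x y : V}

theorem HasFace.isMacLane_of_split (hF : HasFace B C) (h : IsCyclic C m c) (hxy : x ≠ y)
    (hBx : ∀ v, ¬ B.Adj x v) (hBy : ∀ v, ¬ B.Adj y v) (hx : ∀ k, c k ≠ x) (hy : ∀ k, c k ≠ y)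
    (hp : 0 < p) (hpm : p < m)
    (hGB : ∀ u v, G.Adj u v → u ≠ x → u ≠ y → v ≠ x → v ≠ y → B.Adj u v)
    (hNx : ∀ v, G.Adj x v → v = y ∨ ∃ k ≤ p, v = c k)
    (hNy : ∀ v, G.Adj y v → v = x ∨ ∃ k, p ≤ k ∧ k ≤ m ∧ v = c k) : IsMacLane G := by
  have hm := h.three_le
  have hcm : c m = c 0 := by simpa using h.periodic 0
  have h0p : c 0 ≠ c p := fun he =>
    hp.ne (h.eq_of_window (i := 0) le_rfl (by omega) (by omega) (by omega) he)
  obtain ⟨D, hD⟩ : ∃ D, D = ∑ j ∈ Finset.Ico p m, single (c j) (c (j + 1)) := ⟨_, rfl⟩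
  have hDx : ∀ v, D x v = 0 := fun v => by
    rw [hD, Finset.sum_apply, Finset.sum_apply]
    refine Finset.sum_eq_zero fun j _ => single_eq_zero ?_
    rintro (⟨h₁, -⟩ | ⟨h₁, -⟩)
    exacts [hx _ h₁.symm, hx _ h₁.symm]
  have hDc : ∀ j, 0 ≤ j → j < p → D (c j) (c (j + 1)) = 0 := fun j _ hj => by
    rw [hD, Finset.sum_apply, Finset.sum_apply]
    refine Finset.sum_eq_zero fun i hi => single_eq_zero ?_
    rw [Finset.mem_Ico] at hi
    rintro (⟨h₁, -⟩ | ⟨h₁, h₂⟩)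
    · have := h.eq_of_window (i := 0) (by omega) (by omega) (by omega) (by omega) h₁
      omega
    · have := h.eq_of_window (i := 0) (by omega) (by omega) (by omega) (by omega) h₂
      obtain rfl : i = j + 1 := by omega
      have := h.eq_of_window (i := j) (by omega) (by omega) (by omega) (by omega) h₁
      omega
  have hF₀ : HasFace B (D + ∑ j ∈ Finset.Ico 0 p, single (c j) (c (j + 1))) := by
    rw [hD, add_comm, Finset.sum_Ico_consecutive _ (by omega) hpm.le, ← Finset.range_eq_Ico,
      h.sum_eq]
    exact hF
  obtain ⟨G₁, hle₁, hadj₁, hold₁, hF₁⟩ := hF₀.exists_fan hp hBx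
    (fun i j _ hij hj he => hij.ne
      (h.eq_of_window (i := 0) (by omega) (by omega) (by omega) (by omega) he))
    (fun j _ _ => hx j) hDx hDc
  have hF₁' : HasFace G₁ ((single x (c 0) + single x (c p)) +
      ∑ j ∈ Finset.Ico p m, single (c j) (c (j + 1))) := by
    rw [← hD]
    convert hF₁ using 1
    abel
  have hG₁y : ∀ v, ¬ G₁.Adj y v := fun v hv => by
    by_cases hvx : v = x
    · subst hvx
      obtain ⟨j, -, -, hj⟩ := (hadj₁ y).1 hv.symm
      exact hy j hj.symm
    · exact hBy v (hold₁ y v hxy.symm hvx hv)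
  have hne : ∀ k u v, u ≠ x → v ≠ x → single x (c k) u v = 0 := fun k u v hu hv =>
    single_eq_zero (by rintro (⟨h₁, -⟩ | ⟨-, h₁⟩); exacts [hu h₁, hv h₁])
  have hney : ∀ k v, single x (c k) y v = 0 := fun k v =>
    single_eq_zero (by rintro (⟨h₁, -⟩ | ⟨h₁, -⟩); exacts [hxy h₁.symm, hy k h₁.symm])
  obtain ⟨G₂, hle₂, hadj₂, -, hF₂⟩ := hF₁'.exists_fan hpm hG₁y
    (fun i j hi hij hj he => hij.ne
      (h.eq_of_window (i := p) (by omega) (by omega) (by omega) (by omega) he))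
    (fun j _ _ => hy j) (fun v => by simp [hney])
    (fun j _ _ => by simp [hne, hx])
  have hnxy : ¬ G₂.Adj x y := fun h => by
    obtain ⟨j, -, -, hj⟩ := (hadj₂ x).1 h.symm
    exact hx j hj.symm
  have hnex : ∀ k v, single y (c k) x v = 0 := fun k v =>
    single_eq_zero (by rintro (⟨h₁, -⟩ | ⟨h₁, -⟩); exacts [hxy h₁, hx k h₁.symm])
  have hF₃ := hF₂.corner (a := x) (b := c p) (c := y) (by
      have h₁ : single x (c 0) x (c p) = 0 :=
        single_eq_zero (by rintro (⟨-, h₁⟩ | ⟨h₁, -⟩); exacts [h0p h₁.symm, hx _ h₁.symm])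
      have h₂ : single x (c p) x (c p) = 1 := single_eq_one (Or.inl ⟨rfl, rfl⟩)
      simp [h₁, h₂, hnex]) (by
      have h₁ : single y (c m) (c p) y = 0 :=
        single_eq_zero (by
          rw [hcm]; rintro (⟨h₁, -⟩ | ⟨h₁, -⟩); exacts [hy _ h₁, h0p h₁.symm])
      have h₂ : single y (c p) (c p) y = 1 := single_eq_one (Or.inr ⟨rfl, rfl⟩)
      simp [h₁, h₂, hne, hx, hxy.symm]) hxy hnxy
  have hax : ∀ v, G.Adj x v → (addEdge G₂ x y).Adj x v := fun v hv => by
    rw [addEdge_adj]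
    rcases hNx v hv with rfl | ⟨k, hk, rfl⟩
    · exact Or.inr ⟨Or.inl ⟨rfl, rfl⟩, hxy⟩
    · exact Or.inl (hle₂ ((hadj₁ _).2 ⟨k, Nat.zero_le _, hk, rfl⟩))
  have hay : ∀ v, G.Adj y v → (addEdge G₂ x y).Adj y v := fun v hv => by
    rw [addEdge_adj]
    rcases hNy v hv with rfl | ⟨k, hk, hkm, rfl⟩
    · exact Or.inr ⟨Or.inr ⟨rfl, rfl⟩, hxy.symm⟩
    · exact Or.inl ((hadj₂ _).2 ⟨k, hk, hkm, rfl⟩)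
  refine hF₃.isMacLane.mono fun u v huv => ?_
  by_cases hux : u = x
  · subst hux; exact hax v huv
  by_cases huy : u = y
  · subst huy; exact hay v huv
  by_cases hvx : v = x
  · subst hvx; exact (hax u huv.symm).symm
  by_cases hvy : v = y
  · subst hvy; exact (hay u huv.symm).symm
  exact addEdge_adj.2 (Or.inl (hle₂ (hle₁ (hGB u v huv hux huy hvx hvy))))

end Split

section ThreeConnected

variable {V : Type u} [Fintype V] {G : SimpleGraph V} {C : V → V → ZMod 2}

theorem HasFace.supp (hC : HasFace G C) {a b : V} (hab : C a b ≠ 0) : G.Adj a b := by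
  obtain ⟨ι, hι, φ, hφ, i, hi⟩ := hC
  have hCe : IsEven G C := hi ▸ hφ.isEven _
  exact hCe.supp _ _ hab

theorem NoCutVertex.comap_val (x y : V) (hsep : ∀ z, ¬ Separates G {x, y, z}) :
    NoCutVertex (G.comap (Subtype.val : {v // v ≠ x ∧ v ≠ y} → V)) := by
  intro v X hvX hX ⟨w, hwX, hwv⟩
  by_contra hn
  push Not at hn
  refine hsep v ⟨Subtype.val '' X, hX.image _, ?_, ⟨w, ?_, ?_⟩, ?_⟩
  · rintro _ ⟨u, hu, rfl⟩ h
    rcases h with h | h | h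
    · exact u.2.1 h
    · exact u.2.2 h
    · exact hvX (Subtype.ext h ▸ hu)
  · rintro ⟨u, hu, he⟩
    exact hwX (Subtype.ext he ▸ hu)
  · rintro (h | h | h)
    · exact w.2.1 h
    · exact w.2.2 h
    · exact hwv (Subtype.ext h)
  · rintro _ ⟨u, hu, rfl⟩ b hb hbK
    simp only [Set.mem_insert_iff, Set.mem_singleton_iff, not_or] at hbK
    exact hn u hu ⟨b, hbK.1, hbK.2.1⟩ (fun h => hb ⟨_, h, rfl⟩)
      (fun h => hbK.2.2 (congrArg Subtype.val h))

/-- Contracting the edge `xy` yields a hub joined to the other neighbours of `x` and `y`. -/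
theorem hasMinor_hub {x y : V} (hxy : G.Adj x y) :
    G.HasMinor (hub (G.comap (Subtype.val : {v // v ≠ x ∧ v ≠ y} → V))
      {a | G.Adj x a ∨ G.Adj y a}) := by
  have hQ : Linked G {x, y} :=
    (linked_singleton y).insert rfl hxy
  refine hasMinor_of_injective (f := fun o => o.elim x Subtype.val) (w₀ := none) (Q := {x, y})
    ?_ hQ (Or.inl rfl) ?_ ?_
  · rintro (_ | a) (_ | b) hab
    · rfl
    · exact absurd hab.symm b.2.1
    · exact absurd hab a.2.1
    · exact congrArg some (Subtype.ext hab)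
  · rintro (_ | a) ha
    · rfl
    · rcases ha with ha | ha
      · exact absurd ha a.2.1
      · exact absurd ha a.2.2
  · have key : ∀ a : {v // v ≠ x ∧ v ≠ y}, (G.Adj x a ∨ G.Adj y a) →
        ∃ b ∈ ({x, y} : Set V), G.Adj b a := by
      rintro a (h | h)
      · exact ⟨x, Or.inl rfl, h⟩
      · exact ⟨y, Or.inr rfl, h⟩
    rintro (_ | a) (_ | b) hab
    · exact absurd hab (by simp)
    · exact Or.inr (Or.inl ⟨rfl, key b hab⟩)
    · exact Or.inr (Or.inr ⟨rfl, key a hab⟩)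
    · exact Or.inl hab

theorem card_ne_and_ne {x y : V} (hxy : x ≠ y) :
    Fintype.card {v // v ≠ x ∧ v ≠ y} + 2 = Fintype.card V := by
  have h₁ : Fintype.card {v // v ≠ x ∧ v ≠ y} = ((Finset.univ.erase x).erase y).card :=
    Fintype.card_of_subtype _ (by simp [and_comm])
  have h₂ := Finset.card_erase_add_one (Finset.mem_univ x)
  have h₃ := Finset.card_erase_add_one (Finset.mem_erase.2 ⟨hxy.symm, Finset.mem_univ y⟩)
  rw [Finset.card_univ] at h₂
  omega

theorem HasFace.exists_val {x y : V} {C : {v // v ≠ x ∧ v ≠ y} → {v // v ≠ x ∧ v ≠ y} → ZMod 2}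
    {m : ℕ} {c : ℕ → {v // v ≠ x ∧ v ≠ y}}
    (hF : HasFace (G.comap (Subtype.val : {v // v ≠ x ∧ v ≠ y} → V)) C) (h : IsCyclic C m c) :
    ∃ C', HasFace (G.within {v | v ≠ x ∧ v ≠ y}) C' ∧ IsCyclic C' m fun k => (c k : V) := by
  have hs : ∀ a b u v : {v // v ≠ x ∧ v ≠ y}, single (a : V) b u v = single a b u v :=
    fun a b u v => by simp only [single, Subtype.ext_iff]
  refine ⟨∑ k ∈ Finset.range m, single (c k : V) (c (k + 1)), ?_,
    h.three_le, fun k => by rw [h.periodic], fun i j hij => h.inj i j (Subtype.ext hij), rfl⟩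
  refine HasFace.of_comap (f := (Subtype.val : {v // v ≠ x ∧ v ≠ y} → V)) Subtype.val_injective
    (G := G.within {v | v ≠ x ∧ v ≠ y})
    (fun u v huv => ⟨⟨u, huv.2.1⟩, rfl⟩) ⟨fun u v => ?_, fun u v huv => ?_⟩ ?_
  · simp only [Finset.sum_apply]
    exact Finset.sum_congr rfl fun k _ => single_symm _ _ _ _
  · simp only [Finset.sum_apply] at huv
    obtain ⟨k, -, hk⟩ := Finset.exists_ne_zero_of_sum_ne_zero huv
    have hadj : (G.within {v | v ≠ x ∧ v ≠ y}).Adj (c k) (c (k + 1)) :=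
      ⟨hF.supp (h.apply_ne_zero k), (c k).2, (c (k + 1)).2⟩
    rcases single_ne_zero_iff.1 hk with ⟨rfl, rfl⟩ | ⟨rfl, rfl⟩
    · exact hadj
    · exact hadj.symm
  · convert hF using 1
    · exact comap_within
    · rw [← h.sum_eq]
      funext a b
      simp only [Finset.sum_apply, hs]

theorem isMacLane_of_not_separates_pair (hG : G.IsPlanar) (hV : 4 < Fintype.card V)
    (hcut : NoCutVertex G) (hsep : ∀ a b, a ≠ b → ¬ Separates G {a, b})
    (hI : ∀ (W : Type u) [Fintype W] (H : SimpleGraph W), Fintype.card W < Fintype.card V →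
      H.IsPlanar → IsMacLane H) : IsMacLane G := by
  have hex : ∀ a b d : V, ∃ v, v ≠ a ∧ v ≠ b ∧ v ≠ d := fun a b d => by
    have h₁ : ({a, b, d} : Finset V).card < Fintype.card V :=
      Finset.card_le_three.trans_lt (by omega)
    obtain ⟨v, hv⟩ := Finset.exists_mem_notMem_of_card_lt_card (t := Finset.univ) h₁
    simp only [Finset.mem_insert, Finset.mem_singleton, not_or] at hv
    exact ⟨v, hv.2⟩
  have hsep' : ∀ a b, ¬ Separates G {a, b} := fun a b => by
    by_cases hab : a = b
    · subst hab
      rw [Set.pair_eq_singleton]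
      rintro ⟨X, hX, hXa, ⟨w, hw, hwa⟩, hadj⟩
      obtain ⟨u, hu, v, hv, hva, huv⟩ := hcut a X (fun h => hXa a h rfl) hX ⟨w, hw, hwa⟩
      exact hadj u hu v hv hva huv
    · exact hsep a b hab
  have hdeg : ∀ a b d, a ≠ b → a ≠ d → ∃ q, q ≠ b ∧ q ≠ d ∧ G.Adj a q := fun a b d hab had => by
    by_contra! hn
    obtain ⟨v, hva, hvb, hvd⟩ := hex a b d
    refine hsep' b d ⟨{a}, ⟨a, rfl⟩, ?_, ⟨v, hva, by simp [hvb, hvd]⟩, ?_⟩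
    · rintro _ rfl; simp [hab, had]
    · rintro _ rfl w - hw
      simp only [Set.mem_insert_iff, Set.mem_singleton_iff, not_or] at hw
      exact hn w hw.1 hw.2
  have hedge : ∃ a b, G.Adj a b := by
    obtain ⟨a⟩ : Nonempty V := Fintype.card_pos_iff.1 (by omega)
    obtain ⟨b, hb, -⟩ := hex a a a
    obtain ⟨q, -, -, hq⟩ := hdeg a b b hb.symm hb.symm
    exact ⟨a, q, hq⟩
  obtain ⟨x, y, hxy, hz⟩ := exists_contractible hedge hsep'
  have hnc := NoCutVertex.comap_val x y hz
  have hcard := card_ne_and_ne hxy.ne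
  have hnbr : ∀ a b, G.Adj a b → ∃ q q', q ≠ a ∧ q ≠ b ∧ q' ≠ a ∧ q' ≠ b ∧ q ≠ q' ∧
      G.Adj a q ∧ G.Adj a q' := fun a b hab => by
    obtain ⟨q, hqb, -, hq⟩ := hdeg a b b hab.ne hab.ne
    obtain ⟨q', hqb', hne, hq'⟩ := hdeg a b q hab.ne hq.ne
    exact ⟨q, q', hq.ne', hqb, hq'.ne', hqb', hne.symm, hq, hq'⟩
  obtain ⟨q₁, q₂, hq₁x, hq₁y, hq₂x, hq₂y, hq, hxq₁, hxq₂⟩ := hnbr x y hxy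
  obtain ⟨r₁, r₂, hr₁y, hr₁x, hr₂y, hr₂x, hr, hyr₁, hyr₂⟩ := hnbr y x hxy.symm
  have hhub := hI _ _ (by rw [Fintype.card_option]; omega) (hG.of_hasMinor (hasMinor_hub hxy))
  obtain ⟨C, hF, hCN⟩ := hhub.exists_hub_face hnc (by omega)
    ⟨⟨q₁, hq₁x, hq₁y⟩, Or.inl hxq₁, ⟨q₂, hq₂x, hq₂y⟩, Or.inl hxq₂,
      fun h => hq (congrArg Subtype.val h)⟩
  obtain ⟨m, c, hc⟩ := hF.exists_isCyclic hnc (by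
    rintro rfl
    obtain ⟨b, hb⟩ := hCN ⟨q₁, hq₁x, hq₁y⟩ (Or.inl hxq₁)
    exact hb rfl)
  have hon : ∀ v, v ≠ x → v ≠ y → (G.Adj x v ∨ G.Adj y v) → ∃ k, (c k : V) = v :=
    fun v hvx hvy hv => by
      obtain ⟨b, hb⟩ := hCN ⟨v, hvx, hvy⟩ hv
      obtain ⟨k, hk⟩ := hc.exists_apply_eq hb
      exact ⟨k, congrArg Subtype.val hk⟩
  have hadj : ∀ k, G.Adj (c k) (c (k + 1)) := fun k => hF.supp (hc.apply_ne_zero k)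
  obtain ⟨C', hF', hc'⟩ := hF.exists_val hc
  have hX : ∃ i j, (c i : V) ≠ c j ∧ G.Adj x (c i) ∧ G.Adj x (c j) := by
    obtain ⟨i, rfl⟩ := hon q₁ hq₁x hq₁y (Or.inl hxq₁)
    obtain ⟨j, rfl⟩ := hon q₂ hq₂x hq₂y (Or.inl hxq₂)
    exact ⟨i, j, hq, hxq₁, hxq₂⟩
  have hY : ∃ i j, (c i : V) ≠ c j ∧ G.Adj y (c i) ∧ G.Adj y (c j) := by
    obtain ⟨i, rfl⟩ := hon r₁ hr₁x hr₁y (Or.inr hyr₁)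
    obtain ⟨j, rfl⟩ := hon r₂ hr₂x hr₂y (Or.inr hyr₂)
    exact ⟨i, j, hr, hyr₁, hyr₂⟩
  obtain ⟨r, p, hp, hpm, hxp, hyp⟩ := hc'.exists_split hG hadj hxy (fun k => (c k).2.1)
    (fun k => (c k).2.2) hX hY
  have hcr := hc'.shift r
  have hwin : ∀ v, v ≠ x → v ≠ y → (G.Adj x v ∨ G.Adj y v) → ∃ k < m, (c (k + r) : V) = v :=
    fun v hvx hvy hv => by
      obtain ⟨i, rfl⟩ := hon v hvx hvy hv
      obtain ⟨k, hk₁, hk₂, hk⟩ := hc'.exists_mem_window i r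
      exact ⟨k - r, by omega, by rwa [Nat.sub_add_cancel hk₁]⟩
  refine hF'.isMacLane_of_split hcr hxy.ne (fun v h => h.2.1.1 rfl) (fun v h => h.2.1.2 rfl)
    (fun k => (c _).2.1) (fun k => (c _).2.2) hp hpm
    (fun u v huv h₁ h₂ h₃ h₄ => ⟨huv, ⟨h₁, h₂⟩, h₃, h₄⟩) (fun v hv => ?_) fun v hv => ?_
  · refine or_iff_not_imp_left.2 fun hvy => ?_
    obtain ⟨k, hk, rfl⟩ := hwin v hv.ne' hvy (Or.inl hv)
    exact ⟨k, hxp k hk hv, rfl⟩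
  · refine or_iff_not_imp_left.2 fun hvx => ?_
    obtain ⟨k, hk, rfl⟩ := hwin v hvx hv.ne' (Or.inr hv)
    rcases hyp k hk hv with rfl | hpk
    · exact ⟨m, hpm.le, le_rfl, by simpa using (hcr.periodic 0).symm⟩
    · exact ⟨k, hpk, hk.le, rfl⟩

theorem isMacLane_of_card_eq (n : ℕ) : ∀ (W : Type u) [Fintype W] (G : SimpleGraph W),
    Fintype.card W = n → G.IsPlanar → IsMacLane G := by
  induction n using Nat.strong_induction_on with
  | _ n ih =>
    intro V _ G hV hG
    have hI : ∀ (W : Type u) [Fintype W] (H : SimpleGraph W), Fintype.card W < Fintype.card V →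
        H.IsPlanar → IsMacLane H := fun W _ H hW hH => ih _ (hV ▸ hW) W H rfl hH
    have hI' : ∀ A : Set V, A ≠ Set.univ → ∀ G' : SimpleGraph V, (∀ a b, G'.Adj a b → a ∈ A) →
        (G'.comap (Subtype.val : A → V)).IsPlanar → IsMacLane G' := fun A hA G' hG' hp =>
      IsMacLane.of_comap Subtype.val_injective (fun u v huv => ⟨⟨u, hG' u v huv⟩, rfl⟩)
        (hI A _ (card_subtype_lt_of_ne_univ hA) hp)
    by_cases h4 : Fintype.card V ≤ 4
    · exact isMacLane_of_card_le_four h4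
    by_cases hcut : NoCutVertex G
    · by_cases hsep : ∃ a b, a ≠ b ∧ Separates G {a, b}
      · obtain ⟨a, b, hab, hs⟩ := hsep
        exact isMacLane_of_separates_pair hG hI' hcut hab hs
      · push Not at hsep
        exact isMacLane_of_not_separates_pair hG (by omega) hcut hsep hI
    · exact isMacLane_of_not_noCutVertex hG hI' hcut

theorem IsPlanar.isMacLane (hG : G.IsPlanar) : IsMacLane G :=
  isMacLane_of_card_eq _ V G rfl hG

end ThreeConnected

end SimpleGraph

theorem grunbaum_aksionov {V : Type*} [Fintype V] (G : SimpleGraph V)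
    (hplanar : G.IsPlanar)
    (htri : {t : Finset V | G.IsNClique 3 t}.ncard ≤ 3) :
    G.Colorable 3 :=
  hplanar.isMacLane.colorable htri
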